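/- Let φ be a semiflow on E satisfying (H1), (H2) with j = 2, (H3), (COM) and (S), and let w₀ ∈ E have bounded positive semi-orbit. If v₀ ∈ ω(w₀) is a periodic point, then ω(w₀) = γ(v₀). -/

import Mathlib

open Set Filter Topology MeasureTheory Bornology

/-- A semiflow on a Banach space `E`. -/
structure Semiflow (E : Type*) [NormedAddCommGroup E] [NormedSpace ℝ E] where
  toFun : ℝ → E → E
  map_zero' : ∀ v : E, toFun 0 v = v
  map_add' : ∀ t s : ℝ, 0 ≤ t → 0 ≤ s → ∀ v : E, toFun (t + s) v = toFun t (toFun s v)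
  continuousOn' : ContinuousOn (fun p : ℝ × E => toFun p.1 p.2) (Set.Ici (0 : ℝ) ×ˢ Set.univ)

/-- The open `r`-neighborhood `O_r(γ)` of a set `γ` in a normed space. -/
def setNbhd {E : Type*} [NormedAddCommGroup E] (γ : Set E) (r : ℝ) : Set E :=
  {v | ∃ w ∈ γ, ‖v - w‖ < r}

/-- `S` is an `ε`-section at `x₀` of the (partial) flow `ξ` on the set `M`. -/
def IsSectionOn {X : Type*} [TopologicalSpace X] (M : Set X) (ξ : ℝ → X → X)
    (ε : ℝ) (x₀ : X) (S : Set X) : Prop :=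
  x₀ ∈ S ∧ S ⊆ M ∧
    (∃ W : Set X, IsOpen W ∧ x₀ ∈ W ∧
      W ∩ M ⊆ ⋃ t ∈ Set.Icc (-ε) ε, ξ t '' S) ∧
    ∀ y ∈ ⋃ t ∈ Set.Icc (-ε) ε, ξ t '' S,
      ∃! p : ℝ × X, p.1 ∈ Set.Icc (-ε) ε ∧ p.2 ∈ S ∧ ξ p.1 p.2 = y

/-- `T` is an `ε`-transversal at `x₀` of the (partial) flow `ξ` on the set `M`:
an `ε`-section which is the image of a topological embedding of `[-1,1]`,
with `x₀` corresponding to an interior point. -/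
def IsTransversalOn {X : Type*} [TopologicalSpace X] (M : Set X) (ξ : ℝ → X → X)
    (ε : ℝ) (x₀ : X) (T : Set X) : Prop :=
  IsSectionOn M ξ ε x₀ T ∧
    ∃ h : ℝ → X, ContinuousOn h (Set.Icc (-1 : ℝ) 1) ∧ Set.InjOn h (Set.Icc (-1 : ℝ) 1) ∧
      h '' Set.Icc (-1 : ℝ) 1 = T ∧ ∃ s₀ ∈ Set.Ioo (-1 : ℝ) 1, h s₀ = x₀

namespace Semiflow

variable {E : Type*} [NormedAddCommGroup E] [NormedSpace ℝ E]
variable {H : Type*} [NormedAddCommGroup H] [InnerProductSpace ℝ H]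

/-- A stationary point of the semiflow. -/
def IsStationary (φ : Semiflow E) (v₀ : E) : Prop :=
  ∀ t : ℝ, 0 ≤ t → φ.toFun t v₀ = v₀

/-- A periodic (non-stationary) point of the semiflow. -/
def IsPeriodicPt (φ : Semiflow E) (v₀ : E) : Prop :=
  ¬ φ.IsStationary v₀ ∧ ∃ σ : ℝ, 0 < σ ∧ φ.toFun σ v₀ = v₀

/-- The positive semi-orbit `γ⁺(v₀)` (which equals the full orbit for periodic points). -/
def orbit (φ : Semiflow E) (v₀ : E) : Set E :=
  {w | ∃ t : ℝ, 0 ≤ t ∧ φ.toFun t v₀ = w}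

/-- `γ` is a periodic orbit of the semiflow. -/
def IsPeriodicOrbit (φ : Semiflow E) (γ : Set E) : Prop :=
  ∃ v₀ : E, φ.IsPeriodicPt v₀ ∧ γ = φ.orbit v₀

/-- The ω-limit set of a point. -/
def omegaLimit (φ : Semiflow E) (v₀ : E) : Set E :=
  ⋂ s ∈ Set.Ici (0 : ℝ), closure {w | ∃ t : ℝ, s ≤ t ∧ φ.toFun t v₀ = w}

/-- A complete trajectory of the semiflow. -/
def IsCompleteTrajectory (φ : Semiflow E) (v : ℝ → E) : Prop :=
  Continuous v ∧ ∀ t : ℝ, 0 ≤ t → ∀ s : ℝ, v (t + s) = φ.toFun t (v s)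

/-- The α-limit set of a complete trajectory. -/
def alphaLimitOf (φ : Semiflow E) (v : ℝ → E) : Set E :=
  ⋂ s ∈ Set.Iic (0 : ℝ), closure {w | ∃ t : ℝ, t ≤ s ∧ v t = w}

/-- Hypothesis (H1): `P` is symmetric and positive on `Eplus`, negative on `Eminus`,
with `E = Eplus ⊕ Eminus`. -/
def IsH1 (P : E →L[ℝ] E →L[ℝ] ℝ) (Eplus Eminus : Submodule ℝ E) : Prop :=
  (∀ v w : E, P v w = P w v) ∧ IsClosed (Eplus : Set E) ∧ IsClosed (Eminus : Set E) ∧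
    IsCompl Eplus Eminus ∧
    (∀ v ∈ Eplus, v ≠ 0 → 0 < P v v) ∧ (∀ v ∈ Eminus, v ≠ 0 → P v v < 0)

/-- Hypothesis (H3): squeezing with respect to `V(v) = ⟨v, Pv⟩`, with parameters
`δ > 0`, `τV ≥ 0`, `ν > 0`; the embedding `E ↪ H` is `ι`. -/
def IsH3 (φ : Semiflow E) (ι : E →L[ℝ] H) (P : E →L[ℝ] E →L[ℝ] ℝ) (δ τV ν : ℝ) : Prop :=
  0 < δ ∧ 0 ≤ τV ∧ 0 < ν ∧
    ∀ v₁ v₂ : E, ∀ l r : ℝ, 0 ≤ l → l ≤ r → τV ≤ r - l →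
      Real.exp (2 * ν * r) *
          P (φ.toFun r v₁ - φ.toFun r v₂) (φ.toFun r v₁ - φ.toFun r v₂) -
        Real.exp (2 * ν * l) *
          P (φ.toFun l v₁ - φ.toFun l v₂) (φ.toFun l v₁ - φ.toFun l v₂) ≤
      -δ * ∫ s in l..r, Real.exp (2 * ν * s) * ‖ι (φ.toFun s v₁) - ι (φ.toFun s v₂)‖ ^ 2

/-- Hypothesis (COM): some time-`τ` map takes bounded sets to precompact sets. -/
def IsCOM (φ : Semiflow E) : Prop :=
  ∃ τ : ℝ, 0 < τ ∧ ∀ B : Set E, IsBounded B → IsCompact (closure (φ.toFun τ '' B))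

/-- Hypothesis (S): a smoothing estimate from `H` to `E`. -/
def IsSmoothing (φ : Semiflow E) (ι : E →L[ℝ] H) : Prop :=
  ∃ τ C : ℝ, 0 ≤ τ ∧ 0 < C ∧
    ∀ v₁ v₂ : E, ‖φ.toFun τ v₁ - φ.toFun τ v₂‖ ≤ C * ‖ι v₁ - ι v₂‖

/-- An amenable trajectory: a complete trajectory with
`∫_{-∞}^0 e^{2νs} |v(s)|²_H ds < ∞`. -/
def IsAmenableTrajectory (φ : Semiflow E) (ι : E →L[ℝ] H) (ν : ℝ) (v : ℝ → E) : Prop :=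
  φ.IsCompleteTrajectory v ∧
    IntegrableOn (fun s : ℝ => Real.exp (2 * ν * s) * ‖ι (v s)‖ ^ 2) (Set.Iic (0 : ℝ))

/-- The amenable set `𝔄`: points through which an amenable trajectory passes. -/
def amenableSet (φ : Semiflow E) (ι : E →L[ℝ] H) (ν : ℝ) : Set E :=
  {v₀ | ∃ v : ℝ → E, φ.IsAmenableTrajectory ι ν v ∧ v 0 = v₀}

/-- Orbital stability of a set `γ`. -/
def IsOrbitallyStable (φ : Semiflow E) (γ : Set E) : Prop :=
  ∀ ε : ℝ, 0 < ε → ∃ δ : ℝ, 0 < δ ∧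
    ∀ v ∈ setNbhd γ δ, ∀ t : ℝ, 0 ≤ t → φ.toFun t v ∈ setNbhd γ ε

/-- Amenable stability: orbital stability with respect to initial data in `𝔄`. -/
def IsAmenableStable (φ : Semiflow E) (ι : E →L[ℝ] H) (ν : ℝ) (γ : Set E) : Prop :=
  ∀ ε : ℝ, 0 < ε → ∃ δ : ℝ, 0 < δ ∧
    ∀ v ∈ setNbhd γ δ ∩ φ.amenableSet ι ν, ∀ t : ℝ, 0 ≤ t → φ.toFun t v ∈ setNbhd γ ε

/-- Lyapunov stability of a stationary point. -/
def IsLyapunovStable (φ : Semiflow E) (v₀ : E) : Prop :=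
  ∀ ε : ℝ, 0 < ε → ∃ δ : ℝ, 0 < δ ∧
    ∀ v : E, ‖v - v₀‖ < δ → ∀ t : ℝ, 0 ≤ t → ‖φ.toFun t v - v₀‖ < ε

/-- `D` is a `k`-dimensional local unstable set for the stationary point `v₀`:
(U1) `D` is a homeomorphic image of an open `k`-cube; (U2) through every point of `D`
there is a unique complete trajectory, converging to `v₀` as `t → -∞`;
(U3) trajectories through points of `D` near `v₀` stay near `v₀` for `t ≤ 0`. -/
def IsLocalUnstableSet (φ : Semiflow E) (k : ℕ) (v₀ : E) (D : Set E) : Prop :=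
  v₀ ∈ D ∧
    Nonempty (↥(Set.pi Set.univ fun _ : Fin k => Set.Ioo (0 : ℝ) 1) ≃ₜ ↥D) ∧
    (∀ w₀ ∈ D, ∃! w : ℝ → E, φ.IsCompleteTrajectory w ∧ w 0 = w₀) ∧
    (∀ w₀ ∈ D, ∀ w : ℝ → E, φ.IsCompleteTrajectory w → w 0 = w₀ →
      Filter.Tendsto w Filter.atBot (nhds v₀)) ∧
    (∀ ε : ℝ, 0 < ε → ∃ δ : ℝ, 0 < δ ∧ ∀ w₀ ∈ D, ‖w₀ - v₀‖ < δ →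
      ∀ w : ℝ → E, φ.IsCompleteTrajectory w → w 0 = w₀ → ∀ t : ℝ, t ≤ 0 → ‖w t - v₀‖ < ε)

/-- An unstable terminal point: a stationary point with a 2-dimensional local unstable set. -/
def IsUnstableTerminal (φ : Semiflow E) (v₀ : E) : Prop :=
  φ.IsStationary v₀ ∧ ∃ D : Set E, φ.IsLocalUnstableSet 2 v₀ D

/-- A terminal point: a stationary point that is Lyapunov stable or has a
2-dimensional local unstable set. -/
def IsTerminal (φ : Semiflow E) (v₀ : E) : Prop :=
  φ.IsStationary v₀ ∧
    (φ.IsLyapunovStable v₀ ∨ ∃ D : Set E, φ.IsLocalUnstableSet 2 v₀ D)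

/-- An attractor: a bounded closed set with an open neighborhood all of whose points have
precompact positive semi-orbits with ω-limit sets inside the set. -/
def IsAttractor (φ : Semiflow E) (A : Set E) : Prop :=
  IsBounded A ∧ IsClosed A ∧
    ∃ U : Set E, IsOpen U ∧ A ⊆ U ∧
      ∀ v₀ ∈ U, IsCompact (closure (φ.orbit v₀)) ∧ φ.omegaLimit v₀ ⊆ A

/-- `Pi` is the `V`-orthogonal projector onto `Eminus`. -/
def IsVProjector (P : E →L[ℝ] E →L[ℝ] ℝ) (Eminus : Submodule ℝ E) (Pi : E → E) : Prop :=
  ∀ v : E, Pi v ∈ Eminus ∧ ∀ w ∈ Eminus, P w v = P w (Pi v)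

/-- The interior region `𝒢_γ ⊆ 𝔄` of a periodic orbit `γ`: the preimage under `Π`
of the bounded connected component of `E⁻ \ Πγ`. -/
def interiorRegion (φ : Semiflow E) (ι : E →L[ℝ] H) (ν : ℝ) (Eminus : Submodule ℝ E)
    (Pi : E → E) (γ : Set E) : Set E :=
  {a | a ∈ φ.amenableSet ι ν ∧ Pi a ∈ (Eminus : Set E) \ (Pi '' γ) ∧
    IsBounded (connectedComponentIn ((Eminus : Set E) \ (Pi '' γ)) (Pi a))}

/-- The partial order `γ₁ ⩽ γ₂` on periodic orbits: `𝒢_{γ₁} ⊆ 𝒢_{γ₂}`. -/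
def orbitLE (φ : Semiflow E) (ι : E →L[ℝ] H) (ν : ℝ) (Eminus : Submodule ℝ E)
    (Pi : E → E) (γ₁ γ₂ : Set E) : Prop :=
  φ.interiorRegion ι ν Eminus Pi γ₁ ⊆ φ.interiorRegion ι ν Eminus Pi γ₂

/-- External stability of a periodic orbit `γ`. -/
def IsExternallyStable (φ : Semiflow E) (ι : E →L[ℝ] H) (ν : ℝ) (Eminus : Submodule ℝ E)
    (Pi : E → E) (γ : Set E) : Prop :=
  (∃ g : ℕ → Set E, (∀ k, φ.IsPeriodicOrbit (g k)) ∧ (∀ k, g k ≠ γ) ∧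
      (∀ k, φ.orbitLE ι ν Eminus Pi γ (g k)) ∧
      Filter.Tendsto (fun k => Metric.hausdorffDist (g k) γ) Filter.atTop (nhds 0)) ∨
    (∃ v₀ ∈ φ.amenableSet ι ν \ closure (φ.interiorRegion ι ν Eminus Pi γ),
      φ.omegaLimit v₀ = γ)

/-- Internal stability of a periodic orbit `γ`. -/
def IsInternallyStable (φ : Semiflow E) (ι : E →L[ℝ] H) (ν : ℝ) (Eminus : Submodule ℝ E)
    (Pi : E → E) (γ : Set E) : Prop :=
  (∃ g : ℕ → Set E, (∀ k, φ.IsPeriodicOrbit (g k)) ∧ (∀ k, g k ≠ γ) ∧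
      (∀ k, φ.orbitLE ι ν Eminus Pi (g k) γ) ∧
      Filter.Tendsto (fun k => Metric.hausdorffDist (g k) γ) Filter.atTop (nhds 0)) ∨
    (∃ v₀ ∈ φ.interiorRegion ι ν Eminus Pi γ, φ.omegaLimit v₀ = γ)

end Semiflow

namespace PBend

/-- A continuous argument of a nonvanishing planar curve on an interval. -/
def IsArg (f : ℝ → ℂ) (α : ℝ → ℝ) (a b : ℝ) : Prop :=
  ContinuousOn α (Icc a b) ∧
    ∀ t ∈ Icc a b, f t ≠ 0 ∧ f t = (‖f t‖ : ℂ) * Complex.exp ((α t : ℂ) * Complex.I)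

lemma exists_arg_aux {X : Type*} [TopologicalSpace X] [SimplyConnectedSpace X]
    [LocallyPathConnectedSpace X] (x₀ : X) (F : X → ℂ) (hF : Continuous F) (h0 : ∀ x, F x ≠ 0) :
    ∃ A : X → ℝ, Continuous A ∧
      ∀ x, F x = (‖F x‖ : ℂ) * Complex.exp ((A x : ℂ) * Complex.I) := by
  obtain ⟨L, ⟨-, hL⟩, -⟩ := Complex.isCoveringMapOn_exp.existsUnique_continuousMap_lifts
    (⟨F, hF⟩ : C(X, ℂ)) (a₀ := x₀) (e₀ := Complex.log (F x₀)) (Complex.exp_log (h0 x₀)) h0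
  refine ⟨fun x => (L x).im, Complex.continuous_im.comp L.continuous, fun x => ?_⟩
  have h1 : Complex.exp (L x) = F x := congrFun hL x
  rw [← h1, Complex.norm_exp, Complex.ofReal_exp, ← Complex.exp_add, Complex.re_add_im]

lemma exists_arg2 (F : ℝ × ℝ → ℂ) (hF : Continuous F) (h0 : ∀ x, F x ≠ 0) :
    ∃ A : ℝ × ℝ → ℝ, Continuous A ∧
      ∀ x, F x = (‖F x‖ : ℂ) * Complex.exp ((A x : ℂ) * Complex.I) :=
  exists_arg_aux (0, 0) F hF h0

lemma exists_arg1 (F : ℝ → ℂ) (hF : Continuous F) (h0 : ∀ x, F x ≠ 0) :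
    ∃ A : ℝ → ℝ, Continuous A ∧
      ∀ x, F x = (‖F x‖ : ℂ) * Complex.exp ((A x : ℂ) * Complex.I) :=
  exists_arg_aux 0 F hF h0

/-- clamp to an interval -/
def clamp (a b t : ℝ) : ℝ := max a (min b t)

lemma continuous_clamp (a b : ℝ) : Continuous (clamp a b) := by
  unfold clamp; fun_prop

lemma clamp_mem {a b : ℝ} (hab : a ≤ b) (t : ℝ) : clamp a b t ∈ Icc a b := by
  unfold clamp; constructor
  · exact le_max_left _ _
  · exact max_le hab (min_le_left _ _)

lemma clamp_eq {a b t : ℝ} (ht : t ∈ Icc a b) : clamp a b t = t := by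
  unfold clamp; rw [min_eq_right ht.2, max_eq_right ht.1]

lemma IsArg.mono {f : ℝ → ℂ} {α : ℝ → ℝ} {a b c d : ℝ} (h : IsArg f α a b)
    (hc : a ≤ c) (hd : d ≤ b) : IsArg f α c d :=
  ⟨h.1.mono (Icc_subset_Icc hc hd), fun t ht => h.2 t (Icc_subset_Icc hc hd ht)⟩

lemma IsArg.congr {f g : ℝ → ℂ} {α : ℝ → ℝ} {a b : ℝ} (h : IsArg f α a b)
    (hfg : ∀ t ∈ Icc a b, g t = f t) : IsArg g α a b :=
  ⟨h.1, fun t ht => by rw [hfg t ht]; exact h.2 t ht⟩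

lemma IsArg.neg {f : ℝ → ℂ} {α : ℝ → ℝ} {a b : ℝ} (h : IsArg f α a b) :
    IsArg (fun t => - f t) (fun t => α t + Real.pi) a b := by
  refine ⟨h.1.add continuousOn_const, fun t ht => ⟨neg_ne_zero.2 (h.2 t ht).1, ?_⟩⟩
  have h1 : Complex.exp (((α t + Real.pi : ℝ) : ℂ) * Complex.I)
      = - Complex.exp ((α t : ℂ) * Complex.I) := by
    push_cast
    rw [add_mul, Complex.exp_add, Complex.exp_pi_mul_I]; ring
  rw [norm_neg, h1, mul_neg]
  exact congrArg _ (h.2 t ht).2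

lemma re_pos_of {a b : ℂ} (hne : a ≠ b) (hle : ‖b‖ ≤ ‖a‖) :
    0 < ((a - b) * (starRingEnd ℂ) a).re := by
  have h1 : 0 < Complex.normSq (a - b) := Complex.normSq_pos.2 (sub_ne_zero.2 hne)
  have h2 : ‖b‖ ^ 2 ≤ ‖a‖ ^ 2 := by gcongr
  rw [← Complex.normSq_eq_norm_sq, ← Complex.normSq_eq_norm_sq] at h2
  rw [Complex.normSq_apply] at *
  simp only [Complex.mul_re, Complex.sub_re, Complex.sub_im, Complex.conj_re, Complex.conj_im]
    at *
  rw [Complex.normSq_apply] at h2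
  nlinarith

/-- close curves have close argument increments -/
lemma arg_close {f₁ f₂ : ℝ → ℂ} {α₁ α₂ : ℝ → ℝ} {a b : ℝ} (hab : a ≤ b)
    (h₁ : IsArg f₁ α₁ a b) (h₂ : IsArg f₂ α₂ a b)
    (h : ∀ t ∈ Icc a b, ‖f₁ t - f₂ t‖ ≤ ‖f₂ t‖) :
    |(α₁ b - α₁ a) - (α₂ b - α₂ a)| ≤ Real.pi := by
  have hpi := Real.pi_pos
  have hcos : ∀ t ∈ Icc a b, Real.cos (α₁ t - α₂ t) ≠ 0 := by
    intro t ht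
    have hp : 0 < (f₁ t * (starRingEnd ℂ) (f₂ t)).re := by
      have := re_pos_of (a := f₂ t) (b := f₂ t - f₁ t)
        (fun h' => (h₁.2 t ht).1 (by simpa using h'.symm)) (by
          rw [norm_sub_rev]; exact h t ht)
      simpa using this
    rw [(h₁.2 t ht).2, (h₂.2 t ht).2] at hp
    intro hc
    have : ((‖f₁ t‖ : ℂ) * Complex.exp ((α₁ t : ℂ) * Complex.I) *
        (starRingEnd ℂ) ((‖f₂ t‖ : ℂ) * Complex.exp ((α₂ t : ℂ) * Complex.I))).re
        = ‖f₁ t‖ * ‖f₂ t‖ * Real.cos (α₁ t - α₂ t) := by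
      rw [map_mul, ← Complex.exp_conj, map_mul, Complex.conj_ofReal, Complex.conj_ofReal,
        Complex.conj_I]
      have : (‖f₁ t‖ : ℂ) * Complex.exp ((α₁ t : ℂ) * Complex.I) *
        ((‖f₂ t‖ : ℂ) * Complex.exp ((α₂ t : ℂ) * -Complex.I)) =
        ((‖f₁ t‖ * ‖f₂ t‖ : ℝ) : ℂ) * Complex.exp (((α₁ t - α₂ t : ℝ) : ℂ) * Complex.I) := by
        push_cast
        rw [sub_mul, sub_eq_add_neg, Complex.exp_add, mul_neg]; ring
      rw [this, Complex.re_ofReal_mul, Complex.exp_ofReal_mul_I_re]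
    rw [this, hc] at hp
    simp at hp
  by_contra hcon
  push Not at hcon
  have hcont : ContinuousOn (fun t => α₁ t - α₂ t) (Icc a b) := h₁.1.sub h₂.1
  set β := fun t => α₁ t - α₂ t with hβ
  have hI : uIcc (β a) (β b) ⊆ β '' Icc a b := by
    have := intermediate_value_uIcc (a := a) (b := b) (f := β) (by rwa [uIcc_of_le hab])
    rwa [uIcc_of_le hab] at this
  have hlen : Real.pi < max (β a) (β b) - min (β a) (β b) := by
    rw [max_sub_min_eq_abs]
    have : (α₁ b - α₁ a) - (α₂ b - α₂ a) = β b - β a := by simp only [hβ]; ring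
    rw [← this]; exact hcon
  set m := min (β a) (β b)
  set k : ℤ := ⌈(m - Real.pi / 2) / Real.pi⌉
  have hk1 : (m - Real.pi / 2) / Real.pi ≤ k := Int.le_ceil _
  have hk2 : (k : ℝ) < (m - Real.pi / 2) / Real.pi + 1 := Int.ceil_lt_add_one _
  rw [div_le_iff₀ hpi] at hk1
  have hk3 : (k : ℝ) * Real.pi < m - Real.pi / 2 + Real.pi := by
    have := mul_lt_mul_of_pos_right hk2 hpi
    rwa [add_mul, div_mul_cancel₀ _ hpi.ne', one_mul] at this
  have hmem : Real.pi / 2 + k * Real.pi ∈ uIcc (β a) (β b) := by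
    constructor
    · change m ≤ _; linarith
    · change _ ≤ max (β a) (β b); linarith
  obtain ⟨t, ht, hte⟩ := hI hmem
  apply hcos t ht
  change Real.cos (β t) = 0
  rw [hte, Real.cos_add_int_mul_pi, Real.cos_pi_div_two, mul_zero]

lemma int_of_exp {x y : ℝ}
    (h : Complex.exp ((x : ℂ) * Complex.I) = Complex.exp ((y : ℂ) * Complex.I)) :
    ∃ k : ℤ, x - y = 2 * Real.pi * k := by
  rw [Complex.exp_eq_exp_iff_exists_int] at h
  obtain ⟨k, hk⟩ := h
  refine ⟨k, ?_⟩
  have := congrArg Complex.im hk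
  simp at this
  linarith

lemma int_of_eq {z : ℂ} (hz : z ≠ 0) {x y : ℝ}
    (hx : z = (‖z‖ : ℂ) * Complex.exp ((x : ℂ) * Complex.I))
    (hy : z = (‖z‖ : ℂ) * Complex.exp ((y : ℂ) * Complex.I)) :
    ∃ k : ℤ, x - y = 2 * Real.pi * k := by
  apply int_of_exp
  have : (‖z‖ : ℂ) ≠ 0 := by simpa using hz
  exact mul_left_cancel₀ this (hx.symm.trans hy)

/-- curves whose increments are integer multiples of 2π and that are close -/
lemma int_eq_of_close {x y : ℝ} {m n : ℤ} (hx : x = 2 * Real.pi * m) (hy : y = 2 * Real.pi * n)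
    (h : |x - y| ≤ Real.pi) : m = n := by
  have hpi := Real.pi_pos
  rw [hx, hy, ← mul_sub, abs_mul, abs_of_pos (by positivity)] at h
  by_contra hne
  have h1 : (1 : ℤ) ≤ |m - n| := Int.one_le_abs (sub_ne_zero.2 hne)
  have h2 : (1 : ℝ) ≤ |(m : ℝ) - n| := by exact_mod_cast h1
  nlinarith

lemma const_of_int {X : Type*} [TopologicalSpace X] [PreconnectedSpace X] [Inhabited X]
    (f : X → ℝ)
    (hf : Continuous f) (hi : ∀ x, ∃ k : ℤ, f x = k) : ∃ k : ℤ, ∀ x, f x = k := by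
  choose g hg using hi
  have hc : Continuous g := by
    rw [Int.isClosedEmbedding_coe_real.isInducing.continuous_iff]
    convert hf using 1
    funext x; exact (hg x).symm
  refine ⟨g default, fun x => ?_⟩
  rw [hg x, PreconnectedSpace.constant inferInstance hc (x := x) (y := default)]

/-- bounded rotation -/
lemma arg_bdd {f : ℝ → ℂ} {a b m : ℝ} (hf : ContinuousOn f (Icc a b)) (hm : 0 < m) :
    ∃ C : ℝ, 0 ≤ C ∧ ∀ (z : ℂ) (α : ℝ → ℝ) (c d : ℝ), a ≤ c → c ≤ d → d ≤ b →
      IsArg (fun t => f t - z) α c d → (∀ t ∈ Icc c d, m ≤ ‖f t - z‖) →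
      |α d - α c| ≤ C := by
  have hpi := Real.pi_pos
  have huc := isCompact_Icc.uniformContinuousOn_of_continuous hf
  rw [Metric.uniformContinuousOn_iff_le] at huc
  obtain ⟨δ, hδ, hu⟩ := huc m hm
  have key : ∀ (N : ℕ) (z : ℂ) (α : ℝ → ℝ) (c d : ℝ), a ≤ c → c ≤ d → d ≤ b →
      IsArg (fun t => f t - z) α c d → (∀ t ∈ Icc c d, m ≤ ‖f t - z‖) →
      d - c ≤ N * δ → |α d - α c| ≤ N * Real.pi := by
    intro N
    induction N with
    | zero =>
      intro z α c d hc hcd hd _ _ hN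
      have : d = c := by simp at hN; linarith
      simp [this]
    | succ N ih =>
      intro z α c d hc hcd hd hα hz hN
      set e := max c (d - δ) with he
      have hce : c ≤ e := le_max_left _ _
      have hed : e ≤ d := max_le hcd (by linarith)
      have h1 := ih z α c e hc hce (by linarith) (hα.mono le_rfl hed)
        (fun t ht => hz t ⟨ht.1, ht.2.trans hed⟩) (by
          push_cast at hN
          rcases max_choice c (d - δ) with h | h
          · rw [he, h]; simp; positivity
          · rw [he, h]; linarith)
      have hα2 : IsArg (fun t => f t - z) α e d := hα.mono hce le_rfl
      have hdde : d - e ≤ δ := by have := le_max_right c (d - δ); linarith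
      have hconst : IsArg (fun _ => f e - z) (fun _ => α e) e d :=
        ⟨continuousOn_const, fun t ht => hα2.2 e ⟨le_rfl, hed⟩⟩
      have h2 := arg_close hed hα2 hconst (fun t ht => by
        have h3 := hu t ⟨by linarith [ht.1], by linarith [ht.2]⟩ e ⟨by linarith, by linarith⟩
          (by rw [Real.dist_eq, abs_le]; constructor <;> linarith [ht.1, ht.2])
        rw [dist_eq_norm] at h3
        have h4 := hz e ⟨hce, hed⟩
        have : (f t - z) - (f e - z) = f t - f e := by ring
        rw [this]; linarith)
      rw [sub_self, sub_zero] at h2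
      have : α d - α c = (α d - α e) + (α e - α c) := by ring
      rw [this]
      refine (abs_add_le _ _).trans ?_
      push_cast; linarith
  obtain ⟨N, hN⟩ := exists_nat_ge ((b - a) / δ)
  rw [div_le_iff₀ hδ] at hN
  refine ⟨N * Real.pi, by positivity, fun z α c d hc hcd hd hα hz => ?_⟩
  exact key N z α c d hc hcd hd hα hz (by linarith)

/-- a continuous function on the line which is σ-periodic is bounded -/
lemma bdd_of_periodic {F : ℝ × ℝ → ℝ} (hF : Continuous F) {σ : ℝ} (hσ : 0 < σ)
    (hp : ∀ s h, F (s + σ, h) = F (s, h)) (h0 h1 : ℝ) :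
    ∃ C, 0 ≤ C ∧ ∀ s, ∀ h ∈ Icc h0 h1, |F (s, h)| ≤ C := by
  have hc : IsCompact (Icc 0 σ ×ˢ Icc h0 h1) := isCompact_Icc.prod isCompact_Icc
  obtain ⟨C, hC⟩ := hc.exists_bound_of_continuousOn hF.continuousOn
  refine ⟨max C 0, le_max_right _ _, fun s h hh => ?_⟩
  have hper : Function.Periodic (fun s => F (s, h)) σ := fun s => hp s h
  obtain ⟨y, hy, hye⟩ := hper.exists_mem_Ico₀ hσ s
  have := hC (y, h) ⟨⟨hy.1, hy.2.le⟩, hh⟩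
  rw [hye]
  exact (le_max_left _ _).trans' this

end PBend

namespace PBend

/-- planar closed curve data -/
structure PD where
  v : ℝ → ℂ
  σ : ℝ
  hσ : 0 < σ
  hv : Continuous v
  hper : ∀ s, v (s + σ) = v s
  μ : ℝ
  hμ : 0 < μ
  near : ∀ a b, ‖v a - v b‖ < μ → ∃ k : ℤ, |a - b - k * σ| < σ / 16
  B : ℝ × ℝ → ℝ
  hB : Continuous B
  argB : ∀ θ h, h ∈ Icc (σ / 16) (15 * σ / 16) →
    v θ - v (θ + h) = (‖v θ - v (θ + h)‖ : ℂ) * Complex.exp ((B (θ, h) : ℂ) * Complex.I)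
  e : ℤ
  hodd : Odd e
  CB : ℝ
  hCB0 : 0 ≤ CB
  hCB : ∀ θ h, h ∈ Icc (σ / 16) (15 * σ / 16) → |B (θ, h) - 2 * Real.pi / σ * e * θ| ≤ CB

lemma exists_PD (v : ℝ → ℂ) (hv : Continuous v) (σ : ℝ) (hσ : 0 < σ)
    (hper : ∀ s, v (s + σ) = v s) (hinj : ∀ a b, v a = v b → ∃ k : ℤ, a - b = k * σ) :
    ∃ D : PD, D.v = v ∧ D.σ = σ := by
  have hpi := Real.pi_pos
  have hP : Function.Periodic v σ := hper
  have hPk : ∀ (k : ℤ) (s : ℝ), v (s + k * σ) = v s := fun k s => (hP.int_mul k) s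
  have hsep : ∀ θ h, h ∈ Icc (σ / 16) (15 * σ / 16) → v θ - v (θ + h) ≠ 0 := by
    intro θ h hh h0
    obtain ⟨k, hk⟩ := hinj θ (θ + h) (sub_eq_zero.1 h0)
    have h1 : (k : ℝ) * σ < 0 := by linarith [hh.1]
    have h2 : -σ < (k : ℝ) * σ := by linarith [hh.2]
    have h3 : (k : ℝ) < 0 := by by_contra h; push Not at h; nlinarith
    have h4 : (-1 : ℝ) < k := by by_contra h; push Not at h; nlinarith
    have h5 : k < 0 := by exact_mod_cast h3
    have h6 : -1 < k := by exact_mod_cast h4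
    omega
  -- separation constant
  obtain ⟨μ, hμ, hμs⟩ : ∃ μ > 0, ∀ θ h, h ∈ Icc (σ / 16) (15 * σ / 16) →
      μ ≤ ‖v θ - v (θ + h)‖ := by
    have hc : IsCompact (Icc (0:ℝ) σ ×ˢ Icc (σ / 16) (15 * σ / 16)) :=
      isCompact_Icc.prod isCompact_Icc
    have hne : (Icc (0:ℝ) σ ×ˢ Icc (σ / 16) (15 * σ / 16)).Nonempty :=
      ⟨(0, σ / 2), ⟨⟨le_rfl, hσ.le⟩, ⟨by dsimp; linarith, by dsimp; linarith⟩⟩⟩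
    have hcont : Continuous (fun x : ℝ × ℝ => ‖v x.1 - v (x.1 + x.2)‖) := by fun_prop
    obtain ⟨x, hx, hmin⟩ := hc.exists_isMinOn hne hcont.continuousOn
    refine ⟨‖v x.1 - v (x.1 + x.2)‖, norm_pos_iff.2 (hsep _ _ hx.2), fun θ h hh => ?_⟩
    have hp2 : Function.Periodic (fun θ => ‖v θ - v (θ + h)‖) σ := fun θ => by
      change ‖v (θ + σ) - v (θ + σ + h)‖ = _
      rw [hper, show θ + σ + h = θ + h + σ by ring, hper]
    obtain ⟨y, hy, hye⟩ := hp2.exists_mem_Ico₀ hσ θ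
    rw [hye]
    exact hmin (show (y, h) ∈ _ from ⟨⟨hy.1, hy.2.le⟩, hh⟩)
  have hnear : ∀ a b, ‖v a - v b‖ < μ → ∃ k : ℤ, |a - b - k * σ| < σ / 16 := by
    intro a b hab
    refine ⟨round ((a - b) / σ), ?_⟩
    set k := round ((a - b) / σ)
    have h1 : |(a - b) / σ - k| ≤ 1 / 2 := abs_sub_round _
    have h2 : |a - b - k * σ| ≤ σ / 2 := by
      have : a - b - k * σ = ((a - b) / σ - k) * σ := by field_simp
      rw [this, abs_mul, abs_of_pos hσ]; nlinarith
    by_contra hcon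
    push Not at hcon
    have hk : v (a - k * σ) = v a := by
      have := hPk k (a - k * σ); rw [sub_add_cancel] at this; exact this.symm
    have hk2 := hPk k b
    rcases le_total 0 (a - b - k * σ) with h | h
    · rw [abs_of_nonneg h] at *
      have := hμs b (a - b - k * σ) ⟨hcon, by linarith⟩
      rw [show b + (a - b - k * σ) = a - k * σ by ring, hk, norm_sub_rev] at this
      linarith
    · rw [abs_of_nonpos h] at *
      have := hμs a (-(a - b - k * σ)) ⟨hcon, by linarith⟩
      rw [show a + -(a - b - k * σ) = b + k * σ by ring, hk2] at this
      linarith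
  -- the argument function
  set I0 := σ / 16 with hI0
  set I1 := 15 * σ / 16 with hI1
  have hle : I0 ≤ I1 := by rw [hI0, hI1]; linarith
  have hcl := continuous_clamp I0 I1
  have hhalf : σ / 2 ∈ Icc I0 I1 := ⟨by rw [hI0]; linarith, by rw [hI1]; linarith⟩
  obtain ⟨B, hB, hBarg⟩ := exists_arg2 (fun x => v x.1 - v (x.1 + clamp I0 I1 x.2))
    (by fun_prop) (fun x => hsep _ _ (clamp_mem hle _))
  have hodd1 : ∃ k : ℤ, ∀ θ : ℝ,
      (B (θ + σ / 2, σ / 2) - B (θ, σ / 2) - Real.pi) / (2 * Real.pi) = k := by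
    apply const_of_int
    · fun_prop
    · intro θ
      have h1 := hBarg (θ + σ / 2, σ / 2)
      have h2 := hBarg (θ, σ / 2)
      simp only [clamp_eq hhalf] at h1 h2
      have h3 : v (θ + σ / 2 + σ / 2) = v θ := by
        rw [show θ + σ / 2 + σ / 2 = θ + σ by ring, hper]
      rw [h3] at h1
      have hz := hsep θ (σ / 2) hhalf
      have h4 : v θ - v (θ + σ / 2) = (‖v θ - v (θ + σ / 2)‖ : ℂ) *
          Complex.exp (((B (θ + σ / 2, σ / 2) - Real.pi : ℝ) : ℂ) * Complex.I) := by
        push_cast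
        rw [sub_mul, Complex.exp_sub, Complex.exp_pi_mul_I, norm_sub_rev, div_neg, div_one,
          mul_neg, ← h1, neg_sub]
      obtain ⟨k, hk⟩ := int_of_eq hz h4 h2
      refine ⟨k, ?_⟩
      rw [div_eq_iff (by positivity)]
      linarith
  obtain ⟨k, hk⟩ := hodd1
  have hk' : ∀ θ : ℝ, B (θ + σ / 2, σ / 2) = B (θ, σ / 2) + Real.pi + 2 * Real.pi * k := by
    intro θ
    have := hk θ
    rw [div_eq_iff (by positivity)] at this
    linarith
  have hfull : ∃ e : ℤ, ∀ x : ℝ × ℝ, (B (x.1 + σ, x.2) - B x) / (2 * Real.pi) = e := by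
    apply const_of_int
    · fun_prop
    · rintro ⟨θ, h⟩
      have h1 := hBarg (θ + σ, h)
      have h2 := hBarg (θ, h)
      simp only at h1 h2
      rw [hper, show θ + σ + clamp I0 I1 h = θ + clamp I0 I1 h + σ by ring, hper] at h1
      obtain ⟨k, hk⟩ := int_of_eq (hsep _ _ (clamp_mem hle _)) h1 h2
      refine ⟨k, ?_⟩
      rw [div_eq_iff (by positivity)]
      simp only
      linarith
  obtain ⟨e, he⟩ := hfull
  have he' : ∀ θ h : ℝ, B (θ + σ, h) = B (θ, h) + 2 * Real.pi * e := by
    intro θ h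
    have := he (θ, h)
    rw [div_eq_iff (by positivity)] at this
    simp only at this
    linarith
  have hee : e = 2 * k + 1 := by
    have h1 := he' 0 (σ / 2)
    have h2 := hk' 0
    have h3 := hk' (0 + σ / 2)
    rw [show (0:ℝ) + σ / 2 + σ / 2 = 0 + σ by ring] at h3
    have h4 : 2 * Real.pi * (e : ℝ) = 2 * Real.pi * (2 * k + 1) := by linarith
    have h5 := mul_left_cancel₀ (by positivity) h4
    exact_mod_cast h5
  obtain ⟨C, hC0, hC⟩ := bdd_of_periodic
    (F := fun x => B x - 2 * Real.pi / σ * e * x.1) (by fun_prop) hσ (fun s h => by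
      simp only
      rw [he']
      field_simp
      ring) I0 I1
  exact ⟨{ v := v, σ := σ, hσ := hσ, hv := hv, hper := hper, μ := μ, hμ := hμ, near := hnear,
           B := B, hB := hB
           argB := fun θ h hh => by
            have := hBarg (θ, h)
            simp only at this
            rwa [clamp_eq (show h ∈ Icc I0 I1 from hh)] at this
           e := e, hodd := ⟨k, hee⟩, CB := C, hCB0 := hC0
           hCB := fun θ h hh => hC θ h hh }, rfl, rfl⟩

namespace PD
variable (D : PD)

lemma per_int (k : ℤ) (s : ℝ) : D.v (s + k * D.σ) = D.v s :=
  (Function.Periodic.int_mul (f := D.v) D.hper k) s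

lemma sep (θ h : ℝ) (hh : h ∈ Icc (D.σ / 16) (15 * D.σ / 16)) :
    D.μ ≤ ‖D.v θ - D.v (θ + h)‖ := by
  by_contra hcon
  push Not at hcon
  have hσ := D.hσ
  obtain ⟨k, hk⟩ := D.near _ _ hcon
  rw [abs_lt] at hk
  have h1 : (k : ℝ) * D.σ < 0 := by linarith [hh.1]
  have h2 : -D.σ < (k : ℝ) * D.σ := by linarith [hh.2]
  have h3 : (k : ℝ) < 0 := by by_contra h; push Not at h; nlinarith
  have h4 : (-1 : ℝ) < k := by by_contra h; push Not at h; nlinarith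
  have h5 : k < 0 := by exact_mod_cast h3
  have h6 : -1 < k := by exact_mod_cast h4
  omega

/-- distance to the closed curve -/
noncomputable def lev (z : ℂ) : ℝ := Metric.infDist z (range D.v)

lemma isCompact_range : IsCompact (range D.v) := by
  have : range D.v = D.v '' Icc 0 D.σ := by
    apply Subset.antisymm
    · rintro _ ⟨s, rfl⟩
      obtain ⟨y, hy, hye⟩ := Function.Periodic.exists_mem_Ico₀ (f := D.v) D.hper D.hσ s
      exact ⟨y, ⟨hy.1, hy.2.le⟩, hye.symm⟩
    · exact image_subset_range _ _
  rw [this]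
  exact isCompact_Icc.image D.hv

lemma lev_exists (z : ℂ) : ∃ s, D.lev z = ‖z - D.v s‖ := by
  obtain ⟨y, ⟨s, rfl⟩, h⟩ := D.isCompact_range.exists_infDist_eq_dist (range_nonempty _) z
  exact ⟨s, by rw [lev, h, dist_eq_norm]⟩

lemma lev_le (z : ℂ) (s : ℝ) : D.lev z ≤ ‖z - D.v s‖ := by
  rw [← dist_eq_norm]
  exact Metric.infDist_le_dist_of_mem (mem_range_self s)

lemma lev_nonneg (z : ℂ) : 0 ≤ D.lev z := Metric.infDist_nonneg

lemma lev_cont : Continuous D.lev := Metric.continuous_infDist_pt _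

lemma lev_dist (z w : ℂ) : D.lev z ≤ D.lev w + ‖z - w‖ := by
  rw [← dist_eq_norm]; exact Metric.infDist_le_infDist_add_dist

lemma lev_eq_zero {z : ℂ} : D.lev z = 0 ↔ z ∈ range D.v := by
  rw [lev, ← D.isCompact_range.isClosed.mem_iff_infDist_zero (range_nonempty _)]

lemma lev_pos {z : ℂ} (h : z ∉ range D.v) : 0 < D.lev z :=
  lt_of_le_of_ne (D.lev_nonneg z) (fun h' => h (D.lev_eq_zero.1 h'.symm))

/-- angular rate -/
noncomputable def r : ℝ := 2 * Real.pi / D.σ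

lemma r_pos : 0 < D.r := by
  have := D.hσ; have := Real.pi_pos; unfold r; positivity

lemma r_mul : D.r * D.σ = 2 * Real.pi := by
  unfold r; exact div_mul_cancel₀ _ (ne_of_gt D.hσ)

/-- winding number of the closed curve about a point -/
def Wind (z : ℂ) (n : ℤ) : Prop :=
  ∃ α : ℝ → ℝ, Continuous α ∧
    (∀ s, z - D.v s ≠ 0 ∧
      z - D.v s = (‖z - D.v s‖ : ℂ) * Complex.exp ((α s : ℂ) * Complex.I)) ∧
    ∀ s, α (s + D.σ) = α s + 2 * Real.pi * n

lemma exists_wind {z : ℂ} (hz : z ∉ range D.v) : ∃ n, D.Wind z n := by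
  have hpi := Real.pi_pos
  have hne : ∀ s, z - D.v s ≠ 0 := fun s h => hz ⟨s, (sub_eq_zero.1 h).symm⟩
  have hv := D.hv
  obtain ⟨α, hα, hαa⟩ := exists_arg1 (fun s => z - D.v s) (by fun_prop) hne
  have : ∃ n : ℤ, ∀ s, (α (s + D.σ) - α s) / (2 * Real.pi) = n := by
    apply const_of_int
    · fun_prop
    · intro s
      have h1 := hαa (s + D.σ)
      simp only [D.hper] at h1
      obtain ⟨k, hk⟩ := int_of_eq (hne s) h1 (hαa s)
      exact ⟨k, by rw [div_eq_iff (by positivity)]; linarith⟩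
  obtain ⟨n, hn⟩ := this
  refine ⟨n, α, hα, fun s => ⟨hne s, hαa s⟩, fun s => ?_⟩
  have := hn s
  rw [div_eq_iff (by positivity)] at this
  linarith

lemma wind_inc {z z' : ℂ} {n : ℤ} (h : D.Wind z n) {α : ℝ → ℝ} (hα : Continuous α)
    (hne : ∀ s, z' - D.v s ≠ 0)
    (hαa : ∀ s, z' - D.v s = (‖z' - D.v s‖ : ℂ) * Complex.exp ((α s : ℂ) * Complex.I))
    (hd : ∀ s, ‖z' - z‖ ≤ ‖z - D.v s‖) (s : ℝ) : α (s + D.σ) = α s + 2 * Real.pi * n := by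
  obtain ⟨β, hβ, hβa, hβp⟩ := h
  have hσ := D.hσ
  have h1 : IsArg (fun s => z' - D.v s) α s (s + D.σ) :=
    ⟨hα.continuousOn, fun t _ => ⟨hne t, hαa t⟩⟩
  have h2 : IsArg (fun s => z - D.v s) β s (s + D.σ) :=
    ⟨hβ.continuousOn, fun t _ => hβa t⟩
  have h3 := arg_close (by linarith) h1 h2 (fun t _ => by
    rw [show z' - D.v t - (z - D.v t) = z' - z by ring]; exact hd t)
  have h4 := hαa (s + D.σ)
  simp only [D.hper] at h4
  obtain ⟨k, hk⟩ := int_of_eq (hne s) h4 (hαa s)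
  have h5 := int_eq_of_close hk (show β (s + D.σ) - β s = 2 * Real.pi * n by rw [hβp]; ring) h3
  rw [← h5]; linarith

lemma wind_notMem {z : ℂ} {n : ℤ} (h : D.Wind z n) (s : ℝ) : z - D.v s ≠ 0 := by
  obtain ⟨β, hβ, hβa, hβp⟩ := h
  exact (hβa s).1

/-- local constancy of the winding number -/
lemma wind_of_close {z z' : ℂ} {n : ℤ} (h : D.Wind z n) (hd : ‖z' - z‖ < D.lev z) :
    D.Wind z' n := by
  have hv := D.hv
  have hne : ∀ s, z' - D.v s ≠ 0 := by
    intro s hs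
    have h1 := D.lev_le z s
    rw [sub_eq_zero] at hs
    rw [← hs, norm_sub_rev] at h1
    linarith
  obtain ⟨α, hα, hαa⟩ := exists_arg1 (fun s => z' - D.v s) (by fun_prop) hne
  exact ⟨α, hα, fun s => ⟨hne s, hαa s⟩,
    D.wind_inc h hα hne hαa (fun s => hd.le.trans (D.lev_le z s))⟩

lemma wind_unique {z : ℂ} {n m : ℤ} (h : D.Wind z n) (h' : D.Wind z m) : n = m := by
  obtain ⟨β, hβ, hβa, hβp⟩ := h'
  have h1 := D.wind_inc h hβ (fun s => (hβa s).1) (fun s => (hβa s).2) (by simp) 0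
  rw [hβp] at h1
  have hpi := Real.pi_pos
  have h2 : 2 * Real.pi * (m : ℝ) = 2 * Real.pi * n := by linarith
  have := mul_left_cancel₀ (by positivity) h2
  exact_mod_cast this.symm

lemma inc_int {α : ℝ → ℝ} {n : ℤ} (h : ∀ s, α (s + D.σ) = α s + 2 * Real.pi * n) (k : ℤ)
    (s : ℝ) : α (s + k * D.σ) = α s + 2 * Real.pi * n * k := by
  have hp : Function.Periodic (fun s => α s - D.r * n * s) D.σ := fun s => by
    simp only
    rw [h]
    have := D.r_mul
    linear_combination (-(n : ℝ)) * this
  have h1 : α (s + k * D.σ) - D.r * n * (s + k * D.σ) = α s - D.r * n * s := (hp.int_mul k) s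
  have := D.r_mul
  linear_combination h1 + (n * k : ℝ) * this

/-- constant-drift bound for a winding argument -/
lemma wind_bdd {α : ℝ → ℝ} (hα : Continuous α) {n : ℤ}
    (h : ∀ s, α (s + D.σ) = α s + 2 * Real.pi * n) :
    ∃ C, 0 ≤ C ∧ ∀ s, |α s - D.r * n * s| ≤ C := by
  obtain ⟨C, hC0, hC⟩ := bdd_of_periodic (F := fun x => α x.1 - D.r * n * x.1) (by fun_prop)
    D.hσ (fun s h' => by
      simp only
      rw [h]
      have := D.r_mul
      linear_combination (-(n : ℝ)) * this) 0 0
  exact ⟨C, hC0, fun s => hC s 0 ⟨le_rfl, le_rfl⟩⟩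

/-- phases `a` and `b` are far apart modulo `σ` -/
def Far (a b d : ℝ) : Prop := ∃ k : ℤ, |a - b - D.σ / 2 - k * D.σ| ≤ d

/-- A curve in the tube around the closed curve, with phase `θ`. -/
structure Tube (n : ℤ) (u : ℝ → ℂ) (θ : ℝ → ℝ) (a b : ℝ) : Prop where
  hu : ContinuousOn u (Icc a b)
  hθ : ContinuousOn θ (Icc a b)
  close : ∀ t ∈ Icc a b, ‖u t - D.v (θ t)‖ < D.μ / 4
  drift : ∀ t ∈ Icc a b, ∀ s ∈ Icc 0 (3 * D.σ), t + s ≤ b → |θ (t + s) - θ t - s| ≤ D.σ / 8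
  wind : ∀ t ∈ Icc a b, D.Wind (u t) n

variable {D} {n : ℤ} {u : ℝ → ℂ} {θ : ℝ → ℝ} {a b : ℝ}

lemma Tube.mono (h : D.Tube n u θ a b) {c d : ℝ} (hc : a ≤ c) (hd : d ≤ b) :
    D.Tube n u θ c d := by
  have hs := Icc_subset_Icc hc hd
  exact ⟨h.hu.mono hs, h.hθ.mono hs, fun t ht => h.close t (hs ht),
    fun t ht s hs' hb => h.drift t (hs ht) s hs' (hb.trans hd), fun t ht => h.wind t (hs ht)⟩

lemma Tube.drift' (h : D.Tube n u θ a b) {c d : ℝ} (hc : a ≤ c) (hcd : c ≤ d) (hd : d ≤ b)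
    (hl : d - c ≤ 3 * D.σ) : |θ d - θ c - (d - c)| ≤ D.σ / 8 := by
  have := h.drift c ⟨hc, hcd.trans hd⟩ (d - c) ⟨by linarith, hl⟩ (by linarith)
  rwa [add_sub_cancel] at this

lemma Tube.growth (h : D.Tube n u θ a b) (hab : a ≤ b) :
    7 / 8 * (b - a) - D.σ / 8 ≤ θ b - θ a := by
  have hσ := D.hσ
  have key : ∀ k : ℕ, a + k * D.σ ≤ b → 7 / 8 * (k * D.σ) ≤ θ (a + k * D.σ) - θ a := by
    intro k
    induction k with
    | zero => intro _; simp
    | succ k ih =>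
      intro hk
      push_cast at hk ⊢
      have hk0 : (0:ℝ) ≤ k := Nat.cast_nonneg k
      have h1 := ih (by nlinarith)
      have h2 := h.drift' (c := a + k * D.σ) (d := a + (k + 1) * D.σ) (by nlinarith)
        (by nlinarith) hk (by nlinarith)
      rw [abs_le] at h2
      linarith [h2.1]
  set k := ⌊(b - a) / D.σ⌋₊ with hk
  have h1 : (k : ℝ) ≤ (b - a) / D.σ := Nat.floor_le (div_nonneg (by linarith) hσ.le)
  have h2 : (b - a) / D.σ < k + 1 := Nat.lt_floor_add_one _
  rw [le_div_iff₀ hσ] at h1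
  rw [div_lt_iff₀ hσ] at h2
  have h3 := key k (by linarith)
  have hk0 : (0:ℝ) ≤ k := Nat.cast_nonneg k
  have h4 := h.drift' (c := a + k * D.σ) (d := b) (by nlinarith) (by linarith) le_rfl (by nlinarith)
  rw [abs_le] at h4
  linarith [h4.1]

/-- choose a time with opposite phase -/
lemma Tube.exists_far (h : D.Tube n u θ a b) {c d : ℝ} (hc : a ≤ c) (hd : d ≤ b)
    (hcd : d - c = 2 * D.σ) (s : ℝ) : ∃ t ∈ Icc c d, D.Far s (θ t) 0 := by
  have hσ := D.hσ
  have h1 := h.drift' hc (by linarith) hd (by linarith)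
  rw [abs_le] at h1
  set k := ⌊(s - D.σ / 2 - θ c) / D.σ⌋ with hk
  have h2 : (k : ℝ) ≤ (s - D.σ / 2 - θ c) / D.σ := Int.floor_le _
  have h3 : (s - D.σ / 2 - θ c) / D.σ < k + 1 := Int.lt_floor_add_one _
  rw [le_div_iff₀ hσ] at h2
  rw [div_lt_iff₀ hσ] at h3
  obtain ⟨t, ht, hte⟩ := intermediate_value_Icc (a := c) (b := d) (f := θ) (by linarith)
    (h.hθ.mono (Icc_subset_Icc hc hd))
    (show s - D.σ / 2 - k * D.σ ∈ Icc (θ c) (θ d) from ⟨by linarith, by linarith [h1.1]⟩)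
  refine ⟨t, ht, k, ?_⟩
  rw [hte]
  apply le_of_eq
  rw [abs_eq_zero]
  ring

lemma Tube.near_phase (h : D.Tube n u θ a b) {t : ℝ} (ht : t ∈ Icc a b) {s : ℝ}
    (hs : D.lev (u t) = ‖u t - D.v s‖) : ∃ k : ℤ, |s - θ t - k * D.σ| < D.σ / 16 := by
  apply D.near
  have h1 := h.close t ht
  have h2 := D.lev_le (u t) (θ t)
  have h3 : D.v s - D.v (θ t) = (u t - D.v (θ t)) - (u t - D.v s) := by ring
  rw [h3]
  have := norm_sub_le (u t - D.v (θ t)) (u t - D.v s)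
  have := D.hμ
  linarith

end PD
end PBend

namespace PBend

lemma arg_close' {f₁ f₂ : ℝ → ℂ} {α₁ α₂ : ℝ → ℝ} {a b c d : ℝ}
    (h₁ : IsArg f₁ α₁ a b) (h₂ : IsArg f₂ α₂ a b)
    (h : ∀ t ∈ Icc a b, ‖f₁ t - f₂ t‖ ≤ ‖f₂ t‖) (hc : c ∈ Icc a b) (hd : d ∈ Icc a b) :
    |(α₁ d - α₁ c) - (α₂ d - α₂ c)| ≤ Real.pi := by
  rcases le_total c d with hcd | hcd
  · exact arg_close hcd (h₁.mono hc.1 hd.2) (h₂.mono hc.1 hd.2)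
      (fun t ht => h t ⟨hc.1.trans ht.1, ht.2.trans hd.2⟩)
  · have := arg_close hcd (h₁.mono hd.1 hc.2) (h₂.mono hd.1 hc.2)
      (fun t ht => h t ⟨hd.1.trans ht.1, ht.2.trans hc.2⟩)
    rw [abs_sub_comm] at this
    convert this using 2; ring

namespace PD
variable (D : PD) (n : ℤ)

/-- rotation about a point closer to the closed curve -/
lemma rot_inner : ∃ C, 0 ≤ C ∧ ∀ (u : ℝ → ℂ) (θ : ℝ → ℝ) (a b : ℝ), D.Tube n u θ a b → a ≤ b →
    ∀ (z : ℂ) (s : ℝ) (α : ℝ → ℝ), IsArg (fun t => u t - z) α a b →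
    (∀ t ∈ Icc a b, ‖z - D.v s‖ ≤ ‖u t - D.v s‖) →
    D.Far s (θ a) (7 * D.σ / 16) → D.Far s (θ b) (7 * D.σ / 16) →
    |α b - α a - D.r * (D.e - n) * (θ b - θ a)| ≤ C := by
  have hσ := D.hσ
  have hpi := Real.pi_pos
  refine ⟨4 * Real.pi + 6 * D.CB + 2 * Real.pi * |(n : ℝ)|, by have := D.hCB0; positivity, ?_⟩
  intro u θ a b hT hab z s α hα hz hfa hfb
  have hac : a ∈ Icc a b := ⟨le_rfl, hab⟩
  have hbc : b ∈ Icc a b := ⟨hab, le_rfl⟩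
  have hv := D.hv
  have hvc := D.hv.continuousOn (s := univ)
  have huc : Continuous (fun t => u (clamp a b t)) :=
    hT.hu.comp_continuous (continuous_clamp a b) (clamp_mem hab)
  have hne : ∀ t ∈ Icc a b, ∀ s, u t - D.v s ≠ 0 := fun t ht s =>
    D.wind_notMem (hT.wind t ht) s
  obtain ⟨A, hA, hAa⟩ := exists_arg2 (fun x => u (clamp a b x.1) - D.v x.2)
    ((huc.comp continuous_fst).sub (hv.comp continuous_snd))
    (fun x => hne _ (clamp_mem hab _) _)
  have hAa' : ∀ t ∈ Icc a b, ∀ s, u t - D.v s =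
      (‖u t - D.v s‖ : ℂ) * Complex.exp ((A (t, s) : ℂ) * Complex.I) := by
    intro t ht s
    have := hAa (t, s)
    simp only at this
    rwa [clamp_eq ht] at this
  have hAp : ∀ t ∈ Icc a b, ∀ (k : ℤ) (s : ℝ),
      A (t, s + k * D.σ) = A (t, s) + 2 * Real.pi * n * k := by
    intro t ht k s
    exact D.inc_int (α := fun s => A (t, s)) (D.wind_inc (hT.wind t ht) (by fun_prop)
      (hne t ht) (hAa' t ht) (by simp)) k s
  -- (1)
  have h1 := arg_close hab hα (f₂ := fun t => u t - D.v s) (α₂ := fun t => A (t, s))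
    ⟨by fun_prop, fun t ht => ⟨hne t ht s, hAa' t ht s⟩⟩ (fun t ht => by
      rw [show u t - z - (u t - D.v s) = -(z - D.v s) by ring, norm_neg]
      exact hz t ht)
  have hhalf : D.σ / 2 ∈ Icc (D.σ / 16) (15 * D.σ / 16) := ⟨by linarith, by linarith⟩
  have hBne : ∀ θ h, h ∈ Icc (D.σ / 16) (15 * D.σ / 16) → D.v θ - D.v (θ + h) ≠ 0 := by
    intro θ h hh h0
    have := D.sep θ h hh
    rw [h0, norm_zero] at this
    linarith [D.hμ]
  -- (3)
  have h3 : ∀ t ∈ Icc a b, ∀ h ∈ Icc (D.σ / 16) (15 * D.σ / 16),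
      |(A (t, θ t + h) - A (t, θ t + D.σ / 2)) -
        (D.B (θ t, h) - D.B (θ t, D.σ / 2))| ≤ Real.pi := by
    intro t ht h hh
    have hB := D.hB
    exact arg_close' (f₁ := fun x => u t - D.v (θ t + x)) (α₁ := fun x => A (t, θ t + x))
      (f₂ := fun x => D.v (θ t) - D.v (θ t + x)) (α₂ := fun x => D.B (θ t, x))
      ⟨by fun_prop, fun x _ => ⟨hne t ht _, hAa' t ht _⟩⟩
      ⟨by fun_prop, fun x hx => ⟨hBne _ _ hx, D.argB _ _ hx⟩⟩
      (fun x hx => by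
        have h1 := D.sep (θ t) x hx
        have h2 := hT.close t ht
        have := D.hμ
        rw [show u t - D.v (θ t + x) - (D.v (θ t) - D.v (θ t + x)) = u t - D.v (θ t) by ring]
        linarith) hhalf hh
  -- (4)
  have h4 : |(A (b, θ b + D.σ / 2) - A (a, θ a + D.σ / 2)) -
        (D.B (θ b, D.σ / 2) - D.B (θ a, D.σ / 2))| ≤ Real.pi := by
    have hB := D.hB
    have hθ := hT.hθ
    exact arg_close hab (f₁ := fun t => u t - D.v (θ t + D.σ / 2))
      (α₁ := fun t => A (t, θ t + D.σ / 2))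
      (f₂ := fun t => D.v (θ t) - D.v (θ t + D.σ / 2)) (α₂ := fun t => D.B (θ t, D.σ / 2))
      ⟨by fun_prop, fun x hx => ⟨hne x hx _, hAa' x hx _⟩⟩
      ⟨by fun_prop, fun x hx => ⟨hBne _ _ hhalf, D.argB _ _ hhalf⟩⟩
      (fun t ht => by
        have h1 := D.sep (θ t) (D.σ / 2) hhalf
        have h2 := hT.close t ht
        have := D.hμ
        rw [show u t - D.v (θ t + D.σ / 2) - (D.v (θ t) - D.v (θ t + D.σ / 2))
          = u t - D.v (θ t) by ring]
        linarith)
  obtain ⟨ka, hka⟩ := hfa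
  obtain ⟨kb, hkb⟩ := hfb
  rw [abs_le] at hka hkb
  set ha := s - θ a - ka * D.σ with hha
  set hb := s - θ b - kb * D.σ with hhb
  have ha_mem : ha ∈ Icc (D.σ / 16) (15 * D.σ / 16) := by
    constructor <;> [linarith [hka.1]; linarith [hka.2]]
  have hb_mem : hb ∈ Icc (D.σ / 16) (15 * D.σ / 16) := by
    constructor <;> [linarith [hkb.1]; linarith [hkb.2]]
  have h5a : A (a, s) = A (a, θ a + ha) + 2 * Real.pi * n * ka := by
    rw [← hAp a hac, hha]; congr 2; ring
  have h5b : A (b, s) = A (b, θ b + hb) + 2 * Real.pi * n * kb := by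
    rw [← hAp b hbc, hhb]; congr 2; ring
  have h6a := h3 a hac ha ha_mem
  have h6b := h3 b hbc hb hb_mem
  have h7a := D.hCB (θ a) ha ha_mem
  have h7b := D.hCB (θ b) hb hb_mem
  have h8 : 2 * Real.pi * n * (kb - ka : ℝ) = -(D.r * n * (θ b - θ a)) + D.r * n * (ha - hb) := by
    rw [← D.r_mul, hha, hhb]; ring
  have h9 : |D.r * n * (ha - hb)| ≤ 2 * Real.pi * |(n : ℝ)| := by
    rw [abs_mul, abs_mul, abs_of_pos D.r_pos, ← D.r_mul]
    have h10 : |ha - hb| ≤ D.σ := by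
      rw [abs_le]; constructor <;> linarith [ha_mem.1, ha_mem.2, hb_mem.1, hb_mem.2]
    have hr := D.r_pos
    calc D.r * |(n : ℝ)| * |ha - hb| ≤ D.r * |(n : ℝ)| * D.σ := by gcongr
      _ = _ := by ring
  rw [show D.r = 2 * Real.pi / D.σ from rfl] at *
  rw [abs_le] at *
  constructor <;> nlinarith

/-- rotation about a point farther from the closed curve -/
lemma rot_outer {z : ℂ} (hz : D.Wind z n) : ∃ C, 0 ≤ C ∧
    ∀ (u : ℝ → ℂ) (θ : ℝ → ℝ) (a b : ℝ), D.Tube n u θ a b → a ≤ b →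
    ∀ (α : ℝ → ℝ), IsArg (fun t => u t - z) α a b →
    (∀ t ∈ Icc a b, ‖u t - D.v (θ t)‖ ≤ ‖z - D.v (θ t)‖) →
    |α b - α a - D.r * n * (θ b - θ a)| ≤ C := by
  obtain ⟨β, hβ, hβa, hβp⟩ := hz
  obtain ⟨C, hC0, hC⟩ := D.wind_bdd hβ hβp
  have hpi := Real.pi_pos
  refine ⟨Real.pi + 2 * C, by positivity, fun u θ a b hT hab α hα hzu => ?_⟩
  have hθ := hT.hθ
  have h1 : IsArg (fun t => z - D.v (θ t)) (fun t => β (θ t)) a b :=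
    ⟨by fun_prop, fun t _ => hβa _⟩
  have h2 := arg_close hab hα h1.neg (fun t ht => by
    rw [show u t - z - -(z - D.v (θ t)) = u t - D.v (θ t) by ring, norm_neg]
    exact hzu t ht)
  have ha := hC (θ a)
  have hb := hC (θ b)
  rw [abs_le] at *
  constructor <;> nlinarith

/-- rotation of two tube curves with opposite phases -/
lemma rot_pair : ∃ C, 0 ≤ C ∧
    ∀ (u₁ u₂ : ℝ → ℂ) (θ h : ℝ → ℝ) (a b : ℝ), a ≤ b →
    ContinuousOn θ (Icc a b) → ContinuousOn h (Icc a b) →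
    (∀ t ∈ Icc a b, h t ∈ Icc (D.σ / 16) (15 * D.σ / 16)) →
    (∀ t ∈ Icc a b, ‖u₁ t - D.v (θ t)‖ < D.μ / 4) →
    (∀ t ∈ Icc a b, ‖u₂ t - D.v (θ t + h t)‖ < D.μ / 4) →
    ∀ (α : ℝ → ℝ), IsArg (fun t => u₁ t - u₂ t) α a b →
    |α b - α a - D.r * D.e * (θ b - θ a)| ≤ C := by
  have hpi := Real.pi_pos
  refine ⟨Real.pi + 2 * D.CB, by have := D.hCB0; positivity, ?_⟩
  intro u₁ u₂ θ h a b hab hθ hh hm hu₁ hu₂ α hα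
  have hB := D.hB
  have h1 : IsArg (fun t => D.v (θ t) - D.v (θ t + h t)) (fun t => D.B (θ t, h t)) a b := by
    refine ⟨by fun_prop, fun t ht => ⟨fun h0 => ?_, D.argB _ _ (hm t ht)⟩⟩
    have := D.sep (θ t) (h t) (hm t ht)
    simp only at h0
    rw [h0, norm_zero] at this
    linarith [D.hμ]
  have h2 := arg_close hab hα h1 (fun t ht => by
    rw [show u₁ t - u₂ t - (D.v (θ t) - D.v (θ t + h t)) =
      (u₁ t - D.v (θ t)) - (u₂ t - D.v (θ t + h t)) by ring]
    have h3 := norm_sub_le (u₁ t - D.v (θ t)) (u₂ t - D.v (θ t + h t))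
    have h4 := hu₁ t ht
    have h5 := hu₂ t ht
    have h6 := D.sep (θ t) (h t) (hm t ht)
    linarith [D.hμ])
  have ha := D.hCB (θ a) (h a) (hm a ⟨le_rfl, hab⟩)
  have hb := D.hCB (θ b) (h b) (hm b ⟨hab, le_rfl⟩)
  rw [show D.r = 2 * Real.pi / D.σ from rfl]
  rw [abs_le] at *
  constructor <;> nlinarith

end PD
end PBend

namespace PBend
namespace PD
variable (D : PD) (n : ℤ)

lemma odd_abs : (1 : ℝ) ≤ |(D.e : ℝ) - 2 * n| := by
  have h1 : D.e - 2 * n ≠ 0 := by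
    obtain ⟨k, hk⟩ := D.hodd
    omega
  have h2 : (1 : ℤ) ≤ |D.e - 2 * n| := Int.one_le_abs h1
  have h3 : ((1 : ℤ) : ℝ) ≤ ((|D.e - 2 * n| : ℤ) : ℝ) := by exact_mod_cast h2
  push_cast at h3
  exact h3

lemma Far.mono {D : PD} {a b c d : ℝ} (h : D.Far a b c) (hcd : c ≤ d) : D.Far a b d := by
  obtain ⟨k, hk⟩ := h
  exact ⟨k, hk.trans hcd⟩

lemma abs_r_mul_le {c x L : ℝ} (hx : |x| ≤ L) : |D.r * c * x| ≤ D.r * |c| * L := by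
  have := D.r_pos
  rw [abs_mul, abs_mul, abs_of_pos D.r_pos]
  gcongr

lemma corner : ∃ C, 0 ≤ C ∧ ∀ (p q : ℝ → ℂ) (θp θq : ℝ → ℝ) (y₀ b' b x₃ : ℝ) (A : ℝ × ℝ → ℝ)
    (S : Set (ℝ × ℝ)) (sq sp : ℝ),
    D.Tube n p θp y₀ b' → D.Tube n q θq b x₃ → y₀ + 2 * D.σ ≤ b' → b + 2 * D.σ ≤ x₃ →
    ContinuousOn A S →
    (∀ x ∈ S, p x.2 - q x.1 ≠ 0 ∧
      p x.2 - q x.1 = (‖p x.2 - q x.1‖ : ℂ) * Complex.exp ((A x : ℂ) * Complex.I)) →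
    (∀ y ∈ Icc y₀ b', (b, y) ∈ S) → (∀ x ∈ Icc b x₃, (x, b') ∈ S) →
    (∀ y₁ ∈ Icc y₀ b', ∀ τ ∈ Icc 0 (b' - y₁), b + τ ≤ x₃ → (b + τ, y₁ + τ) ∈ S) →
    (∀ y ∈ Icc y₀ b', D.lev (q b) ≤ D.lev (p y)) →
    (∀ x ∈ Icc b x₃, D.lev (p b') ≤ D.lev (q x)) →
    D.lev (q b) = ‖q b - D.v sq‖ → D.lev (p b') = ‖p b' - D.v sp‖ →
    D.Far sq (θp y₀) (7 * D.σ / 16) → D.Far sp (θq x₃) (7 * D.σ / 16) →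
    |A (x₃, b') - A (b, y₀) - D.r * (D.e - n) * ((θp b' - θp y₀) + (θq x₃ - θq b))| ≤ C := by
  have hσ := D.hσ
  have hr := D.r_pos
  obtain ⟨C1, hC1, h1⟩ := D.rot_inner n
  obtain ⟨C3, hC3, h3⟩ := D.rot_pair
  refine ⟨2 * C1 + C3 + D.r * |(D.e : ℝ)| * (3 * D.σ) + 2 * (D.r * |(D.e : ℝ) - n| * (3 * D.σ)),
    by positivity, ?_⟩
  intro p q θp θq y₀ b' b x₃ A S sq sp hp hq hy hx hA hAa hS1 hS2 hS3 hl1 hl2 hsq hsp hf1 hf2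
  obtain ⟨y₁, hy₁, hfar⟩ := hp.exists_far (c := b' - 2 * D.σ) (d := b') (by linarith) le_rfl
    (by ring) sq
  have hy₀₁ : y₀ ≤ y₁ := by linarith [hy₁.1]
  have hy₁b : y₁ ≤ b' := hy₁.2
  set L := b' - y₁ with hL
  have hL0 : 0 ≤ L := by linarith
  have hL2 : L ≤ 2 * D.σ := by linarith [hy₁.1]
  set x₂ := b + L with hx₂
  have hx₂₃ : x₂ ≤ x₃ := by linarith
  -- vertical
  have hV := h1 p θp y₀ y₁ (hp.mono le_rfl hy₁b) hy₀₁ (q b) sq (fun y => A (b, y))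
    ⟨hA.comp (by fun_prop) (fun y hy => hS1 y ⟨hy.1, hy.2.trans hy₁b⟩),
      fun y hy => hAa (b, y) (hS1 y ⟨hy.1, hy.2.trans hy₁b⟩)⟩
    (fun y hy => by
      rw [← hsq]; exact (hl1 y ⟨hy.1, hy.2.trans hy₁b⟩).trans (D.lev_le _ _))
    hf1 (hfar.mono (by positivity))
  -- phases
  obtain ⟨k2, hk2⟩ := hq.near_phase (t := b) ⟨le_rfl, by linarith⟩ hsq
  obtain ⟨k3, hk3⟩ := hp.near_phase (t := b') ⟨by linarith, le_rfl⟩ hsp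
  obtain ⟨k1, hk1⟩ := hfar
  have hdp : ∀ τ ∈ Icc 0 L, |θp (y₁ + τ) - θp y₁ - τ| ≤ D.σ / 8 := fun τ hτ =>
    hp.drift y₁ ⟨hy₀₁, hy₁b⟩ τ ⟨hτ.1, by linarith [hτ.2]⟩ (by linarith [hτ.2])
  have hdq : ∀ τ ∈ Icc 0 L, |θq (b + τ) - θq b - τ| ≤ D.σ / 8 := fun τ hτ =>
    hq.drift b ⟨le_rfl, by linarith⟩ τ ⟨hτ.1, by linarith [hτ.2]⟩ (by linarith [hτ.2])
  set h : ℝ → ℝ := fun τ => θq (b + τ) - θp (y₁ + τ) + ((k2 - k1 : ℤ) : ℝ) * D.σ with hh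
  have hhm : ∀ τ ∈ Icc 0 L, |h τ - D.σ / 2| ≤ 5 * D.σ / 16 := by
    intro τ hτ
    have e1 := hdp τ hτ
    have e2 := hdq τ hτ
    simp only [hh]
    push_cast
    rw [abs_le] at *
    rw [abs_lt] at *
    constructor <;> linarith [e1.1, e1.2, e2.1, e2.2, hk1.1, hk1.2, hk2.1, hk2.2]
  -- diagonal
  have hcp : ContinuousOn (fun τ => θp (y₁ + τ)) (Icc 0 L) :=
    hp.hθ.comp (by fun_prop) (fun τ hτ => ⟨by linarith [hτ.1], by linarith [hτ.2]⟩)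
  have hcq : ContinuousOn (fun τ => θq (b + τ)) (Icc 0 L) :=
    hq.hθ.comp (by fun_prop) (fun τ hτ => ⟨by linarith [hτ.1], by linarith [hτ.2]⟩)
  have hSd : ∀ τ ∈ Icc 0 L, (b + τ, y₁ + τ) ∈ S := fun τ hτ =>
    hS3 y₁ ⟨hy₀₁, hy₁b⟩ τ hτ (by linarith [hτ.2])
  have hD := h3 (fun τ => p (y₁ + τ)) (fun τ => q (b + τ)) (fun τ => θp (y₁ + τ)) h 0 L hL0
    hcp ((hcq.sub hcp).add continuousOn_const)
    (fun τ hτ => by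
      have := hhm τ hτ
      rw [abs_le] at this
      constructor <;> linarith [this.1, this.2])
    (fun τ hτ => hp.close _ ⟨by linarith [hτ.1], by linarith [hτ.2]⟩)
    (fun τ hτ => by
      have := hq.close (b + τ) ⟨by linarith [hτ.1], by linarith [hτ.2]⟩
      simp only [hh]
      rw [show θp (y₁ + τ) + (θq (b + τ) - θp (y₁ + τ) + ((k2 - k1 : ℤ) : ℝ) * D.σ)
        = θq (b + τ) + ((k2 - k1 : ℤ) : ℝ) * D.σ by ring, D.per_int]
      exact this)
    (fun τ => A (b + τ, y₁ + τ))
    ⟨hA.comp (by fun_prop) hSd, fun τ hτ => hAa _ (hSd τ hτ)⟩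
  simp only [add_zero] at hD
  rw [show y₁ + L = b' by rw [hL]; ring] at hD
  -- horizontal
  have hIs : IsArg (fun x => p b' - q x) (fun x => A (x, b')) x₂ x₃ :=
    ⟨hA.comp (by fun_prop) (fun x hx => hS2 x ⟨by linarith [hx.1], hx.2⟩),
      fun x hx => hAa (x, b') (hS2 x ⟨by linarith [hx.1], hx.2⟩)⟩
  have hH := h1 q θq x₂ x₃ (hq.mono (by linarith) le_rfl) hx₂₃ (p b') sp _
    (hIs.neg.congr (fun t _ => by ring))
    (fun x hx => by
      rw [← hsp]; exact (hl2 x ⟨by linarith [hx.1], hx.2⟩).trans (D.lev_le _ _))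
    (by
      refine ⟨k3 - k1 + k2 - 1, ?_⟩
      have e1 := hhm L ⟨hL0, le_rfl⟩
      simp only [hh] at e1
      rw [show y₁ + L = b' by rw [hL]; ring, ← hx₂] at e1
      push_cast at *
      rw [abs_le] at *
      rw [abs_lt] at *
      constructor <;> linarith [e1.1, e1.2, hk3.1, hk3.2])
    hf2
  -- collect
  have e1 := hdp L ⟨hL0, le_rfl⟩
  have e2 := hdq L ⟨hL0, le_rfl⟩
  rw [show y₁ + L = b' by rw [hL]; ring] at e1
  rw [← hx₂] at e2
  have f1 : |θp b' - θp y₁| ≤ 3 * D.σ := by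
    rw [abs_le] at *; constructor <;> linarith [e1.1, e1.2]
  have f2 : |θq x₂ - θq b| ≤ 3 * D.σ := by
    rw [abs_le] at *; constructor <;> linarith [e2.1, e2.2]
  have g1 := D.abs_r_mul_le (c := D.e) f1
  have g2 := D.abs_r_mul_le (c := D.e - n) f1
  have g3 := D.abs_r_mul_le (c := D.e - n) f2
  rw [abs_le] at hV hD hH g1 g2 g3 ⊢
  constructor <;> linarith [hV.1, hV.2, hD.1, hD.2, hH.1, hH.2, g1.1, g1.2, g2.1, g2.2, g3.1, g3.2]

/-- final numeric contradiction -/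
lemma bound_of {P C : ℝ} (h : |D.r * (D.e - 2 * n) * P| ≤ C) : P ≤ C / D.r := by
  have hr := D.r_pos
  have h1 := D.odd_abs n
  rw [le_div_iff₀ hr]
  rw [abs_mul, abs_mul, abs_of_pos hr] at h
  have h2 : |P| * D.r ≤ C := by
    calc |P| * D.r = D.r * 1 * |P| := by ring
      _ ≤ D.r * |(D.e : ℝ) - 2 * n| * |P| := by gcongr
      _ ≤ C := h
  nlinarith [le_abs_self P]

lemma triangle_bound : ∃ C, ∀ (u : ℝ → ℂ) (θ : ℝ → ℝ) (b b' : ℝ), D.Tube n u θ b b' → b ≤ b' →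
    InjOn u (Icc b b') →
    (∀ t ∈ Icc b b', D.lev (u b) ≤ D.lev (u t) ∧ D.lev (u b') ≤ D.lev (u t)) → b' - b ≤ C := by
  have hσ := D.hσ
  have hr := D.r_pos
  obtain ⟨C1, hC1, h1⟩ := D.corner n
  obtain ⟨C3, hC3, h3⟩ := D.rot_pair
  refine ⟨max (4 * D.σ)
    (2 * ((C1 + C3 + D.r * |(D.e : ℝ) - n| * (2 * D.σ)) / D.r) + 4 * D.σ), ?_⟩
  intro u θ b b' hT hbb hinj hlev
  by_cases hshort : b' - b ≤ 4 * D.σ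
  · exact hshort.trans (le_max_left _ _)
  push Not at hshort
  refine le_trans ?_ (le_max_right _ _)
  set c := D.σ / 2 with hc
  set X : ℝ → ℝ := clamp b (b' - c) with hX
  have hXc : Continuous X := continuous_clamp _ _
  have hXm : ∀ x, X x ∈ Icc b (b' - c) := clamp_mem (by linarith)
  set Y : ℝ × ℝ → ℝ := fun x => max (X x.1 + c) (min b' x.2) with hY
  have hYc : Continuous Y := by fun_prop
  have hYm : ∀ x, Y x ∈ Icc (X x.1 + c) b' := fun x =>
    ⟨le_max_left _ _, max_le (by linarith [(hXm x.1).2]) (min_le_left _ _)⟩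
  obtain ⟨A, hA, hAa⟩ := exists_arg2 (fun x => u (Y x) - u (X x.1))
    ((hT.hu.comp_continuous hYc (fun x => ⟨by linarith [(hXm x.1).1, (hYm x).1], (hYm x).2⟩)).sub
      (hT.hu.comp_continuous (hXc.comp continuous_fst)
        (fun x => ⟨(hXm x.1).1, by linarith [(hXm x.1).2]⟩)))
    (fun x h0 => by
      have := hinj ⟨by linarith [(hXm x.1).1, (hYm x).1], (hYm x).2⟩
        ⟨(hXm x.1).1, by linarith [(hXm x.1).2]⟩ (sub_eq_zero.1 h0)
      linarith [(hYm x).1])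
  set S : Set (ℝ × ℝ) := {x | b ≤ x.1 ∧ x.1 ≤ b' - c ∧ x.1 + c ≤ x.2 ∧ x.2 ≤ b'} with hS
  have hAS : ∀ x ∈ S, u x.2 - u x.1 ≠ 0 ∧
      u x.2 - u x.1 = (‖u x.2 - u x.1‖ : ℂ) * Complex.exp ((A x : ℂ) * Complex.I) := by
    rintro ⟨x, y⟩ ⟨s1, s2, s3, s4⟩
    simp only at s1 s2 s3 s4 ⊢
    have hXx : X x = x := clamp_eq ⟨s1, s2⟩
    have hYx : Y (x, y) = y := by
      simp only [hY]; rw [hXx, min_eq_right s4, max_eq_right s3]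
    refine ⟨fun h0 => ?_, ?_⟩
    · have := hinj ⟨by linarith, s4⟩ ⟨s1, by linarith⟩ (sub_eq_zero.1 h0)
      linarith
    · have := hAa (x, y)
      simp only at this
      rwa [hXx, hYx] at this
  obtain ⟨sq, hsq⟩ := D.lev_exists (u b)
  obtain ⟨sp, hsp⟩ := D.lev_exists (u b')
  obtain ⟨k2, hk2⟩ := hT.near_phase (t := b) ⟨le_rfl, hbb⟩ hsq
  obtain ⟨k3, hk3⟩ := hT.near_phase (t := b') ⟨hbb, le_rfl⟩ hsp
  have d1 := hT.drift' (c := b) (d := b + c) le_rfl (by linarith) (by linarith) (by linarith)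
  have d2 := hT.drift' (c := b' - c) (d := b') (by linarith) (by linarith) le_rfl (by linarith)
  have hcor := h1 u u θ θ (b + c) b' b (b' - c) A S sq sp (hT.mono (by linarith) le_rfl)
    (hT.mono le_rfl (by linarith)) (by linarith) (by linarith) hA.continuousOn hAS
    (fun y hy => ⟨le_rfl, by simp only; linarith, hy.1, hy.2⟩)
    (fun x hx => ⟨hx.1, hx.2, by simp only; linarith [hx.2], le_rfl⟩)
    (fun y₁ hy₁ τ hτ hb => ⟨by simp only; linarith [hτ.1], by simp only; linarith,
      by simp only; linarith [hy₁.1], by simp only; linarith [hτ.2]⟩)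
    (fun y hy => (hlev y ⟨by linarith [hy.1], hy.2⟩).1)
    (fun x hx => (hlev x ⟨hx.1, by linarith [hx.2]⟩).2) hsq hsp
    ⟨k2 - 1, by
      push_cast
      rw [abs_le] at *
      rw [abs_lt] at *
      constructor <;> linarith [d1.1, d1.2, hk2.1, hk2.2]⟩
    ⟨k3, by
      rw [abs_le] at *
      rw [abs_lt] at *
      constructor <;> linarith [d2.1, d2.2, hk3.1, hk3.2]⟩
  have hdrift : ∀ x ∈ Icc b (b' - c), |θ (x + c) - θ x - c| ≤ D.σ / 8 := fun x hx =>
    hT.drift x ⟨hx.1, by linarith [hx.2]⟩ c ⟨by positivity, by linarith⟩ (by linarith [hx.2])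
  have hc1 : ContinuousOn (fun x => θ (x + c)) (Icc b (b' - c)) :=
    hT.hθ.comp (by fun_prop) (fun x hx => ⟨by linarith [hx.1], by linarith [hx.2]⟩)
  have hc2 : ContinuousOn θ (Icc b (b' - c)) := hT.hθ.mono (Icc_subset_Icc le_rfl (by linarith))
  have hhyp := h3 (fun x => u (x + c)) u (fun x => θ (x + c)) (fun x => θ x - θ (x + c) + D.σ)
    b (b' - c) (by linarith) hc1 ((hc2.sub hc1).add continuousOn_const)
    (fun x hx => by
      have := hdrift x hx
      rw [abs_le] at this
      constructor <;> linarith [this.1, this.2])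
    (fun x hx => hT.close _ ⟨by linarith [hx.1], by linarith [hx.2]⟩)
    (fun x hx => by
      rw [show θ (x + c) + (θ x - θ (x + c) + D.σ) = θ x + D.σ by ring, D.hper]
      exact hT.close _ ⟨by linarith [hx.1], by linarith [hx.2]⟩)
    (fun x => A (x, x + c))
    ⟨by fun_prop, fun x hx => hAS (x, x + c) ⟨hx.1, hx.2, le_rfl, by simp only; linarith [hx.2]⟩⟩
  simp only [sub_add_cancel] at hhyp
  have f1 : |(θ (b' - c) - θ b) - (θ b' - θ (b + c))| ≤ 2 * D.σ := by
    rw [abs_le] at *; constructor <;> linarith [d1.1, d1.2, d2.1, d2.2]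
  have g1 := D.abs_r_mul_le (c := D.e - n) f1
  have hfin : |D.r * (D.e - 2 * n) * (θ b' - θ (b + c))| ≤
      C1 + C3 + D.r * |(D.e : ℝ) - n| * (2 * D.σ) := by
    rw [abs_le] at hcor hhyp g1 ⊢
    constructor <;> linarith [hcor.1, hcor.2, hhyp.1, hhyp.2, g1.1, g1.2]
  have hb := D.bound_of n hfin
  have hgr := (hT.mono (c := b + c) (d := b') (by linarith) le_rfl).growth (by linarith)
  linarith

end PD
end PBend

namespace PBend

lemma arg_bdd_pt {f : ℝ → ℂ} {a b : ℝ} {z : ℂ} (hf : ContinuousOn f (Icc a b)) (hab : a ≤ b)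
    (hz : ∀ t ∈ Icc a b, f t ≠ z) :
    ∃ C : ℝ, 0 ≤ C ∧ ∀ α : ℝ → ℝ, IsArg (fun t => f t - z) α a b → |α b - α a| ≤ C := by
  obtain ⟨t₀, ht₀, hmin⟩ := isCompact_Icc.exists_isMinOn (nonempty_Icc.2 hab)
    (hf.sub (continuousOn_const (c := z))).norm
  have hm : 0 < ‖f t₀ - z‖ := norm_pos_iff.2 (sub_ne_zero.2 (hz t₀ ht₀))
  obtain ⟨C, hC0, hC⟩ := arg_bdd hf hm
  exact ⟨C, hC0, fun α hα => hC z α a b le_rfl hab le_rfl hα (fun t ht => hmin ht)⟩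

namespace PD
variable (D : PD) (n : ℤ)

lemma lev_sub_le (z w : ℂ) : D.lev z - D.lev w ≤ ‖z - w‖ := by
  linarith [D.lev_dist z w]

lemma rect_bound (p q : ℝ → ℂ) (hp : Continuous p) (hq : Continuous q) (M : ℝ) (hM : 0 ≤ M)
    (hwp : D.Wind (p 0) n) (hwq : D.Wind (q 0) n)
    (hne : ∀ x y, x ≤ 0 → 0 ≤ y → p y ≠ q x) (mp mq : ℝ) (hmp : 0 < mp) (hmq : 0 < mq)
    (hlp : ∀ y ∈ Icc 0 (M + 2 * D.σ), mp ≤ D.lev (p y))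
    (hlq : ∀ x ∈ Icc (-M - 2 * D.σ) 0, mq ≤ D.lev (q x)) :
    ∃ C, ∀ b b' θp θq, D.Tube n p θp M b' → D.Tube n q θq b (-M) → M + 4 * D.σ ≤ b' →
      b ≤ -M - 4 * D.σ → D.lev (p b') ≤ mq / 2 → D.lev (q b) ≤ mp / 2 →
      (∀ y ∈ Icc 0 b', D.lev (q b) ≤ D.lev (p y)) →
      (∀ x ∈ Icc b 0, D.lev (p b') ≤ D.lev (q x)) →
      (∀ y ∈ Icc M b', ‖p y - D.v (θp y)‖ ≤ ‖q 0 - D.v (θp y)‖) →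
      (∀ x ∈ Icc b (-M), ‖q x - D.v (θq x)‖ ≤ ‖p 0 - D.v (θq x)‖) → b' ≤ C := by
  have hσ := D.hσ
  have hr := D.r_pos
  obtain ⟨C2, hC2, h2⟩ := D.corner n
  obtain ⟨C1, hC1, h1⟩ := arg_bdd (f := p) (a := 0) (b := M + 2 * D.σ) (m := mp / 2)
    hp.continuousOn (by positivity)
  obtain ⟨C3, hC3, h3⟩ := arg_bdd (f := q) (a := -M - 2 * D.σ) (b := 0) (m := mq / 2)
    hq.continuousOn (by positivity)
  obtain ⟨C4, hC4, h4⟩ := D.rot_outer n hwp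
  obtain ⟨C5, hC5, h5⟩ := D.rot_outer n hwq
  obtain ⟨C6, hC6, h6⟩ := arg_bdd_pt (f := q) (a := -M) (b := 0) (z := p 0) hq.continuousOn
    (by linarith) (fun t ht => (hne t 0 ht.2 le_rfl).symm)
  obtain ⟨C7, hC7, h7⟩ := arg_bdd_pt (f := p) (a := 0) (b := M) (z := q 0) hp.continuousOn
    (by linarith) (fun t ht => (hne 0 t le_rfl ht.1))
  refine ⟨8 / 7 * ((C1 + C2 + C3 + C4 + C5 + C6 + C7 +
    2 * (D.r * |(n : ℝ)| * (3 * D.σ))) / D.r + D.σ) + M + 2 * D.σ, ?_⟩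
  intro b b' θp θq hTp hTq hb' hb hl1 hl2 hl3 hl4 hm1 hm2
  set Y : ℝ → ℝ := clamp 0 b' with hY
  set X : ℝ → ℝ := clamp b 0 with hX
  have hYm : ∀ y, Y y ∈ Icc 0 b' := clamp_mem (by linarith)
  have hXm : ∀ x, X x ∈ Icc b 0 := clamp_mem (by linarith)
  have hYc : Continuous Y := continuous_clamp _ _
  have hXc : Continuous X := continuous_clamp _ _
  obtain ⟨A, hA, hAa⟩ := exists_arg2 (fun x => p (Y x.2) - q (X x.1))
    (by fun_prop) (fun x => sub_ne_zero.2 (hne _ _ (hXm x.1).2 (hYm x.2).1))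
  set S : Set (ℝ × ℝ) := {x | x.1 ∈ Icc b 0 ∧ x.2 ∈ Icc 0 b'} with hS
  have hAS : ∀ x ∈ S, p x.2 - q x.1 ≠ 0 ∧
      p x.2 - q x.1 = (‖p x.2 - q x.1‖ : ℂ) * Complex.exp ((A x : ℂ) * Complex.I) := by
    rintro ⟨x, y⟩ ⟨s1, s2⟩
    refine ⟨sub_ne_zero.2 (hne _ _ s1.2 s2.1), ?_⟩
    have := hAa (x, y)
    simp only at this s1 s2
    rwa [show X x = x from clamp_eq s1, show Y y = y from clamp_eq s2] at this
  have hArgV : ∀ x ∈ Icc b 0, IsArg (fun y => p y - q x) (fun y => A (x, y)) 0 b' := fun x hx =>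
    ⟨by fun_prop, fun y hy => hAS (x, y) ⟨hx, hy⟩⟩
  have hArgH : ∀ y ∈ Icc 0 b', IsArg (fun x => q x - p y) (fun x => A (x, y) + Real.pi) b 0 :=
    fun y hy =>
    (IsArg.neg (f := fun x => p y - q x) (α := fun x => A (x, y))
      ⟨by fun_prop, fun x hx => hAS (x, y) ⟨hx, hy⟩⟩).congr (fun t _ => by ring)
  obtain ⟨sq, hsq⟩ := D.lev_exists (q b)
  obtain ⟨sp, hsp⟩ := D.lev_exists (p b')
  obtain ⟨y₀, hy₀, hf1⟩ := hTp.exists_far (c := M) (d := M + 2 * D.σ) le_rfl (by linarith)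
    (by ring) sq
  obtain ⟨x₃, hx₃, hf2⟩ := hTq.exists_far (c := -M - 2 * D.σ) (d := -M) (by linarith) le_rfl
    (by ring) sp
  have b00 : (0:ℝ) ∈ Icc b 0 := ⟨by linarith, le_rfl⟩
  have b01 : b ∈ Icc b 0 := ⟨le_rfl, by linarith⟩
  have b10 : (0:ℝ) ∈ Icc 0 b' := ⟨le_rfl, by linarith⟩
  have b11 : b' ∈ Icc 0 b' := ⟨by linarith, le_rfl⟩
  have e2 := h2 p q θp θq y₀ b' b x₃ A S sq sp (hTp.mono hy₀.1 le_rfl) (hTq.mono le_rfl hx₃.2)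
    (by linarith [hy₀.2]) (by linarith [hx₃.1]) hA.continuousOn hAS
    (fun y hy => ⟨b01, by simp only; linarith [hy.1, hy₀.1], hy.2⟩)
    (fun x hx => ⟨⟨hx.1, by simp only; linarith [hx.2, hx₃.2]⟩, b11⟩)
    (fun y₁ hy₁ τ hτ hb => ⟨⟨by simp only; linarith [hτ.1], by simp only; linarith [hx₃.2]⟩,
      ⟨by simp only; linarith [hτ.1, hy₁.1, hy₀.1], by simp only; linarith [hτ.2]⟩⟩)
    (fun y hy => hl3 y ⟨by linarith [hy.1, hy₀.1], hy.2⟩)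
    (fun x hx => hl4 x ⟨hx.1, by linarith [hx.2, hx₃.2]⟩) hsq hsp
    (hf1.mono (by positivity)) (hf2.mono (by positivity))
  have e1 := h1 (q b) (fun y => A (b, y)) 0 y₀ le_rfl (by linarith [hy₀.1]) hy₀.2
    ((hArgV b b01).mono le_rfl (by linarith [hy₀.2]))
    (fun t ht => by
      have := hlp t ⟨ht.1, ht.2.trans hy₀.2⟩
      linarith [D.lev_sub_le (p t) (q b)])
  have e3 := h3 (p b') (fun x => A (x, b') + Real.pi) x₃ 0 hx₃.1 (by linarith [hx₃.2]) le_rfl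
    ((hArgH b' b11).mono (by linarith [hx₃.1]) le_rfl)
    (fun t ht => by
      have := hlq t ⟨hx₃.1.trans ht.1, ht.2⟩
      linarith [D.lev_sub_le (q t) (p b')])
  have e4 := h4 q θq b (-M) hTq (by linarith) (fun x => A (x, 0) + Real.pi)
    ((hArgH 0 b10).mono le_rfl (by linarith)) hm2
  have e5 := h5 p θp M b' hTp (by linarith) (fun y => A (0, y))
    ((hArgV 0 b00).mono hM le_rfl) hm1
  have e6 := h6 (fun x => A (x, 0) + Real.pi) ((hArgH 0 b10).mono (by linarith) le_rfl)
  have e7 := h7 (fun y => A (0, y)) ((hArgV 0 b00).mono le_rfl (by linarith))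
  have d1 := hTp.drift' (c := M) (d := y₀) le_rfl hy₀.1 (by linarith [hy₀.2]) (by linarith [hy₀.2])
  have d2 := hTq.drift' (c := x₃) (d := -M) (by linarith [hx₃.1]) hx₃.2 le_rfl (by linarith [hx₃.1])
  have f1 : |θp y₀ - θp M| ≤ 3 * D.σ := by
    rw [abs_le] at *; constructor <;> linarith [d1.1, d1.2, hy₀.1, hy₀.2]
  have f2 : |θq (-M) - θq x₃| ≤ 3 * D.σ := by
    rw [abs_le] at *; constructor <;> linarith [d2.1, d2.2, hx₃.1, hx₃.2]
  have g1 := D.abs_r_mul_le (c := n) f1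
  have g2 := D.abs_r_mul_le (c := n) f2
  have hfin : |D.r * (D.e - 2 * n) * ((θp b' - θp y₀) + (θq x₃ - θq b))| ≤
      C1 + C2 + C3 + C4 + C5 + C6 + C7 + 2 * (D.r * |(n : ℝ)| * (3 * D.σ)) := by
    rw [abs_le] at e1 e2 e3 e4 e5 e6 e7 g1 g2 ⊢
    constructor <;> linarith [e1.1, e1.2, e2.1, e2.2, e3.1, e3.2, e4.1, e4.2, e5.1, e5.2,
      e6.1, e6.2, e7.1, e7.2, g1.1, g1.2, g2.1, g2.2]
  have hbd := D.bound_of n hfin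
  have hg1 := (hTp.mono (c := y₀) (d := b') hy₀.1 le_rfl).growth (by linarith [hy₀.2])
  have hg2 := (hTq.mono (c := b) (d := x₃) le_rfl hx₃.2).growth (by linarith [hx₃.1])
  linarith [hy₀.2, hx₃.1]

lemma strip_bound (w : ℝ → ℂ) (y₀ y₁ : ℝ) (hy : y₀ ≤ y₁) (hw : ContinuousOn w (Icc y₀ y₁))
    (hwind : D.Wind (w y₀) n) (m₀ : ℝ) (hm₀ : 0 < m₀) :
    ∃ C, ∀ p θ x₀ X, D.Tube n p θ x₀ X → x₀ ≤ X →
      (∀ x ∈ Icc x₀ X, ∀ y ∈ Icc y₀ y₁, m₀ ≤ ‖w y - p x‖) →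
      (∀ x ∈ Icc x₀ X, D.lev (w y₁) ≤ D.lev (p x)) →
      (∀ x ∈ Icc x₀ X, ‖p x - D.v (θ x)‖ ≤ ‖w y₀ - D.v (θ x)‖) → X - x₀ ≤ C := by
  have hσ := D.hσ
  have hr := D.r_pos
  obtain ⟨C1, hC1, h1⟩ := D.rot_inner n
  obtain ⟨C2, hC2, h2⟩ := D.rot_outer n hwind
  obtain ⟨C3, hC3, h3⟩ := arg_bdd hw hm₀
  refine ⟨max (4 * D.σ) (8 / 7 * ((C1 + C2 + 2 * C3) / D.r + D.σ) + 4 * D.σ), ?_⟩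
  intro p θ x₀ X hT hX hm hl hc
  by_cases hshort : X - x₀ ≤ 4 * D.σ
  · exact hshort.trans (le_max_left _ _)
  push Not at hshort
  refine le_trans ?_ (le_max_right _ _)
  obtain ⟨s, hs⟩ := D.lev_exists (w y₁)
  obtain ⟨a, ha, hfa⟩ := hT.exists_far (c := x₀) (d := x₀ + 2 * D.σ) le_rfl (by linarith)
    (by ring) s
  obtain ⟨c, hc', hfc⟩ := hT.exists_far (c := X - 2 * D.σ) (d := X) (by linarith) le_rfl
    (by ring) s
  have hac : a ≤ c := by linarith [ha.2, hc'.1]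
  have hxm : ∀ x, clamp x₀ X x ∈ Icc x₀ X := clamp_mem hX
  have hym : ∀ x, clamp y₀ y₁ x ∈ Icc y₀ y₁ := clamp_mem hy
  obtain ⟨A, hA, hAa⟩ := exists_arg2 (fun x => w (clamp y₀ y₁ x.2) - p (clamp x₀ X x.1))
    ((hw.comp_continuous ((continuous_clamp _ _).comp continuous_snd) (fun x => hym x.2)).sub
      (hT.hu.comp_continuous ((continuous_clamp _ _).comp continuous_fst) (fun x => hxm x.1)))
    (fun x h0 => by
      have := hm _ (hxm x.1) _ (hym x.2)
      rw [h0, norm_zero] at this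
      linarith)
  have hAS : ∀ x ∈ Icc x₀ X, ∀ y ∈ Icc y₀ y₁, w y - p x ≠ 0 ∧
      w y - p x = (‖w y - p x‖ : ℂ) * Complex.exp ((A (x, y) : ℂ) * Complex.I) := by
    intro x hx y hy
    refine ⟨fun h0 => ?_, ?_⟩
    · have := hm x hx y hy
      rw [h0, norm_zero] at this
      linarith
    have := hAa (x, y)
    simp only at this
    rwa [clamp_eq hx, clamp_eq hy] at this
  have hArgH : ∀ y ∈ Icc y₀ y₁, IsArg (fun x => p x - w y) (fun x => A (x, y) + Real.pi) x₀ X :=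
    fun y hy =>
    (IsArg.neg (f := fun x => w y - p x) (α := fun x => A (x, y))
      ⟨by fun_prop, fun x hx => hAS x hx y hy⟩).congr (fun t _ => by ring)
  have hI : Icc a c ⊆ Icc x₀ X := Icc_subset_Icc ha.1 hc'.2
  have e1 := h1 p θ a c (hT.mono ha.1 hc'.2) hac (w y₁) s _
    ((hArgH y₁ ⟨hy, le_rfl⟩).mono ha.1 hc'.2)
    (fun t ht => by rw [← hs]; exact (hl t (hI ht)).trans (D.lev_le _ _))
    (hfa.mono (by positivity)) (hfc.mono (by positivity))
  have e2 := h2 p θ a c (hT.mono ha.1 hc'.2) hac _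
    ((hArgH y₀ ⟨le_rfl, hy⟩).mono ha.1 hc'.2) (fun t ht => hc t (hI ht))
  have e3 : ∀ x ∈ Icc x₀ X, |A (x, y₁) - A (x, y₀)| ≤ C3 := fun x hx =>
    h3 (p x) (fun y => A (x, y)) y₀ y₁ le_rfl hy le_rfl
      ⟨by fun_prop, fun y hy => hAS x hx y hy⟩ (fun y hy => hm x hx y hy)
  have e4 := e3 a (hI ⟨le_rfl, hac⟩)
  have e5 := e3 c (hI ⟨hac, le_rfl⟩)
  have hfin : |D.r * (D.e - 2 * n) * (θ c - θ a)| ≤ C1 + C2 + 2 * C3 := by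
    rw [abs_le] at e1 e2 e4 e5 ⊢
    constructor <;> linarith [e1.1, e1.2, e2.1, e2.2, e4.1, e4.2, e5.1, e5.2]
  have hbd := D.bound_of n hfin
  have hg := (hT.mono (c := a) (d := c) ha.1 hc'.2).growth hac
  linarith [ha.2, hc'.1]

end PD
end PBend

namespace PBend

lemma first_hit {f : ℝ → ℝ} {a c ζ : ℝ} (hac : a ≤ c) (hf : ContinuousOn f (Icc a c))
    (ha : ζ < f a) (hc : f c < ζ) : ∃ b ∈ Icc a c, f b = ζ ∧ ∀ t ∈ Icc a b, ζ ≤ f t := by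
  have hcl : IsClosed (Icc a c ∩ f ⁻¹' (Iic ζ)) :=
    hf.preimage_isClosed_of_isClosed isClosed_Icc isClosed_Iic
  have hne : (Icc a c ∩ f ⁻¹' (Iic ζ)).Nonempty := ⟨c, ⟨hac, le_rfl⟩, hc.le⟩
  have hcpt : IsCompact (Icc a c ∩ f ⁻¹' (Iic ζ)) :=
    isCompact_Icc.of_isClosed_subset hcl inter_subset_left
  obtain ⟨b, ⟨hb, hbζ⟩, hmin⟩ := hcpt.exists_isLeast hne
  have hlt : ∀ t ∈ Icc a b, t ≠ b → ζ < f t := by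
    intro t ht htb
    by_contra h
    exact htb (le_antisymm ht.2 (hmin ⟨⟨ht.1, ht.2.trans hb.2⟩, not_lt.1 h⟩))
  have hfb : f b = ζ := by
    refine le_antisymm hbζ ?_
    by_contra h
    push Not at h
    obtain ⟨t, ht, hte⟩ := intermediate_value_Icc' hb.1 (hf.mono (Icc_subset_Icc le_rfl hb.2))
      (⟨h.le, ha.le⟩ : ζ ∈ Icc (f b) (f a))
    have := hlt t ht (fun h' => by rw [h'] at hte; linarith)
    linarith
  refine ⟨b, hb, hfb, fun t ht => ?_⟩
  by_cases h : t = b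
  · rw [h, hfb]
  · exact (hlt t ht h).le

lemma last_hit {f : ℝ → ℝ} {a c ζ : ℝ} (hac : a ≤ c) (hf : ContinuousOn f (Icc a c))
    (ha : f a < ζ) (hc : ζ < f c) : ∃ b ∈ Icc a c, f b = ζ ∧ ∀ t ∈ Icc b c, ζ ≤ f t := by
  obtain ⟨b, hb, h1, h2⟩ := first_hit (f := fun t => f (-t)) (a := -c) (c := -a) (ζ := ζ)
    (by linarith) (hf.comp (by fun_prop) (fun t ht => ⟨by linarith [ht.2], by linarith [ht.1]⟩))
    (by simpa using hc) (by simpa using ha)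
  refine ⟨-b, ⟨by linarith [hb.2], by linarith [hb.1]⟩, h1, fun t ht => ?_⟩
  simpa using h2 (-t) ⟨by linarith [ht.2], by linarith [ht.1]⟩

lemma first_hit' {f : ℝ → ℝ} {a c ζ : ℝ} (hac : a ≤ c) (hf : ContinuousOn f (Icc a c))
    (ha : f a < ζ) (hc : ζ < f c) : ∃ b ∈ Icc a c, f b = ζ ∧ ∀ t ∈ Icc a b, f t ≤ ζ := by
  obtain ⟨b, hb, h1, h2⟩ := first_hit (f := fun t => - f t) (ζ := -ζ) hac hf.neg
    (by linarith) (by linarith)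
  exact ⟨b, hb, by linarith, fun t ht => by linarith [h2 t ht]⟩

lemma last_hit' {f : ℝ → ℝ} {a c ζ : ℝ} (hac : a ≤ c) (hf : ContinuousOn f (Icc a c))
    (ha : ζ < f a) (hc : f c < ζ) : ∃ b ∈ Icc a c, f b = ζ ∧ ∀ t ∈ Icc b c, f t ≤ ζ := by
  obtain ⟨b, hb, h1, h2⟩ := last_hit (f := fun t => - f t) (ζ := -ζ) hac hf.neg
    (by linarith) (by linarith)
  exact ⟨b, hb, by linarith, fun t ht => by linarith [h2 t ht]⟩

lemma compact_pos {X : Type*} [TopologicalSpace X] {C : Set X} (hC : IsCompact C) {f : X → ℝ}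
    (hf : ContinuousOn f C) (hpos : ∀ x ∈ C, 0 < f x) : ∃ η, 0 < η ∧ ∀ x ∈ C, η ≤ f x := by
  rcases C.eq_empty_or_nonempty with h | h
  · exact ⟨1, one_pos, fun x hx => by simp [h] at hx⟩
  · obtain ⟨x₀, hx₀, hmin⟩ := hC.exists_isMinOn h hf
    exact ⟨f x₀, hpos x₀ hx₀, fun x hx => hmin hx⟩

lemma near_int {f : ℝ → ℝ} {S σ : ℝ} (hσ : 0 < σ) (hS : 0 ≤ S) (hf : ContinuousOn f (Icc 0 S))
    (h : ∀ s ∈ Icc 0 S, ∃ k : ℤ, |f s - k * σ| < σ / 16) : |f S - f 0| ≤ σ / 8 := by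
  obtain ⟨k0, hk0⟩ := h 0 ⟨le_rfl, hS⟩
  obtain ⟨k1, hk1⟩ := h S ⟨hS, le_rfl⟩
  have hq : ∀ x, ∀ k : ℤ, (|x - k0 * σ| = σ / 4) → ¬ |x - k * σ| < σ / 16 := by
    intro x k hx hk
    rw [abs_lt] at hk
    have : (-1 : ℝ) < (k - k0 : ℤ) ∧ ((k - k0 : ℤ) : ℝ) < 1 ∧ ((k - k0 : ℤ) : ℝ) ≠ 0 := by
      push_cast
      refine ⟨?_, ?_, fun h0 => ?_⟩
      · rcases abs_eq (by positivity) |>.1 hx with h' | h' <;> nlinarith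
      · rcases abs_eq (by positivity) |>.1 hx with h' | h' <;> nlinarith
      · have : (k : ℝ) = k0 := by linarith
        rw [this] at hk
        rcases abs_eq (by positivity) |>.1 hx with h' | h' <;> linarith [hk.1, hk.2]
    have h1 : -1 < k - k0 := by exact_mod_cast this.1
    have h2 : k - k0 < 1 := by exact_mod_cast this.2.1
    have h3 : k - k0 ≠ 0 := by exact_mod_cast this.2.2
    omega
  have hbd : |f S - k0 * σ| < σ / 4 := by
    by_contra hcon
    push Not at hcon
    obtain ⟨t, ht, hte⟩ := intermediate_value_Icc hS
      (f := fun t => |f t - k0 * σ|) (hf.sub continuousOn_const).abs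
      (show σ / 4 ∈ Icc _ _ from ⟨by linarith, hcon⟩)
    obtain ⟨k, hk⟩ := h t ht
    exact hq (f t) k hte hk
  have : k1 = k0 := by
    rw [abs_lt] at hbd hk1
    have : (-1 : ℝ) < (k1 - k0 : ℤ) ∧ ((k1 - k0 : ℤ) : ℝ) < 1 := by
      push_cast
      constructor <;> nlinarith
    have h1 : -1 < k1 - k0 := by exact_mod_cast this.1
    have h2 : k1 - k0 < 1 := by exact_mod_cast this.2
    omega
  rw [this] at hk1
  rw [abs_lt] at hk0 hk1
  rw [abs_le]
  constructor <;> linarith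

namespace PD
variable (D : PD)

/-- phase function -/
lemma exists_phase_fun (hinj : ∀ a b, D.v a = D.v b → ∃ k : ℤ, a - b = k * D.σ) :
    ∃ g : ℂ → ℂ, Continuous g ∧ ∀ s, g (D.v s) = Complex.exp (((D.r * s : ℝ) : ℂ) * Complex.I) := by
  have : Fact (0 < D.σ) := ⟨D.hσ⟩
  have hP : Function.Periodic D.v D.σ := D.hper
  let e : AddCircle D.σ → ℂ := hP.lift
  have hec : Continuous e := continuous_coinduced_dom.mpr D.hv
  have hei : Function.Injective e := by
    intro x y hxy
    induction x using QuotientAddGroup.induction_on with | _ a => ?_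
    induction y using QuotientAddGroup.induction_on with | _ b => ?_
    obtain ⟨k, hk⟩ := hinj a b hxy
    have h1 : ((a - b : ℝ) : AddCircle D.σ) = 0 :=
      AddCircle.coe_eq_zero_iff (p := D.σ) |>.2 ⟨k, by rw [hk]; simp⟩
    rw [AddCircle.coe_sub] at h1
    exact sub_eq_zero.1 h1
  obtain ⟨g, hg⟩ := ContinuousMap.exists_extension' (hec.isClosedEmbedding hei)
    (⟨fun x => ((AddCircle.toCircle x : Circle) : ℂ),
      continuous_subtype_val.comp AddCircle.continuous_toCircle⟩ : C(AddCircle D.σ, ℂ))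
  refine ⟨g, g.continuous, fun s => ?_⟩
  have h2 := congrFun hg (s : AddCircle D.σ)
  simp only [Function.comp, ContinuousMap.coe_mk, AddCircle.toCircle_apply_mk, Circle.coe_exp] at h2
  exact h2

lemma isCompact_lev (c : ℝ) : IsCompact {z | D.lev z ≤ c} := by
  refine Metric.isCompact_of_isClosed_isBounded (isClosed_le D.lev_cont continuous_const) ?_
  obtain ⟨R, hR⟩ := D.isCompact_range.isBounded.exists_norm_le
  refine isBounded_iff_forall_norm_le.2 ⟨R + c, fun z hz => ?_⟩
  obtain ⟨s, hs⟩ := D.lev_exists z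
  have h1 := hR (D.v s) ⟨s, rfl⟩
  have h2 : D.lev z ≤ c := hz
  calc ‖z‖ = ‖D.v s + (z - D.v s)‖ := by congr 1; ring
    _ ≤ ‖D.v s‖ + ‖z - D.v s‖ := norm_add_le _ _
    _ ≤ R + c := by linarith

lemma phase_close {g : ℂ → ℂ} (hg : Continuous g)
    (hgv : ∀ s, g (D.v s) = Complex.exp (((D.r * s : ℝ) : ℂ) * Complex.I)) {ε : ℝ} (hε : 0 < ε) :
    ∃ η, 0 < η ∧ ∀ z, D.lev z ≤ η → g z ≠ 0 ∧
      ∀ θ : ℝ, g z = (‖g z‖ : ℂ) * Complex.exp (((D.r * θ : ℝ) : ℂ) * Complex.I) →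
        ‖z - D.v θ‖ < ε := by
  have hv := D.hv
  have hσ := D.hσ
  have hr := D.r_pos
  have hK := D.isCompact_lev 1
  have hlc := D.lev_cont
  obtain ⟨η₁, hη₁, h1⟩ := compact_pos (C := {z | D.lev z ≤ 1} ∩ g ⁻¹' {0}) (f := D.lev)
    (hK.inter_right (isClosed_singleton.preimage hg)) hlc.continuousOn (by
      rintro z ⟨_, hz⟩
      apply D.lev_pos
      rintro ⟨s, rfl⟩
      rw [mem_preimage, hgv, mem_singleton_iff] at hz
      exact Complex.exp_ne_zero _ hz)
  obtain ⟨η₂, hη₂, h2⟩ := compact_pos (C := ({z | D.lev z ≤ 1} ×ˢ Icc 0 D.σ) ∩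
      {x : ℂ × ℝ | g x.1 = (‖g x.1‖ : ℂ) * Complex.exp (((D.r * x.2 : ℝ) : ℂ) * Complex.I) ∧
        ε ≤ ‖x.1 - D.v x.2‖}) (f := fun x => D.lev x.1)
    ((hK.prod isCompact_Icc).inter_right (by
      refine IsClosed.inter (s₁ := {x : ℂ × ℝ | g x.1 = (‖g x.1‖ : ℂ) *
        Complex.exp (((D.r * x.2 : ℝ) : ℂ) * Complex.I)})
        (s₂ := {x : ℂ × ℝ | ε ≤ ‖x.1 - D.v x.2‖}) (isClosed_eq (by fun_prop) (by fun_prop))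
        (isClosed_le (by fun_prop) (by fun_prop)))) (by fun_prop) (by
      rintro ⟨z, θ⟩ ⟨_, hz, hz'⟩
      apply D.lev_pos
      rintro ⟨s, rfl⟩
      simp only at hz hz'
      rw [hgv, Complex.norm_exp_ofReal_mul_I, Complex.ofReal_one, one_mul,
        Complex.exp_eq_exp_iff_exists_int] at hz
      obtain ⟨k, hk⟩ := hz
      have h3 : D.r * s = D.r * θ + k * (2 * Real.pi) := by
        have h4 : (((D.r * s : ℝ) : ℂ)) * Complex.I =
            (((D.r * θ + k * (2 * Real.pi) : ℝ)) : ℂ) * Complex.I := by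
          rw [hk]; push_cast; ring
        exact_mod_cast mul_right_cancel₀ Complex.I_ne_zero h4
      rw [← D.r_mul] at h3
      have h5 : s = θ + k * D.σ := by
        apply mul_left_cancel₀ hr.ne'
        rw [h3]; ring
      rw [h5, D.per_int, sub_self, norm_zero] at hz'
      linarith)
  refine ⟨min (min η₁ η₂ / 2) 1, by positivity, fun z hz => ?_⟩
  have hz1 : D.lev z ≤ 1 := hz.trans (min_le_right _ _)
  have hz2 : D.lev z ≤ min η₁ η₂ / 2 := hz.trans (min_le_left _ _)
  have hz3 : min η₁ η₂ / 2 < η₁ := by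
    have := min_le_left η₁ η₂
    linarith
  have hz4 : min η₁ η₂ / 2 < η₂ := by
    have := min_le_right η₁ η₂
    linarith
  refine ⟨fun h0 => ?_, fun θ hθ => ?_⟩
  · linarith [h1 z ⟨hz1, h0⟩]
  · by_contra hcon
    push Not at hcon
    set k := ⌊θ / D.σ⌋ with hk
    have e1 : (k : ℝ) ≤ θ / D.σ := Int.floor_le _
    have e2 : θ / D.σ < k + 1 := Int.lt_floor_add_one _
    rw [le_div_iff₀ hσ] at e1
    rw [div_lt_iff₀ hσ] at e2
    have e3 : D.v (θ - k * D.σ) = D.v θ := by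
      rw [← D.per_int k, sub_add_cancel]
    have e4 : Complex.exp (((D.r * (θ - k * D.σ) : ℝ) : ℂ) * Complex.I) =
        Complex.exp (((D.r * θ : ℝ) : ℂ) * Complex.I) := by
      rw [Complex.exp_eq_exp_iff_exists_int]
      refine ⟨-k, ?_⟩
      rw [show D.r * (θ - k * D.σ) = D.r * θ - k * (D.r * D.σ) by ring, D.r_mul]
      push_cast; ring
    have := h2 (z, θ - k * D.σ) ⟨⟨hz1, by linarith, by linarith⟩, by simp only; rw [e4]; exact hθ,
      by simp only; rw [e3]; exact hcon⟩
    simp only at this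
    linarith

end PD
end PBend

namespace PBend

/-- planar flow setting -/
structure FS where
  D : PD
  hinj : ∀ a b, D.v a = D.v b → ∃ k : ℤ, a - b = k * D.σ
  K : Set ℂ
  hK : IsCompact K
  Ψ : ℝ → ℂ → ℂ
  maps : ∀ t, ∀ z ∈ K, Ψ t z ∈ K
  zero : ∀ z ∈ K, Ψ 0 z = z
  add : ∀ s t, ∀ z ∈ K, Ψ (s + t) z = Ψ s (Ψ t z)
  cont : ContinuousOn (fun x : ℝ × ℂ => Ψ x.1 x.2) (univ ×ˢ K)
  hvK : ∀ s, D.v s ∈ K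
  hvΨ : ∀ s t, Ψ t (D.v s) = D.v (s + t)
  w : ℝ → ℂ
  T : ℝ
  hw : ContinuousOn w (Ici T)
  W1 : ∀ z ∈ K, ∀ S ε : ℝ, 0 < ε → ∃ t ≥ S, ‖w t - z‖ < ε
  W2 : ∀ ε N : ℝ, 0 < ε → ∃ S, ∀ t ≥ S, ∃ z ∈ K, ∀ s ∈ Icc (-N) N, ‖w (t + s) - Ψ s z‖ < ε
  J : ∀ y ≥ T, w y ∈ K → ∀ t ≥ 0, w (y + t) = Ψ t (w y)
  z0 : ℂ
  hz0 : z0 ∈ K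
  hz0γ : z0 ∉ range D.v

namespace FS
variable (F : FS)

lemma orb_cont {z : ℂ} (hz : z ∈ F.K) : Continuous (fun t => F.Ψ t z) :=
  F.cont.comp_continuous (f := fun t : ℝ => ((t, z) : ℝ × ℂ)) (by fun_prop) (fun _ => ⟨trivial, hz⟩)

lemma lev_orb_cont {z : ℂ} (hz : z ∈ F.K) : Continuous (fun t => F.D.lev (F.Ψ t z)) :=
  F.D.lev_cont.comp (F.orb_cont hz)

lemma map_contOn (t : ℝ) : ContinuousOn (F.Ψ t) F.K :=
  F.cont.comp (f := fun z : ℂ => ((t, z) : ℝ × ℂ)) (by fun_prop) (fun z hz => ⟨trivial, hz⟩)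

lemma add' (s t : ℝ) {z : ℂ} (hz : z ∈ F.K) : F.Ψ s (F.Ψ t z) = F.Ψ (s + t) z :=
  (F.add s t z hz).symm

lemma orb_notMem {z : ℂ} (hz : z ∈ F.K) (h : z ∉ range F.D.v) (t : ℝ) :
    F.Ψ t z ∉ range F.D.v := by
  rintro ⟨s, hs⟩
  apply h
  refine ⟨s + -t, ?_⟩
  rw [← F.hvΨ, hs, F.add' _ _ hz, neg_add_cancel, F.zero z hz]

lemma lev_z0 : 0 < F.D.lev F.z0 := F.D.lev_pos F.hz0γ

lemma exists_w_far (S : ℝ) : ∃ t ≥ S, F.D.lev F.z0 / 2 < F.D.lev (F.w t) := by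
  have h0 := F.lev_z0
  obtain ⟨t, ht, h⟩ := F.W1 F.z0 F.hz0 S (F.D.lev F.z0 / 2) (by positivity)
  refine ⟨t, ht, ?_⟩
  have := F.D.lev_sub_le F.z0 (F.w t)
  rw [norm_sub_rev] at this
  linarith

lemma exists_w_near (S : ℝ) {ζ : ℝ} (hζ : 0 < ζ) : ∃ t ≥ S, F.D.lev (F.w t) < ζ := by
  obtain ⟨t, ht, h⟩ := F.W1 (F.D.v 0) (F.hvK 0) S ζ hζ
  exact ⟨t, ht, (F.D.lev_le _ 0).trans_lt h⟩

lemma w_notMem {y : ℝ} (hy : F.T ≤ y) : F.w y ∉ range F.D.v := by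
  rintro ⟨s, hs⟩
  obtain ⟨t, ht, h⟩ := F.exists_w_far y
  have h1 := F.J y hy (by rw [← hs]; exact F.hvK s) (t - y) (by linarith)
  rw [add_sub_cancel, ← hs, F.hvΨ] at h1
  have : F.D.lev (F.w t) = 0 := F.D.lev_eq_zero.2 ⟨_, h1.symm⟩
  linarith [F.lev_z0]

lemma exists_n : ∃ n : ℤ, (∀ y ≥ F.T, F.D.Wind (F.w y) n) ∧
    ∀ z ∈ F.K, z ∉ range F.D.v → F.D.Wind z n := by
  have hex : ∀ y, ∃ n : ℤ, y ≥ F.T → F.D.Wind (F.w y) n := fun y => by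
    by_cases h : F.T ≤ y
    · obtain ⟨n, hn⟩ := F.D.exists_wind (F.w_notMem h)
      exact ⟨n, fun _ => hn⟩
    · exact ⟨0, fun h' => absurd h' h⟩
  choose N hN using hex
  have hNc : ContinuousOn N (Ici F.T) := by
    intro y hy
    have hpos := F.D.lev_pos (F.w_notMem hy)
    have h1 := Metric.tendsto_nhds.1 (F.hw y hy) _ hpos
    refine Filter.Tendsto.congr' (f₁ := fun _ => N y) ?_ tendsto_const_nhds
    filter_upwards [h1, self_mem_nhdsWithin] with t ht htT
    rw [dist_eq_norm] at ht
    exact F.D.wind_unique (F.D.wind_of_close (hN y hy) ht) (hN t htT)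
  have hconst : ∀ y ≥ F.T, N y = N F.T := fun y hy =>
    isPreconnected_Ici.constant hNc hy (self_mem_Ici)
  refine ⟨N F.T, fun y hy => hconst y hy ▸ hN y hy, fun z hz hzγ => ?_⟩
  obtain ⟨m, hm⟩ := F.D.exists_wind hzγ
  obtain ⟨t, ht, h⟩ := F.W1 z hz F.T _ (F.D.lev_pos hzγ)
  have h1 := F.D.wind_of_close hm h
  rw [F.D.wind_unique h1 (hN t ht), hconst t ht] at hm
  exact hm

/-- tracking the periodic orbit -/
lemma track (N : ℝ) {ε : ℝ} (hε : 0 < ε) : ∃ η, 0 < η ∧ ∀ z ∈ F.K, F.D.lev z ≤ η →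
    ∃ s₀, ∀ s ∈ Icc (-N) N, ‖F.Ψ s z - F.D.v (s₀ + s)‖ < ε := by
  have huc := (isCompact_Icc (a := -N) (b := N)).prod F.hK |>.uniformContinuousOn_of_continuous
    (F.cont.mono (prod_mono (subset_univ _) subset_rfl))
  rw [Metric.uniformContinuousOn_iff] at huc
  obtain ⟨δ, hδ, h⟩ := huc ε hε
  refine ⟨δ / 2, by positivity, fun z hz hl => ?_⟩
  obtain ⟨s₀, hs₀⟩ := F.D.lev_exists z
  refine ⟨s₀, fun s hs => ?_⟩
  have := h (s, z) ⟨hs, hz⟩ (s, F.D.v s₀) ⟨hs, F.hvK _⟩ (by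
    rw [Prod.dist_eq, dist_self, dist_eq_norm, ← hs₀]
    exact max_lt hδ (by linarith))
  simp only at this
  rwa [F.hvΨ, dist_eq_norm] at this

lemma tube {n : ℤ} (hn : ∀ z ∈ F.K, z ∉ range F.D.v → F.D.Wind z n) {ε : ℝ} (hε : 0 < ε) :
    ∃ η, 0 < η ∧ ∀ p ∈ F.K, p ∉ range F.D.v → ∀ a b, a ≤ b →
      (∀ t ∈ Icc a b, F.D.lev (F.Ψ t p) ≤ η) →
      ∃ θ, F.D.Tube n (fun t => F.Ψ t p) θ a b ∧
        ∀ t ∈ Icc a b, ‖F.Ψ t p - F.D.v (θ t)‖ < ε := by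
  have hμ := F.D.hμ
  have hσ := F.D.hσ
  have hr := F.D.r_pos
  set ε' := min ε (F.D.μ / 4) with hε'
  have hε'0 : 0 < ε' := by positivity
  obtain ⟨g, hg, hgv⟩ := F.D.exists_phase_fun F.hinj
  obtain ⟨η₁, hη₁, h1⟩ := F.D.phase_close hg hgv hε'0
  obtain ⟨η₂, hη₂, h2⟩ := F.track (3 * F.D.σ) hε'0
  refine ⟨min η₁ η₂, by positivity, fun p hp hpγ a b hab hl => ?_⟩
  have hc := F.orb_cont hp
  have hcl : Continuous (fun t => F.Ψ (clamp a b t) p) := hc.comp (continuous_clamp a b)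
  obtain ⟨A, hA, hAa⟩ := exists_arg1 (fun t => g (F.Ψ (clamp a b t) p)) (hg.comp hcl)
    (fun t => (h1 _ ((hl _ (clamp_mem hab t)).trans (min_le_left _ _))).1)
  have hclose : ∀ t ∈ Icc a b, ‖F.Ψ t p - F.D.v (A t / F.D.r)‖ < ε' := by
    intro t ht
    refine (h1 _ ((hl t ht).trans (min_le_left _ _))).2 _ ?_
    have := hAa t
    simp only [clamp_eq ht] at this
    rwa [mul_div_cancel₀ _ hr.ne']
  refine ⟨fun t => A t / F.D.r, ⟨hc.continuousOn, by fun_prop, fun t ht =>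
    (hclose t ht).trans_le (min_le_right _ _), ?_, fun t ht => hn _ (F.maps t p hp)
      (F.orb_notMem hp hpγ t)⟩, fun t ht => (hclose t ht).trans_le (min_le_left _ _)⟩
  intro t ht S hS hSb
  obtain ⟨s₀, hs₀⟩ := h2 _ (F.maps t p hp) ((hl t ht).trans (min_le_right _ _))
  have := near_int (f := fun s => A (t + s) / F.D.r - s - s₀) hσ hS.1 (by fun_prop) (by
    intro s hs
    have e1 := hclose (t + s) ⟨by linarith [hs.1, ht.1], by linarith [hs.2]⟩
    have e2 := hs₀ s ⟨by linarith [hs.1], by linarith [hs.2, hS.2]⟩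
    rw [F.add' _ _ hp, add_comm s t] at e2
    obtain ⟨k, hk⟩ := F.D.near (A (t + s) / F.D.r) (s₀ + s) (by
      rw [show F.D.v (A (t + s) / F.D.r) - F.D.v (s₀ + s) =
        (F.Ψ (t + s) p - F.D.v (s₀ + s)) - (F.Ψ (t + s) p - F.D.v (A (t + s) / F.D.r)) by ring]
      have := norm_sub_le (F.Ψ (t + s) p - F.D.v (s₀ + s))
        (F.Ψ (t + s) p - F.D.v (A (t + s) / F.D.r))
      have := min_le_right ε (F.D.μ / 4)
      linarith)
    refine ⟨k, ?_⟩
    rwa [show A (t + s) / F.D.r - s - s₀ - k * F.D.σ =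
      A (t + s) / F.D.r - (s₀ + s) - k * F.D.σ by ring])
  simp only [add_zero] at this
  rwa [show A (t + S) / F.D.r - S - s₀ - (A t / F.D.r - 0 - s₀) =
    A (t + S) / F.D.r - A t / F.D.r - S by ring] at this

end FS
end PBend

namespace PBend
namespace FS
variable (F : FS)

lemma lim_pt (z : ℕ → ℂ) (hz : ∀ k, z k ∈ F.K) : ∃ p ∈ F.K, ∃ φ : ℕ → ℕ, StrictMono φ ∧
    ∀ t, Tendsto (fun k => F.D.lev (F.Ψ t (z (φ k)))) atTop (𝓝 (F.D.lev (F.Ψ t p))) := by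
  obtain ⟨p, hp, φ, hφ, hlim⟩ := F.hK.tendsto_subseq hz
  refine ⟨p, hp, φ, hφ, fun t => ?_⟩
  have h1 : Tendsto (fun k => z (φ k)) atTop (𝓝[F.K] p) :=
    tendsto_nhdsWithin_iff.2 ⟨hlim, Eventually.of_forall fun k => hz _⟩
  exact (F.D.lev_cont.tendsto _).comp ((F.map_contOn t p hp).tendsto.comp h1)

/-- tube property at level `η` with accuracy `ε` -/
def TubeAt (n : ℤ) (η ε : ℝ) : Prop := ∀ p ∈ F.K, p ∉ range F.D.v → ∀ a b, a ≤ b →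
      (∀ t ∈ Icc a b, F.D.lev (F.Ψ t p) ≤ η) →
      ∃ θ, F.D.Tube n (fun t => F.Ψ t p) θ a b ∧
        ∀ t ∈ Icc a b, ‖F.Ψ t p - F.D.v (θ t)‖ < ε

variable {F} {n : ℤ} {η ε : ℝ}

lemma TubeAt.mono (h : F.TubeAt n η ε) {η' : ℝ} (h' : η' ≤ η) : F.TubeAt n η' ε :=
  fun p hp hpγ a b hab hl => h p hp hpγ a b hab (fun t ht => (hl t ht).trans h')

lemma notMem_of_lev {z : ℂ} (h : 0 < F.D.lev z) : z ∉ range F.D.v := fun h' => by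
  rw [F.D.lev_eq_zero.2 h'] at h; exact lt_irrefl _ h

lemma no_strip (hnw : ∀ y ≥ F.T, F.D.Wind (F.w y) n) (hT : F.TubeAt n η ε)
    (hε : ε ≤ F.D.lev F.z0 / 2) {ζ : ℝ} (hζ : 0 < ζ) {p : ℂ} (hp : p ∈ F.K)
    (hl : ∀ x, ζ ≤ F.D.lev (F.Ψ x p) ∧ F.D.lev (F.Ψ x p) ≤ η) : False := by
  have hpγ : p ∉ range F.D.v := by
    have := (hl 0).1
    rw [F.zero p hp] at this
    exact notMem_of_lev (by linarith)
  obtain ⟨y₀, hy₀, hfar⟩ := F.exists_w_far F.T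
  obtain ⟨y₁, hy₁, hnear⟩ := F.exists_w_near y₀ hζ
  set C : Set ℂ := F.K ∩ ⋂ t : ℝ, (F.K ∩ F.Ψ t ⁻¹' {z | ζ ≤ F.D.lev z}) with hC
  have hCc : IsCompact C := F.hK.inter_right (isClosed_iInter fun t =>
    (F.map_contOn t).preimage_isClosed_of_isClosed F.hK.isClosed
      (isClosed_le continuous_const F.D.lev_cont))
  have hwc : ContinuousOn F.w (Icc y₀ y₁) := F.hw.mono (fun t ht => le_trans hy₀ ht.1)
  obtain ⟨m₀, hm₀, hm⟩ := compact_pos (C := Icc y₀ y₁ ×ˢ C) (f := fun x => ‖F.w x.1 - x.2‖)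
    (isCompact_Icc.prod hCc)
    ((hwc.comp continuousOn_fst (fun x hx => hx.1)).sub continuousOn_snd).norm (by
      rintro ⟨y, z⟩ ⟨hy, hz⟩
      simp only at hy hz ⊢
      rw [norm_pos_iff, sub_ne_zero]
      intro h
      obtain ⟨t, ht, htl⟩ := F.exists_w_near y hζ
      have h1 := F.J y (hy₀.trans hy.1) (by rw [h]; exact hz.1) (t - y) (by linarith)
      rw [add_sub_cancel, h] at h1
      have h2 := (mem_iInter.1 hz.2 (t - y)).2
      simp only [mem_preimage, mem_ofPred_eq] at h2
      rw [← h1] at h2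
      linarith)
  obtain ⟨Cb, hCb⟩ := F.D.strip_bound n F.w y₀ y₁ hy₁ hwc (hnw y₀ hy₀) m₀ hm₀
  obtain ⟨θ, hθ, hcl⟩ := hT p hp hpγ 0 (max Cb 0 + 1) (by positivity) (fun t _ => (hl t).2)
  have := hCb _ θ 0 _ hθ (by positivity) (fun x _ y hy => hm (y, F.Ψ x p) ⟨hy, F.maps x p hp,
    mem_iInter.2 fun t => ⟨F.maps x p hp, by
      simp only [mem_preimage, mem_ofPred_eq]
      rw [F.add' _ _ hp]; exact (hl _).1⟩⟩)
    (fun x _ => hnear.le.trans (hl x).1)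
    (fun x hx => (hcl x hx).le.trans (hε.trans (hfar.le.trans (F.D.lev_le _ _))))
  linarith [le_max_left Cb 0]

lemma half_inf (hnw : ∀ y ≥ F.T, F.D.Wind (F.w y) n) (hT : F.TubeAt n η ε)
    (hε : ε ≤ F.D.lev F.z0 / 2) {p : ℂ} (hp : p ∈ F.K) (κ : ℝ) (hκ : κ = 1 ∨ κ = -1) (M : ℝ)
    (hl : ∀ x ≥ M, F.D.lev (F.Ψ (κ * x) p) ≤ η) {ζ : ℝ} (hζ : 0 < ζ) :
    ∃ x ≥ M, F.D.lev (F.Ψ (κ * x) p) < ζ := by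
  by_contra hcon
  push Not at hcon
  have hκ2 : κ * κ = 1 := by rcases hκ with h | h <;> rw [h] <;> norm_num
  obtain ⟨q, hq, φ, hφ, hlim⟩ := F.lim_pt (fun k => F.Ψ (κ * k) p) (fun k => F.maps _ p hp)
  refine no_strip hnw hT hε hζ hq (fun t => ?_)
  have hev : ∀ᶠ k in atTop, ζ ≤ F.D.lev (F.Ψ t (F.Ψ (κ * (φ k : ℕ)) p)) ∧
      F.D.lev (F.Ψ t (F.Ψ (κ * (φ k : ℕ)) p)) ≤ η := by
    have h1 : Tendsto (fun k => ((φ k : ℕ) : ℝ)) atTop atTop :=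
      tendsto_natCast_atTop_atTop.comp hφ.tendsto_atTop
    filter_upwards [h1.eventually_ge_atTop (M - κ * t)] with k hk
    rw [F.add' _ _ hp, show t + κ * (φ k : ℝ) = κ * (κ * t + φ k) by
      rw [mul_add, ← mul_assoc, hκ2, one_mul]]
    exact ⟨hcon _ (by linarith), hl _ (by linarith)⟩
  exact ⟨ge_of_tendsto (hlim t) (hev.mono fun k h => h.1),
    le_of_tendsto (hlim t) (hev.mono fun k h => h.2)⟩

lemma lev_min {p : ℂ} (hp : p ∈ F.K) (hpγ : p ∉ range F.D.v) (a b : ℝ) :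
    ∃ m, 0 < m ∧ ∀ t ∈ Icc a b, m ≤ F.D.lev (F.Ψ t p) :=
  compact_pos isCompact_Icc (F.lev_orb_cont hp).continuousOn
    (fun t _ => F.D.lev_pos (F.orb_notMem hp hpγ t))

lemma per_iter {p : ℂ} (hp : p ∈ F.K) {τ : ℝ} (h : F.Ψ τ p = p) (k : ℤ) (t : ℝ) :
    F.Ψ (t + k * τ) p = F.Ψ t p := by
  have hP : Function.Periodic (fun t => F.Ψ t p) τ := fun t => by
    simp only
    rw [← F.add' _ _ hp, h]
  exact hP.int_mul k t

lemma per_lev {p : ℂ} (hp : p ∈ F.K) {τ : ℝ} (hτ : 0 < τ) (h : F.Ψ τ p = p)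
    (hpγ : p ∉ range F.D.v) : ∃ m, 0 < m ∧ ∀ t, m ≤ F.D.lev (F.Ψ t p) := by
  obtain ⟨m, hm, hml⟩ := lev_min hp hpγ 0 τ
  refine ⟨m, hm, fun t => ?_⟩
  have hP : Function.Periodic (fun t => F.Ψ t p) τ := fun t => by
    simp only
    rw [← F.add' _ _ hp, h]
  obtain ⟨y, hy, hye⟩ := hP.exists_mem_Ico₀ hτ t
  rw [hye]
  exact hml y ⟨hy.1, hy.2.le⟩

lemma per_of_eq {p : ℂ} (hp : p ∈ F.K) {a b : ℝ} (h : F.Ψ a p = F.Ψ b p) :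
    F.Ψ (b - a) p = p := by
  rw [sub_eq_neg_add, F.add _ _ _ hp, ← h, F.add' _ _ hp, neg_add_cancel, F.zero p hp]

lemma no_near (hnw : ∀ y ≥ F.T, F.D.Wind (F.w y) n) (hT : F.TubeAt n η ε)
    (hε : ε ≤ F.D.lev F.z0 / 2) {p : ℂ} (hp : p ∈ F.K) (hpγ : p ∉ range F.D.v) :
    ∃ t, η < F.D.lev (F.Ψ t p) := by
  by_contra hcon
  push Not at hcon
  have hfw : ∀ ζ > 0, ∃ x ≥ 0, F.D.lev (F.Ψ x p) < ζ := fun ζ hζ => by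
    obtain ⟨x, hx, h⟩ := half_inf hnw hT hε hp 1 (Or.inl rfl) 0 (fun x _ => hcon _) hζ
    exact ⟨x, hx, by rwa [one_mul] at h⟩
  have hbw : ∀ ζ > 0, ∃ x ≤ 0, F.D.lev (F.Ψ x p) < ζ := fun ζ hζ => by
    obtain ⟨x, hx, h⟩ := half_inf hnw hT hε hp (-1) (Or.inr rfl) 0 (fun x _ => hcon _) hζ
    exact ⟨-x, by linarith, by rwa [neg_one_mul] at h⟩
  have hnp : ∀ a b, a < b → F.Ψ a p ≠ F.Ψ b p := by
    intro a b hab h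
    obtain ⟨m, hm, hml⟩ := per_lev hp (sub_pos.2 hab) (per_of_eq hp h) hpγ
    obtain ⟨x, _, hx⟩ := hfw m hm
    linarith [hml x]
  obtain ⟨C, hC⟩ := F.D.triangle_bound n
  obtain ⟨m, hm, hml⟩ := lev_min hp hpγ 0 (max C 0 + 1)
  have hm0 := hml 0 ⟨le_rfl, by positivity⟩
  obtain ⟨x₁, hx₁, h₁⟩ := hfw (m / 2) (by positivity)
  obtain ⟨x₂, hx₂, h₂⟩ := hbw (m / 2) (by positivity)
  obtain ⟨b', hb', hl', hf'⟩ := first_hit (f := fun t => F.D.lev (F.Ψ t p)) hx₁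
    (F.lev_orb_cont hp).continuousOn (by linarith : m / 2 < _) h₁
  obtain ⟨b, hb, hl, hf⟩ := last_hit (f := fun t => F.D.lev (F.Ψ t p)) hx₂
    (F.lev_orb_cont hp).continuousOn h₂ (by linarith : m / 2 < _)
  obtain ⟨θ, hθ, -⟩ := hT p hp hpγ b b' (hb.2.trans hb'.1) (fun t _ => hcon t)
  have := hC _ θ b b' hθ (hb.2.trans hb'.1) (fun x _ y _ hxy => by
      rcases lt_trichotomy x y with h | h | h
      · exact absurd hxy (hnp x y h)
      · exact h
      · exact absurd hxy.symm (hnp y x h)) (fun t ht => by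
      rw [hl, hl', and_self]
      rcases le_total t 0 with h | h
      · exact hf t ⟨ht.1, h⟩
      · exact hf' t ⟨h, ht.2⟩)
  have hb'2 : max C 0 + 1 < b' := by
    by_contra h
    push Not at h
    have := hml b' ⟨hb'.1, h⟩
    linarith
  linarith [le_max_left C 0, hb.2]

end FS
end PBend

namespace PBend
namespace FS
variable {F : FS} {n : ℤ} {η ε : ℝ}

lemma approx (hη : 0 < η) (hη2 : η < F.D.lev F.z0 / 2) (N : ℕ) :
    (∃ z ∈ F.K, |F.D.lev z - η| ≤ 1 / ((N : ℝ) + 1) ∧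
      ∀ s ∈ Icc (0 : ℝ) N, F.D.lev (F.Ψ (1 * s) z) ≤ η + 1 / ((N : ℝ) + 1)) ∧
    (∃ z ∈ F.K, |F.D.lev z - η| ≤ 1 / ((N : ℝ) + 1) ∧
      ∀ s ∈ Icc (0 : ℝ) N, F.D.lev (F.Ψ (-1 * s) z) ≤ η + 1 / ((N : ℝ) + 1)) := by
  have hN0 : (0 : ℝ) ≤ N := Nat.cast_nonneg N
  obtain ⟨η', hη', htr⟩ := F.track N (half_pos hη)
  set ε := min (1 / ((N : ℝ) + 1)) (min (η / 4) (η' / 2)) with hε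
  have hε0 : 0 < ε := by positivity
  have e1 : ε ≤ 1 / ((N : ℝ) + 1) := min_le_left _ _
  have e2 : ε ≤ η / 4 := (min_le_right _ _).trans (min_le_left _ _)
  have e3 : ε ≤ η' / 2 := (min_le_right _ _).trans (min_le_right _ _)
  obtain ⟨S, hS⟩ := F.W2 ε N hε0
  obtain ⟨a, ha, hfar⟩ := F.exists_w_far (max S F.T)
  have haS : S ≤ a := (le_max_left _ _).trans ha
  have haT : F.T ≤ a := (le_max_right _ _).trans ha
  obtain ⟨t, ht, hnear⟩ := F.exists_w_near a (half_pos hη')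
  obtain ⟨c, hc, hfar'⟩ := F.exists_w_far t
  -- window near the closed orbit
  have hwin : ∀ s ∈ Icc (-(N : ℝ)) N, F.D.lev (F.w (t + s)) < η := by
    obtain ⟨z, hz, hzw⟩ := hS t (haS.trans ht)
    have h0 := hzw 0 ⟨by linarith, hN0⟩
    rw [add_zero, F.zero z hz] at h0
    have h1 := F.D.lev_sub_le z (F.w t)
    rw [norm_sub_rev] at h1
    obtain ⟨s₀, hs₀⟩ := htr z hz (by linarith)
    intro s hs
    have h2 := hs₀ s hs
    have h3 := F.D.lev_le (F.Ψ s z) (s₀ + s)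
    have h4 := hzw s hs
    have h5 := F.D.lev_sub_le (F.w (t + s)) (F.Ψ s z)
    linarith
  have hwl : ContinuousOn (fun t => F.D.lev (F.w t)) (Ici F.T) :=
    F.D.lev_cont.comp_continuousOn F.hw
  have ht0 : F.D.lev (F.w t) < η := by simpa using hwin 0 ⟨by linarith, hN0⟩
  have hfin : ∀ b ≥ a, F.D.lev (F.w b) = η → ∀ κ : ℝ, (κ = 1 ∨ κ = -1) →
      (∀ s ∈ Icc (0 : ℝ) N, F.D.lev (F.w (b + κ * s)) ≤ η) →
      ∃ z ∈ F.K, |F.D.lev z - η| ≤ 1 / ((N : ℝ) + 1) ∧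
      ∀ s ∈ Icc (0 : ℝ) N, F.D.lev (F.Ψ (κ * s) z) ≤ η + 1 / ((N : ℝ) + 1) := by
    intro b hb hbη κ hκ hle
    obtain ⟨z, hz, hzw⟩ := hS b (haS.trans hb)
    refine ⟨z, hz, ?_, fun s hs => ?_⟩
    · have h0 := hzw 0 ⟨by linarith, hN0⟩
      rw [add_zero, F.zero z hz] at h0
      have h1 := F.D.lev_sub_le z (F.w b)
      have h2 := F.D.lev_sub_le (F.w b) z
      rw [norm_sub_rev] at h1
      rw [abs_le]
      constructor <;> linarith
    · have h1 := hle s hs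
      have h2 := hzw (κ * s) (by
        rcases hκ with h | h <;> rw [h] <;> constructor <;> linarith [hs.1, hs.2])
      have h3 := F.D.lev_sub_le (F.Ψ (κ * s) z) (F.w (b + κ * s))
      rw [norm_sub_rev] at h3
      linarith
  constructor
  · obtain ⟨b, hb, hbη, hbl⟩ := last_hit' (f := fun t => F.D.lev (F.w t)) ht
      (hwl.mono (fun x hx => haT.trans hx.1)) (by linarith : η < _) ht0
    refine hfin b hb.1 hbη 1 (Or.inl rfl) (fun s hs => hbl _ ⟨by linarith [hs.1], ?_⟩)
    by_contra hcon
    have := hwin (b - t) ⟨by linarith [hs.2], by linarith [hb.2]⟩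
    rw [add_sub_cancel] at this
    linarith
  · obtain ⟨b, hb, hbη, hbl⟩ := first_hit' (f := fun t => F.D.lev (F.w t)) hc
      (hwl.mono (fun x hx => (haT.trans ht).trans hx.1)) ht0 (by linarith : η < _)
    refine hfin b (le_trans ht hb.1) hbη (-1) (Or.inr rfl)
      (fun s hs => hbl _ ⟨?_, by linarith [hs.1]⟩)
    by_contra hcon
    have := hwin (b - t) ⟨by linarith [hb.1], by linarith [hs.2]⟩
    rw [add_sub_cancel] at this
    linarith

lemma exists_half_of (κ : ℝ) (h : ∀ N : ℕ, ∃ z ∈ F.K, |F.D.lev z - η| ≤ 1 / ((N : ℝ) + 1) ∧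
      ∀ s ∈ Icc (0 : ℝ) N, F.D.lev (F.Ψ (κ * s) z) ≤ η + 1 / ((N : ℝ) + 1)) :
    ∃ p ∈ F.K, F.D.lev p = η ∧ ∀ t ≥ 0, F.D.lev (F.Ψ (κ * t) p) ≤ η := by
  choose z hz h1 h2 using h
  obtain ⟨p, hp, φ, hφ, hlim⟩ := F.lim_pt z hz
  have hsm : Tendsto (fun k : ℕ => (1 : ℝ) / ((φ k : ℕ) + 1)) atTop (𝓝 0) :=
    tendsto_one_div_add_atTop_nhds_zero_nat.comp hφ.tendsto_atTop
  refine ⟨p, hp, ?_, fun t ht => ?_⟩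
  · have h3 := hlim 0
    rw [F.zero p hp] at h3
    have h4 : Tendsto (fun k => F.D.lev (F.Ψ 0 (z (φ k)))) atTop (𝓝 η) := by
      rw [tendsto_iff_dist_tendsto_zero]
      refine squeeze_zero (fun _ => dist_nonneg) (fun k => ?_) hsm
      rw [F.zero _ (hz _), Real.dist_eq]
      exact h1 _
    exact tendsto_nhds_unique h3 h4
  · have h4 : Tendsto (fun k : ℕ => η + (1 : ℝ) / ((φ k : ℕ) + 1)) atTop (𝓝 η) := by
      simpa using hsm.const_add η
    refine le_of_tendsto_of_tendsto (hlim (κ * t)) h4 ?_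
    have h5 : Tendsto (fun k => ((φ k : ℕ) : ℝ)) atTop atTop :=
      tendsto_natCast_atTop_atTop.comp hφ.tendsto_atTop
    filter_upwards [h5.eventually_ge_atTop t] with k hk
    exact h2 (φ k) t ⟨ht, hk⟩

/-- the two half orbits with disjoint images -/
lemma exists_pair {η3 η1 : ℝ} (h13 : η1 ≤ η3) (h1 : 0 < η1)
    (hnn : ∀ p ∈ F.K, p ∉ range F.D.v → ∃ t, η3 < F.D.lev (F.Ψ t p))
    {p q : ℂ} (hp : p ∈ F.K) (hq : q ∈ F.K) (hpl : F.D.lev p = η1) (hql : F.D.lev q = η1)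
    (hpf : ∀ t ≥ 0, F.D.lev (F.Ψ (1 * t) p) ≤ η1)
    (hqb : ∀ t ≥ 0, F.D.lev (F.Ψ (-1 * t) q) ≤ η1) :
    ∃ P ∈ F.K, ∃ Q ∈ F.K, η3 < F.D.lev P ∧ η3 < F.D.lev Q ∧
      (∃ M, ∀ t ≥ M, F.D.lev (F.Ψ t P) ≤ η1) ∧ (∃ M, ∀ t ≤ M, F.D.lev (F.Ψ t Q) ≤ η1) ∧
      ∀ x y, x ≤ 0 → 0 ≤ y → F.Ψ y P ≠ F.Ψ x Q := by
  obtain ⟨a, ha⟩ := hnn p hp (notMem_of_lev (by linarith))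
  obtain ⟨c, hc⟩ := hnn q hq (notMem_of_lev (by linarith))
  set A := F.Ψ a p with hA
  set B := F.Ψ c q with hB
  have hAK : A ∈ F.K := F.maps _ _ hp
  have hBK : B ∈ F.K := F.maps _ _ hq
  have hAf : ∀ t ≥ -a, F.D.lev (F.Ψ t A) ≤ η1 := fun t ht => by
    rw [hA, F.add' _ _ hp]
    have := hpf (t + a) (by linarith)
    rwa [one_mul] at this
  have hBb : ∀ t ≤ -c, F.D.lev (F.Ψ t B) ≤ η1 := fun t ht => by
    rw [hB, F.add' _ _ hq]
    have := hqb (-(t + c)) (by linarith)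
    rwa [neg_one_mul, neg_neg] at this
  by_cases hsame : ∃ d, F.Ψ d B = A
  · obtain ⟨d, hd⟩ := hsame
    have hAb : ∀ t ≤ -c - d, F.D.lev (F.Ψ t A) ≤ η1 := fun t ht => by
      rw [← hd, F.add' _ _ hBK]
      exact hBb _ (by linarith)
    have hopen : ∀ᶠ t in 𝓝 (0 : ℝ), η3 < F.D.lev (F.Ψ t A) :=
      (F.lev_orb_cont hAK).continuousAt.eventually_const_lt (by show η3 < F.D.lev (F.Ψ 0 A); rw [F.zero A hAK]; exact ha)
    obtain ⟨κ, hκ, hball⟩ := Metric.eventually_nhds_iff.1 hopen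
    have k1 : η3 < F.D.lev (F.Ψ (κ / 2) A) := hball (by
      rw [Real.dist_eq, sub_zero, abs_of_pos (by positivity)]; linarith)
    have k2 : η3 < F.D.lev (F.Ψ (-(κ / 2)) A) := hball (by
      rw [Real.dist_eq, sub_zero, abs_neg, abs_of_pos (by positivity)]; linarith)
    refine ⟨_, F.maps (κ / 2) A hAK, _, F.maps (-(κ / 2)) A hAK, k1, k2,
      ⟨-a, fun t ht => ?_⟩, ⟨-c - d, fun t ht => ?_⟩, fun x y hx hy h => ?_⟩
    · rw [F.add' _ _ hAK]; exact hAf _ (by linarith)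
    · rw [F.add' _ _ hAK]; exact hAb _ (by linarith)
    · rw [F.add' _ _ hAK, F.add' _ _ hAK] at h
      have hper := per_of_eq hAK h.symm
      set τ := y + κ / 2 - (x + -(κ / 2)) with hτ
      have hτ0 : 0 < τ := by linarith
      obtain ⟨k, hk⟩ := exists_nat_ge (-a / τ)
      rw [div_le_iff₀ hτ0] at hk
      have h5 := per_iter hAK hper k 0
      rw [zero_add, F.zero A hAK] at h5
      have h6 := hAf (((k : ℤ) : ℝ) * τ) (by exact_mod_cast hk)
      rw [h5] at h6
      linarith
  · push Not at hsame
    refine ⟨A, hAK, B, hBK, ha, hc, ⟨-a, hAf⟩, ⟨-c, hBb⟩, fun x y hx hy h => ?_⟩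
    apply hsame (-y + x)
    rw [F.add _ _ _ hBK, ← h, F.add' _ _ hAK, neg_add_cancel, F.zero A hAK]

theorem contradiction (F : FS) : False := by
  have hσ := F.D.hσ
  have hz0 := F.lev_z0
  obtain ⟨n, hnw, hnK⟩ := F.exists_n
  obtain ⟨η3, hη3, hT3⟩ := F.tube hnK (half_pos hz0)
  obtain ⟨η0, hη0, hT0⟩ := F.tube hnK (show 0 < min η3 (F.D.lev F.z0 / 2) by positivity)
  set η1 := min η0 (min η3 (F.D.lev F.z0 / 4)) with hη1
  have hη1p : 0 < η1 := by positivity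
  have hη13 : η1 ≤ η3 := (min_le_right _ _).trans (min_le_left _ _)
  have hη14 : η1 < F.D.lev F.z0 / 2 := by
    have : η1 ≤ F.D.lev F.z0 / 4 := (min_le_right _ _).trans (min_le_right _ _)
    linarith
  have hT1 : F.TubeAt n η1 (min η3 (F.D.lev F.z0 / 2)) := TubeAt.mono hT0 (min_le_left _ _)
  obtain ⟨p, hp, hpl, hpf⟩ := exists_half_of 1 (fun N => (approx hη1p hη14 N).1)
  obtain ⟨q, hq, hql, hqb⟩ := exists_half_of (-1) (fun N => (approx hη1p hη14 N).2)
  obtain ⟨P, hP, Q, hQ, hPl, hQl, ⟨M₁, hM₁⟩, ⟨M₂, hM₂⟩, hne⟩ := exists_pair hη13 hη1p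
    (fun p hp hpγ => no_near hnw hT3 le_rfl hp hpγ) hp hq hpl hql hpf hqb
  have hPγ : P ∉ range F.D.v := notMem_of_lev (by linarith)
  have hQγ : Q ∉ range F.D.v := notMem_of_lev (by linarith)
  set M := max 0 (max M₁ (-M₂)) with hM
  have hM0 : 0 ≤ M := le_max_left _ _
  have hMP : ∀ t ≥ M, F.D.lev (F.Ψ t P) ≤ η1 := fun t ht =>
    hM₁ t (((le_max_left _ _).trans (le_max_right _ _)).trans ht)
  have hMQ : ∀ t ≤ -M, F.D.lev (F.Ψ t Q) ≤ η1 := fun t ht => hM₂ t (by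
    have : -M₂ ≤ M := (le_max_right _ _).trans (le_max_right _ _)
    linarith)
  obtain ⟨mp, hmp, hlp⟩ := lev_min hP hPγ 0 (M + 2 * F.D.σ)
  obtain ⟨mq, hmq, hlq⟩ := lev_min hQ hQγ (-M - 2 * F.D.σ) 0
  obtain ⟨C, hC⟩ := F.D.rect_bound n (fun t => F.Ψ t P) (fun t => F.Ψ t Q) (F.orb_cont hP)
    (F.orb_cont hQ) M hM0 (by rw [F.zero P hP]; exact hnK P hP hPγ)
    (by rw [F.zero Q hQ]; exact hnK Q hQ hQγ) hne mp mq hmp hmq hlp hlq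
  set L := max C (M + 4 * F.D.σ) with hL
  have hL0 : 0 ≤ L := le_trans (by positivity) (le_max_right _ _)
  obtain ⟨m1, hm1, hl1⟩ := lev_min hP hPγ 0 (L + 1)
  obtain ⟨m2, hm2, hl2⟩ := lev_min hQ hQγ (-L - 1) 0
  set ζ := min (min (mp / 2) (mq / 2)) (min (m1 / 2) (m2 / 2)) with hζ
  have hζ0 : 0 < ζ := by positivity
  have z1 : ζ ≤ mp / 2 := (min_le_left _ _).trans (min_le_left _ _)
  have z2 : ζ ≤ mq / 2 := (min_le_left _ _).trans (min_le_right _ _)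
  have z3 : ζ ≤ m1 / 2 := (min_le_right _ _).trans (min_le_left _ _)
  have z4 : ζ ≤ m2 / 2 := (min_le_right _ _).trans (min_le_right _ _)
  obtain ⟨x₁, hx₁, h₁⟩ := half_inf hnw hT1 (min_le_right _ _) hP 1 (Or.inl rfl) M
    (fun x hx => by rw [one_mul]; exact hMP x hx) hζ0
  rw [one_mul] at h₁
  obtain ⟨x₂, hx₂, h₂⟩ := half_inf hnw hT1 (min_le_right _ _) hQ (-1) (Or.inr rfl) M
    (fun x hx => by rw [neg_one_mul]; exact hMQ _ (by linarith)) hζ0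
  rw [neg_one_mul] at h₂
  obtain ⟨b', hb', hb'l, hb'f⟩ := first_hit (f := fun t => F.D.lev (F.Ψ t P))
    (hM0.trans hx₁) (F.lev_orb_cont hP).continuousOn
    (by linarith [hl1 0 ⟨le_rfl, by linarith⟩] : ζ < _) h₁
  obtain ⟨b, hb, hbl, hbf⟩ := last_hit (f := fun t => F.D.lev (F.Ψ t Q)) (a := -x₂) (c := 0)
    (by linarith) (F.lev_orb_cont hQ).continuousOn h₂
    (by linarith [hl2 0 ⟨by linarith, le_rfl⟩] : ζ < _)
  have hb'L : L + 1 < b' := by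
    by_contra h
    linarith [hl1 b' ⟨hb'.1, not_lt.1 h⟩]
  have hbL : b < -L - 1 := by
    by_contra h
    linarith [hl2 b ⟨not_lt.1 h, hb.2⟩]
  have hLM : M + 4 * F.D.σ ≤ L := le_max_right _ _
  obtain ⟨θp, hTp, hcp⟩ := hT1 P hP hPγ M b' (by linarith) (fun t ht => hMP t ht.1)
  obtain ⟨θq, hTq, hcq⟩ := hT1 Q hQ hQγ b (-M) (by linarith) (fun t ht => hMQ t ht.2)
  have := hC b b' θp θq hTp hTq (by linarith) (by linarith) (hb'l.le.trans z2) (hbl.le.trans z1)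
    (fun y hy => hbl.le.trans (hb'f y hy)) (fun x hx => hb'l.le.trans (hbf x hx))
    (fun y hy => by
      rw [F.zero Q hQ]
      exact (hcp y hy).le.trans ((min_le_left _ _).trans (hQl.le.trans (F.D.lev_le _ _))))
    (fun x hx => by
      rw [F.zero P hP]
      exact (hcq x hx).le.trans ((min_le_left _ _).trans (hPl.le.trans (F.D.lev_le _ _))))
  linarith [le_max_left C (M + 4 * F.D.σ)]

end FS
end PBend

namespace PBend

lemma minimal_period (v : ℝ → ℂ) (hv : Continuous v) (S : AddSubgroup ℝ)
    (hS : ∀ s, s ∈ S ↔ ∀ t, v (t + s) = v t) (σ0 : ℝ) (hσ0 : 0 < σ0) (hσS : σ0 ∈ S)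
    (hns : ∃ t, v t ≠ v 0) : ∃ σ > 0, ∀ s, s ∈ S ↔ ∃ k : ℤ, s = k * σ := by
  rcases AddSubgroup.dense_or_cyclic S with hd | ⟨a, ha⟩
  · exfalso
    obtain ⟨t, ht⟩ := hns
    apply ht
    have : v = fun _ => v 0 := by
      refine hv.ext_on hd continuous_const ?_
      intro s hs
      have := (hS s).1 hs 0
      rwa [zero_add] at this
    exact congrFun this t
  · have hmem : ∀ s, s ∈ S ↔ ∃ k : ℤ, s = k * a := by
      intro s
      rw [ha, AddSubgroup.mem_closure_singleton]
      constructor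
      · rintro ⟨k, hk⟩; exact ⟨k, by rw [← hk, zsmul_eq_mul]⟩
      · rintro ⟨k, hk⟩; exact ⟨k, by rw [hk, zsmul_eq_mul]⟩
    have ha0 : a ≠ 0 := by
      rintro rfl
      obtain ⟨k, hk⟩ := (hmem σ0).1 hσS
      rw [mul_zero] at hk
      linarith
    refine ⟨|a|, abs_pos.2 ha0, fun s => ?_⟩
    rw [hmem]
    rcases abs_choice a with h | h <;> rw [h]
    constructor
    · rintro ⟨k, hk⟩; exact ⟨-k, by rw [hk]; push_cast; ring⟩
    · rintro ⟨k, hk⟩; exact ⟨-k, by rw [hk]; push_cast; ring⟩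

theorem planar_final (K : Set ℂ) (hK : IsCompact K) (Ψ : ℝ → ℂ → ℂ)
    (maps : ∀ t, ∀ z ∈ K, Ψ t z ∈ K) (zero : ∀ z ∈ K, Ψ 0 z = z)
    (hadd : ∀ s t, ∀ z ∈ K, Ψ (s + t) z = Ψ s (Ψ t z))
    (cont : ContinuousOn (fun x : ℝ × ℂ => Ψ x.1 x.2) (univ ×ˢ K))
    (w : ℝ → ℂ) (T : ℝ) (hw : ContinuousOn w (Ici T))
    (W1 : ∀ z ∈ K, ∀ S ε : ℝ, 0 < ε → ∃ t ≥ S, ‖w t - z‖ < ε)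
    (W2 : ∀ ε N : ℝ, 0 < ε → ∃ S, ∀ t ≥ S, ∃ z ∈ K, ∀ s ∈ Icc (-N) N, ‖w (t + s) - Ψ s z‖ < ε)
    (J : ∀ y ≥ T, w y ∈ K → ∀ t ≥ 0, w (y + t) = Ψ t (w y))
    (v0 : ℂ) (hv0 : v0 ∈ K) (σ0 : ℝ) (hσ0 : 0 < σ0) (hper : Ψ σ0 v0 = v0)
    (hns : ∃ t, Ψ t v0 ≠ v0) : ∀ z ∈ K, ∃ s, Ψ s v0 = z := by
  intro z0 hz0
  by_contra hz
  have hvc : Continuous fun s => Ψ s v0 := by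
    have : Continuous fun s : ℝ => ((s, v0) : ℝ × ℂ) := by fun_prop
    exact cont.comp_continuous this fun s => ⟨mem_univ _, hv0⟩
  have key : ∀ a b, Ψ a v0 = Ψ b v0 → Ψ (a - b) v0 = v0 := by
    intro a b h
    have := hadd (-b) a v0 hv0
    rw [h, ← hadd (-b) b v0 hv0, neg_add_cancel, zero v0 hv0] at this
    rw [← this]; congr 1; ring
  have key2 : ∀ s, Ψ s v0 = v0 → ∀ t, Ψ (t + s) v0 = Ψ t v0 := by
    intro s h t; rw [hadd t s v0 hv0, h]
  let S : AddSubgroup ℝ :=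
    { carrier := {s | ∀ t, Ψ (t + s) v0 = Ψ t v0}
      add_mem' := by
        intro a b ha hb t
        rw [← add_assoc, hb, ha]
      zero_mem' := by intro t; rw [add_zero]
      neg_mem' := by
        intro a ha t
        have := ha (t + -a)
        rw [← this]; congr 1; ring }
  obtain ⟨σ, hσ, hSσ⟩ := minimal_period (fun s => Ψ s v0) hvc S (fun s => Iff.rfl) σ0 hσ0
    (key2 _ hper) (by
      obtain ⟨t, ht⟩ := hns
      refine ⟨t, ?_⟩
      show Ψ t v0 ≠ Ψ 0 v0
      rw [zero v0 hv0]; exact ht)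
  have hinj : ∀ a b, Ψ a v0 = Ψ b v0 → ∃ k : ℤ, a - b = k * σ := fun a b h =>
    (hSσ _).1 (key2 _ (key a b h))
  have hperσ : ∀ s, Ψ (s + σ) v0 = Ψ s v0 := (hSσ σ).2 ⟨1, by simp⟩
  obtain ⟨D, hDv, hDσ⟩ := exists_PD (fun s => Ψ s v0) hvc σ hσ hperσ hinj
  have hDv' : ∀ s, D.v s = Ψ s v0 := fun s => congrFun hDv s
  exact FS.contradiction
    { D := D
      hinj := by intro a b h; rw [hDv', hDv'] at h; rw [hDσ]; exact hinj a b h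
      K := K, hK := hK, Ψ := Ψ, maps := maps, zero := zero, add := hadd, cont := cont
      hvK := by intro s; rw [hDv']; exact maps s v0 hv0
      hvΨ := by intro s t; rw [hDv', hDv', add_comm, hadd t s v0 hv0]
      w := w, T := T, hw := hw, W1 := W1, W2 := W2, J := J
      z0 := z0, hz0 := hz0
      hz0γ := by
        rintro ⟨s, hs⟩
        exact hz ⟨s, by rw [← hDv']; exact hs⟩ }

end PBend

namespace PBend
section omega
variable {E : Type*} [NormedAddCommGroup E] [NormedSpace ℝ E]

lemma exists_planar_proj (Eplus Eminus : Submodule ℝ E) (hcl : IsClosed (Eplus : Set E))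
    (hc : IsCompl Eplus Eminus) [FiniteDimensional ℝ ↥Eminus]
    (h2 : Module.finrank ℝ ↥Eminus = 2) :
    ∃ pr : E →L[ℝ] ℂ, ∀ u, pr u = 0 → u ∈ Eplus := by
  haveI : IsClosed (Eplus : Set E) := hcl
  let e := Submodule.quotientEquivOfIsCompl Eplus Eminus hc
  haveI : FiniteDimensional ℝ (E ⧸ Eplus) := e.symm.finiteDimensional
  have hf : Module.finrank ℝ (E ⧸ Eplus) = Module.finrank ℝ ℂ := by
    rw [e.finrank_eq, h2, Complex.finrank_real_complex]
  let c : (E ⧸ Eplus) ≃L[ℝ] ℂ := ContinuousLinearEquiv.ofFinrankEq hf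
  refine ⟨(c : (E ⧸ Eplus) →L[ℝ] ℂ).comp (Submodule.mkQL Eplus), fun u hu => ?_⟩
  have h1 : c (Submodule.Quotient.mk u) = 0 := hu
  rw [ContinuousLinearEquiv.map_eq_zero_iff] at h1
  exact (Submodule.Quotient.mk_eq_zero Eplus).1 h1

lemma inv_contOn {X Y : Type*} [TopologicalSpace X] [TopologicalSpace Y] [T2Space Y]
    {K : Set X} (hK : IsCompact K) {f : X → Y} (hf : ContinuousOn f K) {g : Y → X}
    (hg : ∀ x ∈ K, g (f x) = x) : ContinuousOn g (f '' K) := by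
  rw [continuousOn_iff_isClosed]
  intro t ht
  refine ⟨f '' (K ∩ t), ((hK.inter_right ht).image_of_continuousOn
    (hf.mono inter_subset_left)).isClosed, ?_⟩
  ext y
  constructor
  · rintro ⟨hy, x, hx, rfl⟩
    refine ⟨⟨x, ⟨hx, ?_⟩, rfl⟩, ⟨x, hx, rfl⟩⟩
    have : g (f x) ∈ t := hy
    rwa [hg x hx] at this
  · rintro ⟨⟨x, ⟨hx, hxt⟩, rfl⟩, h2⟩
    refine ⟨?_, h2⟩
    show g (f x) ∈ t
    rwa [hg x hx]

variable (φ : Semiflow E)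

lemma flow_cont_time (p : E) : ContinuousOn (fun t => φ.toFun t p) (Ici 0) := by
  have := φ.continuousOn'
  exact this.comp (f := fun t : ℝ => (t, p)) (by fun_prop) (fun t ht => ⟨ht, mem_univ _⟩)

lemma flow_cont_space {t : ℝ} (ht : 0 ≤ t) : Continuous (φ.toFun t) := by
  have := φ.continuousOn'
  exact this.comp_continuous (f := fun p : E => (t, p)) (by fun_prop)
    (fun p => ⟨ht, mem_univ _⟩)

lemma flow_unif {Q : Set E} (hQ : IsCompact Q) (N : ℝ) {ε : ℝ} (hε : 0 < ε) :
    ∃ η > 0, ∀ p ∈ Q, ∀ q ∈ Q, ‖p - q‖ < η → ∀ a ∈ Icc 0 N,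
      ‖φ.toFun a p - φ.toFun a q‖ < ε := by
  have hc : IsCompact (Icc 0 N ×ˢ Q) := isCompact_Icc.prod hQ
  have := hc.uniformContinuousOn_of_continuous
    (φ.continuousOn'.mono (prod_mono (fun x hx => hx.1) (subset_univ _)))
  obtain ⟨η, hη, h⟩ := Metric.uniformContinuousOn_iff.1 this ε hε
  refine ⟨η, hη, fun p hp q hq hpq a ha => ?_⟩
  have := h (a, p) ⟨ha, hp⟩ (a, q) ⟨ha, hq⟩ (by
    rw [Prod.dist_eq]; simp only [dist_self]
    rw [dist_eq_norm]; exact max_lt hη hpq)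
  rwa [dist_eq_norm] at this

lemma mem_omega_iff (w p : E) : p ∈ φ.omegaLimit w ↔
    ∀ S ε : ℝ, 0 < ε → ∃ t ≥ S, 0 ≤ t ∧ ‖φ.toFun t w - p‖ < ε := by
  unfold Semiflow.omegaLimit
  simp only [mem_iInter, Metric.mem_closure_iff]
  constructor
  · intro h S ε hε
    obtain ⟨b, ⟨t, ht, rfl⟩, hb⟩ := h (max S 0) (mem_Ici.2 (le_max_right _ _)) ε hε
    refine ⟨t, (le_max_left _ _).trans ht, (le_max_right _ _).trans ht, ?_⟩
    rwa [dist_comm, dist_eq_norm] at hb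
  · intro h s hs ε hε
    obtain ⟨t, ht, h0, hb⟩ := h s ε hε
    refine ⟨_, ⟨t, ht, rfl⟩, ?_⟩
    rwa [dist_comm, dist_eq_norm]

lemma omega_closed (w : E) : IsClosed (φ.omegaLimit w) := by
  unfold Semiflow.omegaLimit
  exact isClosed_biInter fun _ _ => isClosed_closure

lemma omega_maps (w : E) {t : ℝ} (ht : 0 ≤ t) {p : E} (hp : p ∈ φ.omegaLimit w) :
    φ.toFun t p ∈ φ.omegaLimit w := by
  rw [mem_omega_iff] at hp ⊢
  intro S ε hε
  obtain ⟨η, hη, h⟩ := Metric.continuous_iff.1 (flow_cont_space φ ht) p ε hε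
  obtain ⟨s, hs, hs0, hd⟩ := hp S η hη
  refine ⟨t + s, by linarith, by linarith, ?_⟩
  rw [φ.map_add' t s ht hs0, ← dist_eq_norm]
  exact h _ (by rwa [dist_eq_norm])

variable {φ} {w : E} {Q : Set E} {τ : ℝ}

lemma omega_sub (hQ : IsCompact Q) (hQw : ∀ t ≥ τ, φ.toFun t w ∈ Q) : φ.omegaLimit w ⊆ Q := by
  intro p hp
  rw [mem_omega_iff] at hp
  rw [← hQ.isClosed.closure_eq, Metric.mem_closure_iff]
  intro ε hε
  obtain ⟨t, ht, -, h⟩ := hp τ ε hε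
  exact ⟨_, hQw t ht, by rwa [dist_comm, dist_eq_norm]⟩

lemma omega_attr (hQ : IsCompact Q) (hQw : ∀ t ≥ τ, φ.toFun t w ∈ Q) {ε : ℝ} (hε : 0 < ε) :
    ∃ S, ∀ t ≥ S, ∃ z ∈ φ.omegaLimit w, ‖φ.toFun t w - z‖ < ε := by
  by_contra hcon
  push Not at hcon
  choose u hu hfar using fun n : ℕ => hcon (max (n : ℝ) (max τ 0))
  obtain ⟨p, hp, k, hk, hlim⟩ := hQ.tendsto_subseq (x := fun n => φ.toFun (u n) w)
    (fun n => hQw _ (((le_max_left _ _).trans (le_max_right _ _)).trans (hu n)))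
  have hpK : p ∈ φ.omegaLimit w := by
    rw [mem_omega_iff]
    intro S η hη
    have e1 := (Metric.tendsto_atTop.1 hlim) η hη
    obtain ⟨n1, hn1⟩ := e1
    obtain ⟨n2, hn2⟩ := exists_nat_ge S
    set n := max n1 n2
    have a1 : n ≤ k n := hk.id_le n
    have a2 : (n2 : ℝ) ≤ k n := by exact_mod_cast (le_max_right n1 n2).trans a1
    refine ⟨u (k n), ?_, ((le_max_right _ _).trans (le_max_right _ _)).trans (hu _), ?_⟩
    · have := (le_max_left _ _).trans (hu (k n)); linarith
    · have := hn1 n (le_max_left _ _)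
      rwa [dist_eq_norm] at this
  obtain ⟨n, hn⟩ := (Metric.tendsto_atTop.1 hlim) ε hε
  have := hn n le_rfl
  rw [dist_eq_norm] at this
  exact absurd this (not_lt.2 (hfar (k n) p hpK))

lemma omega_surj (hQ : IsCompact Q) (hQw : ∀ t ≥ τ, φ.toFun t w ∈ Q) {t : ℝ} (ht : 0 ≤ t)
    {p : E} (hp : p ∈ φ.omegaLimit w) : ∃ q ∈ φ.omegaLimit w, φ.toFun t q = p := by
  have hKc : IsCompact (φ.omegaLimit w) :=
    hQ.of_isClosed_subset (omega_closed φ w) (omega_sub hQ hQw)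
  have himg : IsClosed (φ.toFun t '' φ.omegaLimit w) :=
    (hKc.image (flow_cont_space φ ht)).isClosed
  have : p ∈ φ.toFun t '' φ.omegaLimit w := by
    rw [← himg.closure_eq, Metric.mem_closure_iff]
    intro ε hε
    obtain ⟨η, hη, hu⟩ := flow_unif φ hQ t (half_pos hε)
    obtain ⟨S, hS⟩ := omega_attr hQ hQw hη
    obtain ⟨s, hs, hs0, hd⟩ := (mem_omega_iff φ w p).1 hp (max S (max τ 0) + t) (ε / 2) (half_pos hε)
    have b1 := le_max_left S (max τ 0)
    have b2 := le_max_right S (max τ 0)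
    have b3 := le_max_left τ 0
    have b4 := le_max_right τ 0
    obtain ⟨z, hz, hzd⟩ := hS (s - t) (by linarith)
    refine ⟨_, ⟨z, hz, rfl⟩, ?_⟩
    have := hu _ (hQw (s - t) (by linarith)) z (omega_sub hQ hQw hz) hzd t ⟨ht, le_rfl⟩
    rw [← φ.map_add' t (s - t) ht (by linarith), show t + (s - t) = s by ring] at this
    rw [dist_eq_norm]
    calc ‖p - φ.toFun t z‖ = ‖(φ.toFun s w - φ.toFun t z) - (φ.toFun s w - p)‖ := by congr 1; abel
      _ ≤ _ := norm_sub_le _ _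
      _ < ε := by linarith
  obtain ⟨q, hq, h⟩ := this
  exact ⟨q, hq, h⟩

end omega
end PBend

namespace PBend
section squeeze
variable {E : Type*} [NormedAddCommGroup E] [NormedSpace ℝ E]
variable {H : Type*} [NormedAddCommGroup H] [InnerProductSpace ℝ H]
variable {ι : E →L[ℝ] H} {φ : Semiflow E} {P : E →L[ℝ] E →L[ℝ] ℝ} {δ τV ν : ℝ}

lemma integrand_cont (p q : E) : ContinuousOn (fun s => Real.exp (2 * ν * s) *
    ‖ι (φ.toFun s p) - ι (φ.toFun s q)‖ ^ 2) (Ici 0) := by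
  have h1 := flow_cont_time φ p
  have h2 := flow_cont_time φ q
  have h3 : ContinuousOn (fun s => ι (φ.toFun s p)) (Ici 0) := ι.continuous.comp_continuousOn h1
  have h4 : ContinuousOn (fun s => ι (φ.toFun s q)) (Ici 0) := ι.continuous.comp_continuousOn h2
  have h5 : ContinuousOn (fun s : ℝ => Real.exp (2 * ν * s)) (Ici 0) := by fun_prop
  exact h5.mul ((h3.sub h4).norm.pow 2)

lemma integrand_nonneg (p q : E) {l r : ℝ} (hlr : l ≤ r) :
    0 ≤ ∫ s in l..r, Real.exp (2 * ν * s) * ‖ι (φ.toFun s p) - ι (φ.toFun s q)‖ ^ 2 :=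
  intervalIntegral.integral_nonneg hlr fun s _ => by positivity

lemma V_cont : Continuous fun u : E => P u u := by
  fun_prop

/-- the sign of `V` is preserved after the delay -/
lemma V_neg_persist (h3 : φ.IsH3 ι P δ τV ν) (p q : E) {l r : ℝ} (hl : 0 ≤ l) (hr : l + τV ≤ r)
    (hneg : P (φ.toFun l p - φ.toFun l q) (φ.toFun l p - φ.toFun l q) < 0) :
    P (φ.toFun r p - φ.toFun r q) (φ.toFun r p - φ.toFun r q) < 0 := by
  obtain ⟨hδ, hτ, hν, h⟩ := h3
  have := h p q l r hl (by linarith) (by linarith)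
  have i := integrand_nonneg (ι := ι) (φ := φ) (ν := ν) p q (show l ≤ r by linarith)
  have e1 : Real.exp (2 * ν * l) * P (φ.toFun l p - φ.toFun l q) (φ.toFun l p - φ.toFun l q) < 0 :=
    mul_neg_of_pos_of_neg (Real.exp_pos _) hneg
  have e2 : Real.exp (2 * ν * r) * P (φ.toFun r p - φ.toFun r q) (φ.toFun r p - φ.toFun r q) < 0 := by
    nlinarith [mul_nonneg hδ.le i]
  by_contra hc
  push Not at hc
  exact absurd e2 (not_lt.2 (mul_nonneg (Real.exp_pos _).le hc))

variable {K : Set E}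

lemma K_nonpos (h3 : φ.IsH3 ι P δ τV ν) (hK : IsCompact K)
    (hsurj : ∀ t, 0 ≤ t → ∀ p ∈ K, ∃ q ∈ K, φ.toFun t q = p) {p q : E} (hp : p ∈ K) (hq : q ∈ K) :
    P (p - q) (p - q) ≤ 0 := by
  obtain ⟨hδ, hτ, hν, h⟩ := h3
  obtain ⟨C, hC⟩ : ∃ C, ∀ a ∈ K, ∀ b ∈ K, P (a - b) (a - b) ≤ C := by
    have hc : ContinuousOn (fun x : E × E => P (x.1 - x.2) (x.1 - x.2)) (K ×ˢ K) := by fun_prop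
    obtain ⟨C, hC⟩ := (hK.prod hK).bddAbove_image hc
    exact ⟨C, fun a ha b hb => hC ⟨(a, b), ⟨ha, hb⟩, rfl⟩⟩
  by_contra hcon
  push Not at hcon
  set V := P (p - q) (p - q)
  have hb : ∀ m : ℝ, 0 ≤ m → τV ≤ m → Real.exp (2 * ν * m) * V ≤ C := by
    intro m hm hm2
    obtain ⟨p', hp', e1⟩ := hsurj m hm p hp
    obtain ⟨q', hq', e2⟩ := hsurj m hm q hq
    have := h p' q' 0 m le_rfl hm (by linarith)
    have i := integrand_nonneg (ι := ι) (φ := φ) (ν := ν) p' q' hm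
    rw [e1, e2, φ.map_zero', φ.map_zero', mul_zero, Real.exp_zero, one_mul] at this
    have := hC p' hp' q' hq'
    nlinarith [mul_nonneg hδ.le i]
  have ht : Tendsto (fun m : ℝ => Real.exp (2 * ν * m) * V) atTop atTop :=
    (Real.tendsto_exp_atTop.comp (tendsto_id.const_mul_atTop (by positivity))).atTop_mul_const hcon
  obtain ⟨m, hm1, hm2⟩ := ((ht.eventually_gt_atTop C).and
    (eventually_ge_atTop (max 0 τV))).exists
  have := hb m ((le_max_left _ _).trans hm2) ((le_max_right _ _).trans hm2)
  linarith

lemma K_neg (hι : Function.Injective ι) (h3 : φ.IsH3 ι P δ τV ν) (hK : IsCompact K)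
    (hsurj : ∀ t, 0 ≤ t → ∀ p ∈ K, ∃ q ∈ K, φ.toFun t q = p) {p q : E} (hp : p ∈ K) (hq : q ∈ K)
    (hne : p ≠ q) : P (p - q) (p - q) < 0 := by
  have hh3 := h3
  obtain ⟨hδ, hτ, hν, h⟩ := h3
  set m := max 1 τV with hm
  have hm1 : 1 ≤ m := le_max_left _ _
  have hm2 : τV ≤ m := le_max_right _ _
  obtain ⟨p', hp', e1⟩ := hsurj m (by linarith) p hp
  obtain ⟨q', hq', e2⟩ := hsurj m (by linarith) q hq
  have h0 := h p' q' 0 m le_rfl (by linarith) (by linarith)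
  have hle := K_nonpos hh3 hK hsurj hp' hq'
  rw [e1, e2, φ.map_zero', φ.map_zero', mul_zero, Real.exp_zero, one_mul] at h0
  have i : 0 < ∫ s in (0:ℝ)..m, Real.exp (2 * ν * s) *
      ‖ι (φ.toFun s p') - ι (φ.toFun s q')‖ ^ 2 := by
    refine intervalIntegral.integral_pos (by linarith)
      ((integrand_cont p' q').mono fun x hx => hx.1) (fun s _ => by positivity)
      ⟨m, ⟨by linarith, le_rfl⟩, ?_⟩
    rw [e1, e2]
    have : ι p - ι q ≠ 0 := sub_ne_zero.2 (fun h => hne (hι h))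
    positivity
  by_contra hc
  push Not at hc
  have := mul_pos hδ i
  have := mul_nonneg (Real.exp_pos (2 * ν * m)).le hc
  linarith

lemma K_inj (hι : Function.Injective ι) (h3 : φ.IsH3 ι P δ τV ν) (hK : IsCompact K)
    (hsurj : ∀ t, 0 ≤ t → ∀ p ∈ K, ∃ q ∈ K, φ.toFun t q = p) {p q : E} (hp : p ∈ K) (hq : q ∈ K)
    {t : ℝ} (ht : 0 ≤ t) (heq : φ.toFun t p = φ.toFun t q) : p = q := by
  by_contra hne
  have hneg := K_neg hι h3 hK hsurj hp hq hne
  have hτ := h3.2.1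
  have := V_neg_persist h3 p q (l := 0) (r := τV + t) le_rfl (by linarith)
    (by rwa [φ.map_zero', φ.map_zero'])
  rw [φ.map_add' _ _ hτ ht, φ.map_add' _ _ hτ ht, heq, sub_self] at this
  simp at this

/-- asymptotic tracking -/
lemma track_lim (h3 : φ.IsH3 ι P δ τV ν) (hS : φ.IsSmoothing ι) {Q : Set E} (hQ : IsCompact Q)
    {p q : E} {τ : ℝ} (hp : ∀ t ≥ τ, φ.toFun t p ∈ Q) (hq : ∀ t ≥ τ, φ.toFun t q ∈ Q)
    (hpos : ∀ t ≥ 0, 0 ≤ P (φ.toFun t p - φ.toFun t q) (φ.toFun t p - φ.toFun t q))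
    {ε : ℝ} (hε : 0 < ε) : ∃ S, ∀ t ≥ S, ‖φ.toFun t p - φ.toFun t q‖ < ε := by
  obtain ⟨hδ, hτ, hν, h⟩ := h3
  obtain ⟨τS, C, hτS, hC, hsm⟩ := hS
  obtain ⟨η, hη, hu⟩ := flow_unif φ hQ 1 hε
  set A := P (p - q) (p - q) / δ with hA
  have hintg : ∀ r, 0 ≤ r → τV ≤ r → ∫ s in (0:ℝ)..r, Real.exp (2 * ν * s) *
      ‖ι (φ.toFun s p) - ι (φ.toFun s q)‖ ^ 2 ≤ A := by
    intro r hr hr2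
    have := h p q 0 r le_rfl hr (by linarith)
    rw [φ.map_zero', φ.map_zero', mul_zero, Real.exp_zero, one_mul] at this
    have i := mul_nonneg (Real.exp_pos (2 * ν * r)).le (hpos r hr)
    rw [hA, le_div_iff₀ hδ]
    linarith
  have ht : Tendsto (fun m : ℝ => Real.exp (2 * ν * m) * (η / C) ^ 2) atTop atTop :=
    (Real.tendsto_exp_atTop.comp (tendsto_id.const_mul_atTop (by positivity))).atTop_mul_const
      (by positivity)
  obtain ⟨S0, hS0⟩ := eventually_atTop.1 (ht.eventually_gt_atTop A)
  refine ⟨max S0 (max τ (max τV 0)) + 1 + τS, fun t ht => ?_⟩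
  have b1 := le_max_left S0 (max τ (max τV 0))
  have b2 := le_max_right S0 (max τ (max τV 0))
  have b3 := le_max_left τ (max τV 0)
  have b4 := le_max_right τ (max τV 0)
  have b5 := le_max_left τV 0
  have b6 := le_max_right τV 0
  set a := t - 1 - τS with ha
  have ha0 : 0 ≤ a := by linarith
  have hex : ∃ s ∈ Icc a (a + 1), ‖ι (φ.toFun s p) - ι (φ.toFun s q)‖ < η / C := by
    by_contra hcon
    push Not at hcon
    have hi : ∀ x y, 0 ≤ x → 0 ≤ y → IntervalIntegrable (fun s => Real.exp (2 * ν * s) *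
      ‖ι (φ.toFun s p) - ι (φ.toFun s q)‖ ^ 2) volume x y := fun x y hx hy =>
      ((integrand_cont p q).mono (fun z hz => by
        have := hz.1; exact (le_min hx hy).trans this)).intervalIntegrable
    have k1 := hintg (a + 1) (by linarith) (by linarith)
    rw [← intervalIntegral.integral_add_adjacent_intervals (hi 0 a le_rfl ha0)
      (hi a (a + 1) ha0 (by linarith))] at k1
    have k2 := integrand_nonneg (ι := ι) (φ := φ) (ν := ν) p q ha0
    have k3 : Real.exp (2 * ν * a) * (η / C) ^ 2 ≤ ∫ s in a..(a+1), Real.exp (2 * ν * s) *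
        ‖ι (φ.toFun s p) - ι (φ.toFun s q)‖ ^ 2 := by
      have := intervalIntegral.integral_mono_on (a := a) (b := a + 1) (by linarith)
        (f := fun _ => Real.exp (2 * ν * a) * (η / C) ^ 2) (by simp) (hi a (a+1) ha0 (by linarith))
        (fun s hs => by
          have := hcon s hs
          have h1 : Real.exp (2 * ν * a) ≤ Real.exp (2 * ν * s) :=
            Real.exp_le_exp.2 (by have := hs.1; gcongr)
          gcongr)
      simpa using this
    have := hS0 a (by linarith)
    linarith
  obtain ⟨s, hs, hsd⟩ := hex
  have hs0 : 0 ≤ s := ha0.trans hs.1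
  have hclose : ‖φ.toFun (τS + s) p - φ.toFun (τS + s) q‖ < η := by
    rw [φ.map_add' _ _ hτS hs0, φ.map_add' _ _ hτS hs0]
    refine (hsm _ _).trans_lt ?_
    calc _ < C * (η / C) := by gcongr
      _ = η := by field_simp
  have hs1 := hs.1
  have hs2 := hs.2
  have := hu _ (hp (τS + s) (by linarith)) _ (hq (τS + s) (by linarith)) hclose (t - (τS + s))
    ⟨by linarith, by linarith⟩
  rwa [← φ.map_add' _ _ (by linarith) (by linarith), ← φ.map_add' _ _ (by linarith) (by linarith),
    sub_add_cancel] at this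

/-- uniform negativity in the second case -/
lemma unif_neg (h3 : φ.IsH3 ι P δ τV ν) (hK : IsCompact K)
    (hsurj : ∀ t, 0 ≤ t → ∀ p ∈ K, ∃ q ∈ K, φ.toFun t q = p) {w : E}
    (hneg : ∀ p ∈ K, ∃ t ≥ 0, P (φ.toFun t w - φ.toFun t p) (φ.toFun t w - φ.toFun t p) < 0) :
    ∃ T ≥ 0, ∀ t ≥ T, ∀ z ∈ K, P (φ.toFun t w - z) (φ.toFun t w - z) < 0 := by
  have main : ∃ T ≥ 0, ∀ t ≥ T, ∀ p ∈ K,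
      P (φ.toFun t w - φ.toFun t p) (φ.toFun t w - φ.toFun t p) < 0 := by
    refine hK.induction_on (p := fun s => ∃ T ≥ 0, ∀ t ≥ T, ∀ p ∈ s,
      P (φ.toFun t w - φ.toFun t p) (φ.toFun t w - φ.toFun t p) < 0) ?_ ?_ ?_ ?_
    · exact ⟨0, le_rfl, fun t _ p hp => absurd hp (notMem_empty p)⟩
    · rintro s s' hss ⟨T, hT, h⟩
      exact ⟨T, hT, fun t ht p hp => h t ht p (hss hp)⟩
    · rintro s s' ⟨T, hT, h⟩ ⟨T', hT', h'⟩
      refine ⟨max T T', hT.trans (le_max_left _ _), fun t ht p hp => ?_⟩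
      rcases hp with hp | hp
      · exact h t ((le_max_left _ _).trans ht) p hp
      · exact h' t ((le_max_right _ _).trans ht) p hp
    · intro p hp
      obtain ⟨t, ht, hn⟩ := hneg p hp
      have hc : Continuous fun p => P (φ.toFun t w - φ.toFun t p) (φ.toFun t w - φ.toFun t p) := by
        have := flow_cont_space φ ht
        fun_prop
      have hev := hc.continuousAt.eventually_lt_const hn
      refine ⟨_, mem_nhdsWithin_of_mem_nhds hev, t + τV, by linarith [h3.2.1], fun r hr q hq => ?_⟩
      exact V_neg_persist h3 w q ht hr hq
  obtain ⟨T, hT, h⟩ := main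
  refine ⟨T, hT, fun t ht z hz => ?_⟩
  obtain ⟨p, hp, rfl⟩ := hsurj t (hT.le.trans ht) z hz
  exact h t ht p hp

end squeeze
end PBend

namespace PBend
section twosided
variable {E : Type*} [NormedAddCommGroup E] [NormedSpace ℝ E]

/-- two-sided extension of the semiflow on an invariant compact set -/
lemma exists_twosided (φ : Semiflow E) (K : Set E) (hK : IsCompact K)
    (hmaps : ∀ t, 0 ≤ t → ∀ p ∈ K, φ.toFun t p ∈ K)
    (hsurj : ∀ t, 0 ≤ t → ∀ p ∈ K, ∃ q ∈ K, φ.toFun t q = p)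
    (hinj : ∀ t, 0 ≤ t → ∀ p ∈ K, ∀ q ∈ K, φ.toFun t p = φ.toFun t q → p = q) :
    ∃ Θ : ℝ → E → E, (∀ t, ∀ p ∈ K, Θ t p ∈ K) ∧ (∀ t, 0 ≤ t → ∀ p ∈ K, Θ t p = φ.toFun t p) ∧
      (∀ s t, ∀ p ∈ K, Θ (s + t) p = Θ s (Θ t p)) ∧
      ContinuousOn (fun x : ℝ × E => Θ x.1 x.2) (univ ×ˢ K) := by
  have hex : ∀ t : ℝ, ∀ p : E, ∃ q, p ∈ K → (q ∈ K ∧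
      ∀ a b, 0 ≤ a → 0 ≤ b → a = b + t → φ.toFun a p = φ.toFun b q) := by
    intro t p
    by_cases hp : p ∈ K
    · set N := max 0 (-t)
      have hN : 0 ≤ N := le_max_left _ _
      have hN2 : -t ≤ N := le_max_right _ _
      obtain ⟨r, hr, hrp⟩ := hsurj N hN p hp
      refine ⟨φ.toFun (t + N) r, fun _ => ⟨hmaps _ (by linarith) r hr, fun a b ha hb hab => ?_⟩⟩
      rw [← hrp, ← φ.map_add' _ _ ha hN, ← φ.map_add' _ _ hb (by linarith), hab, add_assoc]
    · exact ⟨p, fun h => absurd h hp⟩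
  choose Θ hΘ using hex
  have hm : ∀ t, ∀ p ∈ K, Θ t p ∈ K := fun t p hp => (hΘ t p hp).1
  have hrel : ∀ t, ∀ p ∈ K, ∀ a b, 0 ≤ a → 0 ≤ b → a = b + t →
      φ.toFun a p = φ.toFun b (Θ t p) := fun t p hp => (hΘ t p hp).2
  refine ⟨Θ, hm, ?_, ?_, ?_⟩
  · intro t ht p hp
    have := hrel t p hp t 0 ht le_rfl (by ring)
    rw [this, φ.map_zero']
  · intro s t p hp
    set b := |s| + |t|
    have hs := neg_abs_le s
    have ht := neg_abs_le t
    have hs' := abs_nonneg s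
    have ht' := abs_nonneg t
    refine hinj b (by positivity) _ (hm _ _ hp) _ (hm _ _ (hm _ _ hp)) ?_
    rw [← hrel (s + t) p hp (b + (s + t)) b (by linarith) (by linarith) rfl,
      ← hrel s _ (hm t p hp) (b + s) b (by linarith) (by linarith) rfl,
      ← hrel t p hp (b + s + t) (b + s) (by linarith) (by linarith) rfl, ← add_assoc b s t]
  · rintro ⟨t0, p0⟩ ⟨-, hp0⟩
    set N := |t0| + 1
    have hN : 0 ≤ N := by positivity
    classical
    obtain ⟨g, hg⟩ : ∃ g : E → E, ∀ x ∈ K, g (φ.toFun N x) = x := by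
      refine ⟨fun y => if h : ∃ x ∈ K, φ.toFun N x = y then h.choose else y, fun x hx => ?_⟩
      have h : ∃ x' ∈ K, φ.toFun N x' = φ.toFun N x := ⟨x, hx, rfl⟩
      simp only [dif_pos h]
      exact hinj N hN _ h.choose_spec.1 _ hx h.choose_spec.2
    have hgc : ContinuousOn g (φ.toFun N '' K) :=
      inv_contOn hK (flow_cont_space φ hN).continuousOn hg
    have hcomp : ContinuousOn (fun x : ℝ × E => g (φ.toFun (N + x.1) x.2)) (Ioo (-N) N ×ˢ K) := by
      refine hgc.comp (g := g) (f := fun x : ℝ × E => φ.toFun (N + x.1) x.2) ?_ ?_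
      · refine φ.continuousOn'.comp (f := fun x : ℝ × E => (N + x.1, x.2)) (by fun_prop) ?_
        rintro ⟨t, p⟩ ⟨ht, hp⟩
        have := ht.1
        exact ⟨by show 0 ≤ N + t; simp only at this; linarith, mem_univ _⟩
      · rintro ⟨t, p⟩ ⟨ht, hp⟩
        have := ht.1
        simp only at this
        exact ⟨Θ t p, hm t p hp, (hrel t p hp (N + t) N (by linarith) hN rfl).symm⟩
    have hon : ContinuousOn (fun x : ℝ × E => Θ x.1 x.2) (Ioo (-N) N ×ˢ K) := by
      refine hcomp.congr ?_
      rintro ⟨t, p⟩ ⟨ht, hp⟩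
      have := ht.1
      simp only at this
      show Θ t p = g (φ.toFun (N + t) p)
      rw [hrel t p hp (N + t) N (by linarith) hN rfl, hg _ (hm t p hp)]
    have ht0 : t0 ∈ Ioo (-N) N := by
      have := neg_abs_le t0
      have := le_abs_self t0
      constructor <;> simp only [N] <;> linarith
    have := hon (t0, p0) ⟨ht0, hp0⟩
    refine this.mono_of_mem_nhdsWithin ?_
    rw [show (Ioo (-N) N ×ˢ K : Set (ℝ × E)) = (Ioo (-N) N ×ˢ univ) ∩ (univ ×ˢ K) by
      rw [prod_inter_prod, inter_univ, univ_inter]]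
    exact inter_mem (mem_nhdsWithin_of_mem_nhds
      ((isOpen_Ioo.prod isOpen_univ).mem_nhds ⟨ht0, mem_univ _⟩)) self_mem_nhdsWithin

end twosided

section final
variable {E : Type*} [NormedAddCommGroup E] [NormedSpace ℝ E]
variable {H : Type*} [NormedAddCommGroup H] [InnerProductSpace ℝ H]

theorem omega_main
    (ι : E →L[ℝ] H) (hι : Function.Injective ι)
    (φ : Semiflow E)
    (P : E →L[ℝ] E →L[ℝ] ℝ) (Eplus Eminus : Submodule ℝ E)
    (hH1 : Semiflow.IsH1 P Eplus Eminus)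
    [FiniteDimensional ℝ ↥Eminus] (hH2 : Module.finrank ℝ ↥Eminus = 2)
    (δ τV ν : ℝ) (hH3 : φ.IsH3 ι P δ τV ν)
    (hCOM : φ.IsCOM) (hS : φ.IsSmoothing ι)
    (w₀ : E) (hbdd : IsBounded (φ.orbit w₀))
    (v₀ : E) (hv₀ : v₀ ∈ φ.omegaLimit w₀) (hper : φ.IsPeriodicPt v₀) :
    φ.omegaLimit w₀ = φ.orbit v₀ := by
  obtain ⟨-, hcl, -, hcompl, hpos, -⟩ := hH1
  obtain ⟨pr, hpr⟩ := exists_planar_proj Eplus Eminus hcl hcompl hH2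
  have hprV : ∀ p q : E, P (p - q) (p - q) < 0 → pr p ≠ pr q := by
    intro p q hneg heq
    have h0 : pr (p - q) = 0 := by rw [map_sub, heq, sub_self]
    have h1 := hpr _ h0
    by_cases h2 : p - q = 0
    · rw [h2] at hneg; simp at hneg
    · exact absurd hneg (not_lt.2 (hpos _ h1 h2).le)
  obtain ⟨τ, hτ, hcom⟩ := hCOM
  set Q := closure (φ.toFun τ '' φ.orbit w₀) with hQdef
  have hQ : IsCompact Q := hcom _ hbdd
  have hQw : ∀ t ≥ τ, φ.toFun t w₀ ∈ Q := fun t ht => subset_closure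
    ⟨φ.toFun (t - τ) w₀, ⟨t - τ, by linarith, rfl⟩, by
      rw [← φ.map_add' _ _ hτ.le (by linarith)]; congr 1; ring⟩
  set K := φ.omegaLimit w₀ with hKdef
  have hKQ : K ⊆ Q := omega_sub hQ hQw
  have hKc : IsCompact K := hQ.of_isClosed_subset (omega_closed φ w₀) hKQ
  have hmaps : ∀ t, 0 ≤ t → ∀ p ∈ K, φ.toFun t p ∈ K := fun t ht p hp => omega_maps φ w₀ ht hp
  have hsurj : ∀ t, 0 ≤ t → ∀ p ∈ K, ∃ q ∈ K, φ.toFun t q = p := fun t ht p hp =>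
    omega_surj hQ hQw ht hp
  have hinj : ∀ t, 0 ≤ t → ∀ p ∈ K, ∀ q ∈ K, φ.toFun t p = φ.toFun t q → p = q :=
    fun t ht p hp q hq h => K_inj hι hH3 hKc hsurj hp hq ht h
  obtain ⟨Θ, Θm, Θφ, Θadd, Θc⟩ := exists_twosided φ K hKc hmaps hsurj hinj
  have prinj : ∀ p ∈ K, ∀ q ∈ K, pr p = pr q → p = q := by
    intro p hp q hq h
    by_contra hne
    exact hprV p q (K_neg hι hH3 hKc hsurj hp hq hne) h
  classical
  obtain ⟨g, hg⟩ : ∃ g : ℂ → E, ∀ x ∈ K, g (pr x) = x := by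
    refine ⟨fun y => if h : ∃ x ∈ K, pr x = y then h.choose else 0, fun x hx => ?_⟩
    have h : ∃ x' ∈ K, pr x' = pr x := ⟨x, hx, rfl⟩
    simp only [dif_pos h]
    exact prinj _ h.choose_spec.1 _ hx h.choose_spec.2
  have hgc : ContinuousOn g (pr '' K) := inv_contOn hKc pr.continuous.continuousOn hg
  set Ψ : ℝ → ℂ → ℂ := fun t z => pr (Θ t (g z)) with hΨ
  have hΨpr : ∀ t, ∀ p ∈ K, Ψ t (pr p) = pr (Θ t p) := by
    intro t p hp; simp only [hΨ, hg p hp]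
  have Ψcont : ContinuousOn (fun x : ℝ × ℂ => Ψ x.1 x.2) (univ ×ˢ (pr '' K)) := by
    refine pr.continuous.comp_continuousOn ?_
    refine Θc.comp (f := fun x : ℝ × ℂ => (x.1, g x.2)) ?_ ?_
    · exact continuousOn_fst.prodMk (hgc.comp continuousOn_snd fun x hx => hx.2)
    · rintro ⟨t, z⟩ ⟨-, x, hx, rfl⟩
      refine ⟨mem_univ _, ?_⟩
      show g (pr x) ∈ K
      rw [hg x hx]; exact hx
  have Θ0 : ∀ p ∈ K, Θ 0 p = p := fun p hp => by rw [Θφ 0 le_rfl p hp, φ.map_zero']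
  obtain ⟨hnst, σ, hσ, hσv⟩ := hper
  have prb : ∃ C > 0, ∀ u, ‖pr u‖ ≤ C * ‖u‖ := by
    refine ⟨‖pr‖ + 1, by positivity, fun u => (pr.le_opNorm u).trans ?_⟩
    gcongr
    linarith
  obtain ⟨C, hC, hprb⟩ := prb
  have prlt : ∀ a b : E, ∀ ε, ‖a - b‖ < ε / C → ‖pr a - pr b‖ < ε := by
    intro a b ε h
    rw [← map_sub]
    calc _ ≤ C * ‖a - b‖ := hprb _
      _ < C * (ε / C) := by gcongr
      _ = ε := by field_simp
  -- the planar curve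
  obtain ⟨w, T, hw, W1, W2, J⟩ : ∃ (w : ℝ → ℂ) (T : ℝ), ContinuousOn w (Ici T) ∧
      (∀ z ∈ pr '' K, ∀ S ε : ℝ, 0 < ε → ∃ t ≥ S, ‖w t - z‖ < ε) ∧
      (∀ ε N : ℝ, 0 < ε → ∃ S, ∀ t ≥ S, ∃ z ∈ pr '' K, ∀ s ∈ Icc (-N) N,
        ‖w (t + s) - Ψ s z‖ < ε) ∧
      (∀ y ≥ T, w y ∈ pr '' K → ∀ t ≥ 0, w (y + t) = Ψ t (w y)) := by
    by_cases hcase : ∃ p ∈ K, ∀ t ≥ 0,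
        0 ≤ P (φ.toFun t w₀ - φ.toFun t p) (φ.toFun t w₀ - φ.toFun t p)
    · obtain ⟨p, hp, hpp⟩ := hcase
      have htr := fun {ε : ℝ} (hε : 0 < ε) => track_lim hH3 hS hQ hQw
        (fun t (ht : t ≥ τ) => hKQ (hmaps t (hτ.le.trans ht) p hp)) hpp hε
      refine ⟨fun t => pr (φ.toFun t p), 0, pr.continuous.comp_continuousOn (flow_cont_time φ p),
        ?_, ?_, ?_⟩
      · rintro _ ⟨x, hx, rfl⟩ S ε hε
        obtain ⟨S1, hS1⟩ := htr (ε := ε / C / 2) (by positivity)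
        obtain ⟨t, ht, ht0, hd⟩ := (mem_omega_iff φ w₀ x).1 hx (max S S1) (ε / C / 2) (by positivity)
        refine ⟨t, (le_max_left _ _).trans ht, prlt _ _ _ ?_⟩
        have h1 := hS1 t ((le_max_right _ _).trans ht)
        calc ‖φ.toFun t p - x‖ = ‖(φ.toFun t w₀ - x) - (φ.toFun t w₀ - φ.toFun t p)‖ := by
              congr 1; abel
          _ ≤ _ := norm_sub_le _ _
          _ < ε / C := by linarith
      · intro ε N hε
        refine ⟨max N 0, fun t ht => ?_⟩
        have t1 := (le_max_left _ _).trans ht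
        have t0 := (le_max_right _ _).trans ht
        refine ⟨pr (φ.toFun t p), ⟨_, hmaps t t0 p hp, rfl⟩, fun s hs => ?_⟩
        have := hs.1
        rw [hΨpr s _ (hmaps t t0 p hp), ← Θφ t t0 p hp, ← Θadd s t p hp,
          Θφ (s + t) (by linarith) p hp, add_comm s t, sub_self, norm_zero]
        exact hε
      · intro y hy _ t ht
        show pr (φ.toFun (y + t) p) = Ψ t (pr (φ.toFun y p))
        rw [hΨpr t _ (hmaps y hy p hp), Θφ t ht _ (hmaps y hy p hp), ← φ.map_add' t y ht hy,
          add_comm]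
    · push Not at hcase
      obtain ⟨T, hT, hneg⟩ := unif_neg hH3 hKc hsurj hcase
      refine ⟨fun t => pr (φ.toFun t w₀), T, pr.continuous.comp_continuousOn
        ((flow_cont_time φ w₀).mono fun t ht => hT.le.trans ht), ?_, ?_, ?_⟩
      · rintro _ ⟨x, hx, rfl⟩ S ε hε
        obtain ⟨t, ht, ht0, hd⟩ := (mem_omega_iff φ w₀ x).1 hx S (ε / C) (by positivity)
        exact ⟨t, ht, prlt _ _ _ hd⟩
      · intro ε N hε
        set M := max N 0
        have hM0 : 0 ≤ M := le_max_right _ _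
        have hMN : N ≤ M := le_max_left _ _
        obtain ⟨η, hη, hu⟩ := flow_unif φ hQ (2 * M) (show 0 < ε / C by positivity)
        obtain ⟨S, hS⟩ := omega_attr hQ hQw hη
        refine ⟨max S τ + M, fun t ht => ?_⟩
        have s1 := le_max_left S τ
        have s2 := le_max_right S τ
        obtain ⟨z, hz, hzd⟩ := hS (t - M) (by linarith)
        refine ⟨pr (φ.toFun M z), ⟨_, hmaps M hM0 z hz, rfl⟩, fun s hs => ?_⟩
        have hs1 := hs.1
        have hs2 := hs.2
        have h1 := hu _ (hQw (t - M) (by linarith)) z (hKQ hz) hzd (M + s)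
          ⟨by linarith, by linarith⟩
        rw [← φ.map_add' _ _ (by linarith) (by linarith), show M + s + (t - M) = t + s by ring] at h1
        rw [hΨpr s _ (hmaps M hM0 z hz), ← Θφ M hM0 z hz, ← Θadd s M z hz,
          Θφ (s + M) (by linarith) z hz, add_comm s M]
        exact prlt _ _ _ h1
      · rintro y hy ⟨x, hx, hxy⟩
        exact absurd hxy.symm (hprV _ _ (hneg y hy x hx))
  have hfin := planar_final (pr '' K) (hKc.image pr.continuous) Ψ
    (by rintro t _ ⟨x, hx, rfl⟩; rw [hΨpr t x hx]; exact ⟨_, Θm t x hx, rfl⟩)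
    (by rintro _ ⟨x, hx, rfl⟩; rw [hΨpr 0 x hx, Θ0 x hx])
    (by
      rintro s t _ ⟨x, hx, rfl⟩
      rw [hΨpr _ x hx, hΨpr t x hx, hΨpr s _ (Θm t x hx), Θadd s t x hx])
    Ψcont w T hw W1 W2 J (pr v₀) ⟨v₀, hv₀, rfl⟩ σ hσ
    (by rw [hΨpr σ v₀ hv₀, Θφ σ hσ.le v₀ hv₀, hσv])
    (by
      by_contra hcon
      push Not at hcon
      refine hnst fun t ht => ?_
      have := hcon t
      rw [hΨpr t v₀ hv₀, Θφ t ht v₀ hv₀] at this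
      exact prinj _ (hmaps t ht v₀ hv₀) _ hv₀ this)
  apply Subset.antisymm
  · intro x hx
    obtain ⟨s, hs⟩ := hfin (pr x) ⟨x, hx, rfl⟩
    rw [hΨpr s v₀ hv₀] at hs
    have hsx := prinj _ (Θm s v₀ hv₀) _ hx hs
    have hperk : ∀ n : ℕ, Θ (s + n * σ) v₀ = Θ s v₀ := by
      intro n
      induction n with
      | zero => simp
      | succ n ih =>
        rw [show s + ((n + 1 : ℕ) : ℝ) * σ = (s + n * σ) + σ by push_cast; ring,
          Θadd _ _ v₀ hv₀, Θφ σ hσ.le v₀ hv₀, hσv, ih]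
    obtain ⟨n, hn⟩ := exists_nat_ge (-s / σ)
    rw [div_le_iff₀ hσ] at hn
    have h0 : 0 ≤ s + n * σ := by linarith
    refine ⟨s + n * σ, h0, ?_⟩
    rw [← Θφ _ h0 v₀ hv₀, hperk n, hsx]
  · rintro _ ⟨t, ht, rfl⟩
    exact hmaps t ht v₀ hv₀

end final
end PBend

/-- Lemma 4: if the ω-limit set of a point with bounded positive semi-orbit contains a
periodic point `v₀`, then it equals the periodic orbit `γ(v₀)`. -/
theorem omegaLimit_eq_orbit_of_periodicPt
    {E : Type*} [NormedAddCommGroup E] [NormedSpace ℝ E]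
    {H : Type*} [NormedAddCommGroup H] [InnerProductSpace ℝ H]
    (ι : E →L[ℝ] H) (hι : Function.Injective ι)
    (φ : Semiflow E)
    (P : E →L[ℝ] E →L[ℝ] ℝ) (Eplus Eminus : Submodule ℝ E)
    (hH1 : Semiflow.IsH1 P Eplus Eminus)
    [FiniteDimensional ℝ ↥Eminus] (hH2 : Module.finrank ℝ ↥Eminus = 2)
    (δ τV ν : ℝ) (hH3 : φ.IsH3 ι P δ τV ν)
    (hCOM : φ.IsCOM) (hS : φ.IsSmoothing ι)
    (w₀ : E) (hbdd : IsBounded (φ.orbit w₀))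
    (v₀ : E) (hv₀ : v₀ ∈ φ.omegaLimit w₀) (hper : φ.IsPeriodicPt v₀) :
    φ.omegaLimit w₀ = φ.orbit v₀ := by
  exact PBend.omega_main ι hι φ P Eplus Eminus hH1 hH2 δ τV ν hH3 hCOM hS w₀ hbdd v₀ hv₀ hper
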